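/- Let N ≥ 1 and m ≥ 1 be integers and let q be a real number with q > 1 if N ≤ 2m and 1 < q ≤ (N+2m)/(N−2m) if N > 2m. If u is a bounded classical solution of the half-space Dirichlet problem (−Δ)^m u = u^q with u ≥ 0, then u ≡ 0. -/

import Mathlib

noncomputable def lap {N : ℕ} (f : EuclideanSpace ℝ (Fin N) → ℝ)
    (x : EuclideanSpace ℝ (Fin N)) : ℝ :=
  ∑ i : Fin N, iteratedDeriv 2 (fun t : ℝ => f (x + t • EuclideanSpace.single i (1 : ℝ))) 0

noncomputable def polyLap {N : ℕ} (m : ℕ) (f : EuclideanSpace ℝ (Fin N) → ℝ)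
    (x : EuclideanSpace ℝ (Fin N)) : ℝ :=
  (-1 : ℝ) ^ m * (lap^[m] f x)

/-- The first coordinate vector `e₁ = (1,0,…,0)` of `ℝ^N`. -/
noncomputable def e1 (N : ℕ) [NeZero N] : EuclideanSpace ℝ (Fin N) :=
  EuclideanSpace.single 0 1

/-- `u` is a bounded classical solution of the half-space Dirichlet problem
`(-Δ)^m u = u^q`:  `u` is `C^{2m}` in the open half-space `{x₁ > 0}`, `u` and its
derivatives of order `≤ 2m-1` extend continuously to the closed half-space
(i.e. `u` is `C^{2m-1}` there) and are bounded there, `u` solves the equation in the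
open half-space, and the Dirichlet boundary conditions
`∂^j u/∂x₁^j = 0`, `j = 0,…,m-1`, hold on `{x₁ = 0}`. -/
def IsBCSol (N m : ℕ) [NeZero N] (q : ℝ) (u : EuclideanSpace ℝ (Fin N) → ℝ) : Prop :=
  ContDiffOn ℝ (2 * m : ℕ) u {x : EuclideanSpace ℝ (Fin N) | 0 < x 0} ∧
  ContDiffOn ℝ (2 * m - 1 : ℕ) u {x : EuclideanSpace ℝ (Fin N) | 0 ≤ x 0} ∧
  (∀ j : ℕ, j ≤ 2 * m - 1 → ∃ C : ℝ, ∀ x : EuclideanSpace ℝ (Fin N), 0 ≤ x 0 →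
    ‖iteratedFDerivWithin ℝ j u {y : EuclideanSpace ℝ (Fin N) | 0 ≤ y 0} x‖ ≤ C) ∧
  (∀ x : EuclideanSpace ℝ (Fin N), 0 < x 0 → polyLap m u x = u x ^ q) ∧
  (∀ j : ℕ, j < m → ∀ x : EuclideanSpace ℝ (Fin N), x 0 = 0 →
    iteratedFDerivWithin ℝ j u {y : EuclideanSpace ℝ (Fin N) | 0 ≤ y 0} x (fun _ => e1 N) = 0)

open Set Filter Topology MeasureTheory
open scoped ContDiff

abbrev Euc (N : ℕ) := EuclideanSpace ℝ (Fin N)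

/-- The `i`-th coordinate vector. -/
noncomputable abbrev bv {N : ℕ} (i : Fin N) : Euc N := EuclideanSpace.single i (1 : ℝ)

/-- The `i`-th partial derivative. -/
noncomputable def pd {N : ℕ} (i : Fin N) (f : Euc N → ℝ) (x : Euc N) : ℝ :=
  lineDeriv ℝ f x (bv i)

section Lap
variable {N : ℕ} {U : Set (Euc N)} {f g : Euc N → ℝ}

lemma lap_eq_sum (f : Euc N → ℝ) (x : Euc N) : lap f x = ∑ i, pd i (pd i f) x := by
  unfold lap
  refine Finset.sum_congr rfl fun i _ => ?_
  rw [iteratedDeriv_succ, iteratedDeriv_one]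
  unfold pd lineDeriv
  congr 1
  funext t
  have := deriv_comp_const_add (fun s : ℝ => f (x + s • bv i)) t 0
  rw [add_zero] at this
  rw [← this]
  congr 1
  funext s
  rw [add_smul, add_assoc]

lemma pd_eq_fderiv {i : Fin N} {x : Euc N} (hf : DifferentiableAt ℝ f x) :
    pd i f x = fderiv ℝ f x (bv i) := hf.lineDeriv_eq_fderiv

lemma ContDiffOn.pd {n m : WithTop ℕ∞} (hU : IsOpen U) (hf : ContDiffOn ℝ n f U)
    (h : m + 1 ≤ n) (i : Fin N) : ContDiffOn ℝ m (pd i f) U := by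
  have h1 : (1 : WithTop ℕ∞) ≤ n := le_trans (by simp) h
  have : ContDiffOn ℝ m (fun x => fderiv ℝ f x (bv i)) U :=
    (hf.fderiv_of_isOpen hU h).clm_apply contDiffOn_const
  refine this.congr fun x hx => pd_eq_fderiv ?_
  exact (hf.differentiableOn (by positivity)).differentiableAt (hU.mem_nhds hx)

lemma pd_congr (hU : IsOpen U) (h : EqOn f g U) (i : Fin N) : EqOn (pd i f) (pd i g) U :=
  fun _ hx => (h.eventuallyEq_of_mem (hU.mem_nhds hx)).lineDeriv_eq

lemma lap_congr (hU : IsOpen U) (h : EqOn f g U) : EqOn (lap f) (lap g) U := by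
  intro x hx
  rw [lap_eq_sum, lap_eq_sum]
  exact Finset.sum_congr rfl fun i _ => pd_congr hU (pd_congr hU h i) i hx

lemma lap_iter_congr (hU : IsOpen U) (h : EqOn f g U) (k : ℕ) :
    EqOn (lap^[k] f) (lap^[k] g) U := by
  induction k with
  | zero => simpa using h
  | succ k ih => rw [Function.iterate_succ_apply', Function.iterate_succ_apply']; exact lap_congr hU ih

lemma ContDiffOn.lap {n m : WithTop ℕ∞} (hU : IsOpen U) (hf : ContDiffOn ℝ n f U)
    (h : m + 2 ≤ n) : ContDiffOn ℝ m (lap f) U := by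
  have h' : (m + 1) + 1 ≤ n := by rwa [add_assoc, one_add_one_eq_two]
  have : ContDiffOn ℝ m (fun x => ∑ i, _root_.pd i (_root_.pd i f) x) U :=
    ContDiffOn.sum fun i _ => (hf.pd hU h' i).pd hU le_rfl i
  exact this.congr fun x _ => lap_eq_sum f x

lemma ContDiffOn.lap_iter {m : WithTop ℕ∞} (hU : IsOpen U) (k : ℕ) :
    ∀ {f : Euc N → ℝ}, ContDiffOn ℝ (m + (2 * k : ℕ)) f U → ContDiffOn ℝ m (_root_.lap^[k] f) U := by
  induction k with
  | zero => intro f hf; simpa using hf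
  | succ k ih =>
    intro f hf
    rw [Function.iterate_succ_apply]
    refine ih (hf.lap hU ?_)
    rw [add_assoc]; push_cast; rw [mul_add, mul_one]

lemma ContDiffOn.lap_iter_infty (hU : IsOpen U) (k : ℕ) (hf : ContDiffOn ℝ ∞ f U) :
    ContDiffOn ℝ ∞ (_root_.lap^[k] f) U := by
  refine ContDiffOn.lap_iter hU k (hf.of_le ?_)
  change ((⊤ : ℕ∞) : WithTop ℕ∞) + (((2 * k : ℕ) : ℕ∞) : WithTop ℕ∞) ≤ _
  rw [← WithTop.coe_add, top_add]

lemma pd_add {i : Fin N} {x : Euc N} (hf : DifferentiableAt ℝ f x) (hg : DifferentiableAt ℝ g x) :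
    pd i (fun y => f y + g y) x = pd i f x + pd i g x := by
  rw [pd_eq_fderiv (hf.fun_add hg), pd_eq_fderiv hf, pd_eq_fderiv hg, fderiv_fun_add hf hg]; rfl

lemma pd_mul {i : Fin N} {x : Euc N} (hf : DifferentiableAt ℝ f x) (hg : DifferentiableAt ℝ g x) :
    pd i (fun y => f y * g y) x = pd i f x * g x + f x * pd i g x := by
  rw [pd_eq_fderiv (hf.fun_mul hg), pd_eq_fderiv hf, pd_eq_fderiv hg, fderiv_fun_mul hf hg]
  simp; ring

lemma ContDiffOn.diffAt {n : WithTop ℕ∞} (hU : IsOpen U) (hf : ContDiffOn ℝ n f U) (hn : 1 ≤ n) {x : Euc N}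
    (hx : x ∈ U) : DifferentiableAt ℝ f x :=
  (hf.differentiableOn (by positivity)).differentiableAt (hU.mem_nhds hx)

lemma lap_add (hU : IsOpen U) (hf : ContDiffOn ℝ 2 f U) (hg : ContDiffOn ℝ 2 g U) {x : Euc N}
    (hx : x ∈ U) : lap (fun y => f y + g y) x = lap f x + lap g x := by
  simp_rw [lap_eq_sum, ← Finset.sum_add_distrib]
  refine Finset.sum_congr rfl fun i _ => ?_
  have h1 : EqOn (pd i (fun y => f y + g y)) (fun y => pd i f y + pd i g y) U := fun y hy =>
    pd_add (hf.diffAt hU one_le_two hy) (hg.diffAt hU one_le_two hy)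
  rw [pd_congr hU h1 i hx]
  have e : (1 : WithTop ℕ∞) + 1 ≤ 2 := by rw [one_add_one_eq_two]
  exact pd_add ((hf.pd hU e i).diffAt hU le_rfl hx) ((hg.pd hU e i).diffAt hU le_rfl hx)

lemma lap_mul (hU : IsOpen U) (hf : ContDiffOn ℝ 2 f U) (hg : ContDiffOn ℝ 2 g U) {x : Euc N}
    (hx : x ∈ U) : lap (fun y => f y * g y) x =
      lap f x * g x + 2 * ∑ i, pd i f x * pd i g x + f x * lap g x := by
  simp_rw [lap_eq_sum, Finset.sum_mul, Finset.mul_sum, ← Finset.sum_add_distrib]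
  refine Finset.sum_congr rfl fun i _ => ?_
  have h1 : EqOn (pd i (fun y => f y * g y)) (fun y => pd i f y * g y + f y * pd i g y) U :=
    fun y hy => pd_mul (hf.diffAt hU one_le_two hy) (hg.diffAt hU one_le_two hy)
  rw [pd_congr hU h1 i hx]
  have e : (1 : WithTop ℕ∞) + 1 ≤ 2 := by rw [one_add_one_eq_two]
  have df := (hf.pd hU e i).diffAt hU le_rfl hx
  have dg := (hg.pd hU e i).diffAt hU le_rfl hx
  have df0 := hf.diffAt hU one_le_two hx
  have dg0 := hg.diffAt hU one_le_two hx
  rw [pd_add (df.fun_mul dg0) (df0.fun_mul dg), pd_mul df dg0, pd_mul df0 dg]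
  ring

lemma lap_const_mul (hU : IsOpen U) (hf : ContDiffOn ℝ 2 f U) (c : ℝ) {x : Euc N}
    (hx : x ∈ U) : lap (fun y => c * f y) x = c * lap f x := by
  rw [lap_mul (f := fun _ => c) hU contDiffOn_const hf hx]
  have : ∀ y i, pd i (fun _ : Euc N => c) y = 0 := fun y i => by
    rw [pd_eq_fderiv (by fun_prop)]; simp
  have h2 : lap (fun _ : Euc N => c) x = 0 := by
    rw [lap_eq_sum]
    refine Finset.sum_eq_zero fun i _ => ?_
    have : pd i (fun _ : Euc N => c) = fun _ => 0 := funext fun y => this y i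
    rw [this, pd_eq_fderiv (by fun_prop)]; simp
  simp [this, h2]

lemma lap_iter_add (hU : IsOpen U) (k : ℕ) : ∀ {f g : Euc N → ℝ}, ContDiffOn ℝ (2 * k : ℕ) f U →
    ContDiffOn ℝ (2 * k : ℕ) g U →
    EqOn (lap^[k] (fun y => f y + g y)) (fun x => lap^[k] f x + lap^[k] g x) U := by
  induction k with
  | zero => intro f g _ _ x _; simp
  | succ k ih =>
    intro f g hf hg x hx
    rw [Function.iterate_succ_apply, Function.iterate_succ_apply, Function.iterate_succ_apply]
    have e : ((2 * k : ℕ) : WithTop ℕ∞) + 2 ≤ ((2 * (k + 1) : ℕ) : WithTop ℕ∞) := by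
      rw [mul_add, mul_one]; push_cast; exact le_rfl
    have e2 : (2 : WithTop ℕ∞) ≤ ((2 * (k + 1) : ℕ) : WithTop ℕ∞) := le_trans (by simp) e
    have := lap_iter_congr hU (f := lap fun y => f y + g y) (g := fun y => lap f y + lap g y)
      (fun y hy => lap_add hU (hf.of_le e2) (hg.of_le e2) hy) k hx
    rw [this]
    exact ih (hf.lap hU e) (hg.lap hU e) hx

lemma lap_iter_const_mul (hU : IsOpen U) (c : ℝ) (k : ℕ) : ∀ {f : Euc N → ℝ},
    ContDiffOn ℝ (2 * k : ℕ) f U →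
    EqOn (lap^[k] (fun y => c * f y)) (fun x => c * lap^[k] f x) U := by
  induction k with
  | zero => intro f _ x _; simp
  | succ k ih =>
    intro f hf x hx
    rw [Function.iterate_succ_apply, Function.iterate_succ_apply]
    have e : ((2 * k : ℕ) : WithTop ℕ∞) + 2 ≤ ((2 * (k + 1) : ℕ) : WithTop ℕ∞) := by
      rw [mul_add, mul_one]; push_cast; exact le_rfl
    have e2 : (2 : WithTop ℕ∞) ≤ ((2 * (k + 1) : ℕ) : WithTop ℕ∞) := le_trans (by simp) e
    rw [lap_iter_congr hU (f := lap fun y => c * f y) (g := fun y => c * lap f y)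
      (fun y hy => lap_const_mul hU (hf.of_le e2) c hy) k hx]
    exact ih (hf.lap hU e) hx

end Lap

section IBP
variable {N : ℕ} {U : Set (Euc N)} {f g φ : Euc N → ℝ}

lemma tsupport_pd_subset (i : Fin N) (φ : Euc N → ℝ) : tsupport (pd i φ) ⊆ tsupport φ := by
  refine closure_minimal (fun x hx => ?_) (isClosed_tsupport φ)
  by_contra h
  apply hx
  have : EqOn φ (fun _ => 0) (tsupport φ)ᶜ := fun y hy => image_eq_zero_of_notMem_tsupport hy
  rw [pd_congr (isClosed_tsupport φ).isOpen_compl this i h, pd_eq_fderiv (by fun_prop)]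
  simp

lemma tsupport_lap_subset (φ : Euc N → ℝ) : tsupport (lap φ) ⊆ tsupport φ := by
  refine closure_minimal (fun x hx => ?_) (isClosed_tsupport φ)
  by_contra h
  apply hx
  rw [lap_eq_sum]
  refine Finset.sum_eq_zero fun i _ => ?_
  by_contra h2
  exact h (tsupport_pd_subset i φ (tsupport_pd_subset i _ (subset_tsupport _ h2)))

lemma tsupport_lap_iter_subset (k : ℕ) (φ : Euc N → ℝ) : tsupport (lap^[k] φ) ⊆ tsupport φ := by
  induction k with
  | zero => simp
  | succ k ih => rw [Function.iterate_succ_apply']; exact (tsupport_lap_subset _).trans ih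

lemma HasCompactSupport.mono_tsupport (hc : HasCompactSupport φ) (h : tsupport g ⊆ tsupport φ) :
    HasCompactSupport g := hc.of_isClosed_subset (isClosed_tsupport g) h

lemma continuous_mul_of_tsupport (hU : IsOpen U) (hg : ContinuousOn g U) (hφ : Continuous φ)
    (hs : tsupport φ ⊆ U) : Continuous (fun x => g x * φ x) := by
  have h1 : ContinuousOn (fun x => g x * φ x) U := hg.mul hφ.continuousOn
  exact h1.continuous_of_tsupport_subset hU ((tsupport_mul_subset_right (f := g) (g := φ)).trans hs)

lemma integrable_mul_of_tsupport (hU : IsOpen U) (hg : ContinuousOn g U) (hφ : Continuous φ)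
    (hc : HasCompactSupport φ) (hs : tsupport φ ⊆ U) : Integrable (fun x => g x * φ x) :=
  (continuous_mul_of_tsupport hU hg hφ hs).integrable_of_hasCompactSupport
    (HasCompactSupport.mul_left hc)

lemma ContDiff.pd_contDiff {n m : WithTop ℕ∞} (hφ : ContDiff ℝ n φ) (h : m + 1 ≤ n) (i : Fin N) :
    ContDiff ℝ m (pd i φ) :=
  contDiffOn_univ.1 (hφ.contDiffOn.pd isOpen_univ h i)

lemma ContDiff.lap_contDiff {n m : WithTop ℕ∞} (hφ : ContDiff ℝ n φ) (h : m + 2 ≤ n) :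
    ContDiff ℝ m (lap φ) :=
  contDiffOn_univ.1 (hφ.contDiffOn.lap isOpen_univ h)

lemma ContDiff.lap_iter_contDiff {m : WithTop ℕ∞} (k : ℕ) (hφ : ContDiff ℝ (m + (2 * k : ℕ)) φ) :
    ContDiff ℝ m (lap^[k] φ) :=
  contDiffOn_univ.1 (ContDiffOn.lap_iter isOpen_univ k hφ.contDiffOn)

lemma integral_mul_pd (hU : IsOpen U) (hg : ContDiffOn ℝ 1 g U) (hφ : ContDiff ℝ 1 φ)
    (hc : HasCompactSupport φ) (hs : tsupport φ ⊆ U) (i : Fin N) :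
    ∫ x, g x * pd i φ x = - ∫ x, pd i g x * φ x := by
  have hpφ : Continuous (pd i φ) :=
    (hφ.pd_contDiff (m := 0) (by simp) i).continuous
  have hpg : ContinuousOn (pd i g) U := (hg.pd hU (m := 0) (by simp) i).continuousOn
  refine integral_bilinear_hasLineDerivAt_right_eq_neg_left_of_integrable
    (B := ContinuousLinearMap.mul ℝ ℝ) (v := bv i) (f := g) (g := φ) ?_ ?_ ?_ ?_ ?_
  · exact integrable_mul_of_tsupport hU hpg hφ.continuous hc hs
  · exact integrable_mul_of_tsupport hU hg.continuousOn hpφ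
      (hc.mono_tsupport (tsupport_pd_subset i φ)) ((tsupport_pd_subset i φ).trans hs)
  · exact integrable_mul_of_tsupport hU hg.continuousOn hφ.continuous hc hs
  · intro x hx
    exact (hg.diffAt hU le_rfl (hs hx)).lineDifferentiableAt.hasLineDerivAt
  · intro x _
    exact (hφ.differentiable one_ne_zero x).lineDifferentiableAt.hasLineDerivAt

lemma integral_mul_lap (hU : IsOpen U) (hg : ContDiffOn ℝ 2 g U) (hφ : ContDiff ℝ 2 φ)
    (hc : HasCompactSupport φ) (hs : tsupport φ ⊆ U) :
    ∫ x, g x * lap φ x = ∫ x, lap g x * φ x := by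
  have e : (1 : WithTop ℕ∞) + 1 ≤ 2 := by rw [one_add_one_eq_two]
  have e0 : (0 : WithTop ℕ∞) + 1 ≤ 1 := by simp
  simp_rw [lap_eq_sum, Finset.mul_sum, Finset.sum_mul]
  rw [integral_finsetSum, integral_finsetSum]
  · refine Finset.sum_congr rfl fun i _ => ?_
    have t1 := tsupport_pd_subset i φ
    rw [integral_mul_pd hU (hg.of_le one_le_two) (hφ.pd_contDiff e i) (hc.mono_tsupport t1)
      (t1.trans hs), integral_mul_pd hU (hg.pd hU e i) (hφ.of_le one_le_two) hc hs, neg_neg]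
  · intro i _
    exact integrable_mul_of_tsupport hU ((hg.pd hU e i).pd hU e0 i).continuousOn hφ.continuous hc hs
  · intro i _
    have t2 := (tsupport_pd_subset i _).trans (tsupport_pd_subset i φ)
    exact integrable_mul_of_tsupport hU hg.continuousOn
      ((hφ.pd_contDiff e i).pd_contDiff e0 i).continuous (hc.mono_tsupport t2) (t2.trans hs)

lemma integral_mul_lap_iter (hU : IsOpen U) (hc : HasCompactSupport φ) (hs : tsupport φ ⊆ U)
    (k : ℕ) : ∀ {g : Euc N → ℝ}, ContDiffOn ℝ (2 * k : ℕ) g U → ContDiff ℝ (2 * k : ℕ) φ →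
    ∫ x, g x * lap^[k] φ x = ∫ x, lap^[k] g x * φ x := by
  induction k with
  | zero => intro g _ _; simp
  | succ k ih =>
    intro g hg hφ
    have e : ((2 * k : ℕ) : WithTop ℕ∞) + 2 ≤ ((2 * (k + 1) : ℕ) : WithTop ℕ∞) := by
      rw [mul_add, mul_one]; push_cast; exact le_rfl
    have e2 : (2 : WithTop ℕ∞) ≤ ((2 * (k + 1) : ℕ) : WithTop ℕ∞) := le_trans (by simp) e
    have t := tsupport_lap_iter_subset k φ
    rw [Function.iterate_succ_apply' lap k φ, Function.iterate_succ_apply lap k g,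
      integral_mul_lap hU (hg.of_le e2) (ContDiff.lap_iter_contDiff k (hφ.of_le ?_))
        (hc.mono_tsupport t) (t.trans hs)]
    · exact ih (hg.lap hU e) (hφ.of_le (le_trans (by simp) e))
    · rw [add_comm]; exact e

lemma contDiff_mul_of_tsupport {n : WithTop ℕ∞} (hU : IsOpen U) (hg : ContDiffOn ℝ n g U)
    (hφ : ContDiff ℝ n φ) (hs : tsupport φ ⊆ U) : ContDiff ℝ n (fun x => g x * φ x) := by
  refine contDiff_iff_contDiffAt.2 fun x => ?_
  by_cases hx : x ∈ tsupport φ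
  · exact (hg.contDiffAt (hU.mem_nhds (hs hx))).mul hφ.contDiffAt
  · refine (contDiffAt_const (c := (0 : ℝ))).congr_of_eventuallyEq ?_
    filter_upwards [(notMem_tsupport_iff_eventuallyEq.1 hx)] with y hy
    simp [hy]

end IBP

section Calc
variable {N : ℕ} {U : Set (Euc N)} {f g : Euc N → ℝ}

lemma pd_comp {i : Fin N} {x : Euc N} {φ : ℝ → ℝ} {d : ℝ} (hφ : HasDerivAt φ d (f x))
    (hf : DifferentiableAt ℝ f x) : pd i (fun y => φ (f y)) x = d * pd i f x := by
  have h := hφ.comp_hasFDerivAt x hf.hasFDerivAt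
  rw [pd_eq_fderiv hf, pd_eq_fderiv (f := fun y => φ (f y)) h.differentiableAt]
  have := h.fderiv
  simp only [Function.comp_def] at this
  rw [this]; simp

lemma lap_comp (hU : IsOpen U) (hf : ContDiffOn ℝ 2 f U) {V : Set ℝ} (hV : ∀ y ∈ U, f y ∈ V)
    {φ φ₁ φ₂ : ℝ → ℝ} (h1 : ∀ s ∈ V, HasDerivAt φ (φ₁ s) s) (h2 : ∀ s ∈ V, HasDerivAt φ₁ (φ₂ s) s)
    {x : Euc N} (hx : x ∈ U) :
    lap (fun y => φ (f y)) x = φ₂ (f x) * ∑ i, pd i f x ^ 2 + φ₁ (f x) * lap f x := by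
  simp_rw [lap_eq_sum, Finset.mul_sum, ← Finset.sum_add_distrib]
  refine Finset.sum_congr rfl fun i _ => ?_
  have e : (1 : WithTop ℕ∞) + 1 ≤ 2 := by rw [one_add_one_eq_two]
  have h : EqOn (pd i (fun y => φ (f y))) (fun y => φ₁ (f y) * pd i f y) U := fun y hy =>
    pd_comp (h1 _ (hV y hy)) (hf.diffAt hU one_le_two hy)
  have df0 := hf.diffAt hU one_le_two hx
  have df := (hf.pd hU e i).diffAt hU le_rfl hx
  have d1 : DifferentiableAt ℝ (fun y => φ₁ (f y)) x :=
    ((h2 _ (hV x hx)).differentiableAt.comp x df0)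
  rw [pd_congr hU h i hx, pd_mul d1 df, pd_comp (h2 _ (hV x hx)) df0]
  ring

lemma pd_const_mul {i : Fin N} {x : Euc N} (c : ℝ) (hf : DifferentiableAt ℝ f x) :
    pd i (fun y => c * f y) x = c * pd i f x :=
  pd_comp (φ := fun s => c * s) (by simpa using (hasDerivAt_id (f x)).const_mul c) hf

lemma pd_const {i : Fin N} {x : Euc N} (c : ℝ) : pd i (fun _ : Euc N => c) x = 0 := by
  rw [pd_eq_fderiv (by fun_prop)]; simp

lemma pd_coord (i j : Fin N) (x : Euc N) : pd i (fun y => y j) x = if i = j then 1 else 0 := by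
  have : HasLineDerivAt ℝ (fun y : Euc N => y j) (if i = j then 1 else 0) x (bv i) := by
    unfold HasLineDerivAt
    have : (fun t : ℝ => (x + t • bv i) j) = fun t => x j + t * (if i = j then 1 else 0) := by
      funext t; simp [bv, eq_comm]
    rw [this]
    simpa using ((hasDerivAt_id (0 : ℝ)).mul_const (if i = j then (1 : ℝ) else 0)).const_add (x j)
  exact this.lineDeriv

lemma pd_normSq (i : Fin N) (a x : Euc N) : pd i (fun y => ‖a - y‖ ^ 2) x = 2 * (x i - a i) := by
  have : HasLineDerivAt ℝ (fun y : Euc N => ‖a - y‖ ^ 2) (2 * (x i - a i)) x (bv i) := by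
    unfold HasLineDerivAt
    have : (fun t : ℝ => ‖a - (x + t • bv i)‖ ^ 2) =
        fun t => ‖a - x‖ ^ 2 + t * (2 * (x i - a i)) + t ^ 2 := by
      funext t
      have : a - (x + t • bv i) = (a - x) - t • bv i := by abel
      rw [this, norm_sub_sq_real, inner_smul_right, norm_smul, EuclideanSpace.inner_single_right]
      simp
      ring
    rw [this]
    have h := (((hasDerivAt_id (0 : ℝ)).mul_const (2 * (x i - a i))).const_add (‖a - x‖ ^ 2)).add
      ((hasDerivAt_id (0 : ℝ)).pow 2)
    convert h using 1
    · funext t; simp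
    · simp
  exact this.lineDeriv

lemma contDiff_coord {n : WithTop ℕ∞} (j : Fin N) : ContDiff ℝ n (fun y : Euc N => y j) := by
  fun_prop

lemma contDiff_normSq {n : WithTop ℕ∞} (a : Euc N) : ContDiff ℝ n (fun y : Euc N => ‖a - y‖ ^ 2) :=
  (contDiff_const.sub contDiff_id).norm_sq ℝ

end Calc

section Kernel
variable {N : ℕ} [NeZero N]

/-- The quadratic form `(1-σ)|x-y|² + σ|x*-y|²`, with `x*` the reflection of `x`. -/
noncomputable def kQ (x : Euc N) (σ : ℝ) (y : Euc N) : ℝ := ‖x - y‖ ^ 2 + 4 * x 0 * y 0 * σ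

lemma contDiff_kQ {n : WithTop ℕ∞} (x : Euc N) (σ : ℝ) : ContDiff ℝ n (kQ x σ) := by
  unfold kQ
  exact (contDiff_normSq x).add ((contDiff_const.mul (contDiff_coord 0)).mul contDiff_const)

lemma pd_kQ (i : Fin N) (x : Euc N) (σ : ℝ) (y : Euc N) :
    pd i (kQ x σ) y = 2 * (y i - x i) + 4 * x 0 * σ * (if i = 0 then 1 else 0) := by
  have : kQ x σ = fun y => ‖x - y‖ ^ 2 + 4 * x 0 * σ * y 0 := by funext y; unfold kQ; ring
  rw [this, pd_add ((contDiff_normSq (n := 1) x).differentiable one_ne_zero _) (by fun_prop),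
    pd_normSq, pd_const_mul _ (by fun_prop), pd_coord]

lemma lap_kQ (x : Euc N) (σ : ℝ) (y : Euc N) : lap (kQ x σ) y = 2 * N := by
  rw [lap_eq_sum]
  have : ∀ i, pd i (pd i (kQ x σ)) y = 2 := by
    intro i
    have : pd i (kQ x σ) = fun y => 2 * y i + (-2 * x i + 4 * x 0 * σ * (if i = 0 then 1 else 0)) := by
      funext y; rw [pd_kQ]; ring
    rw [this, pd_add (by fun_prop) (by fun_prop), pd_const_mul _ (by fun_prop), pd_coord, pd_const]
    simp
  simp [this, mul_comm]

lemma lap_coord (y : Euc N) (j : Fin N) : lap (fun y : Euc N => y j) y = 0 := by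
  rw [lap_eq_sum]
  refine Finset.sum_eq_zero fun i _ => ?_
  have : pd i (fun y : Euc N => y j) = fun y => if i = j then 1 else 0 := by
    funext y; rw [pd_coord]
  rw [this, pd_const]

lemma sum_pd_kQ_sq (x : Euc N) (σ : ℝ) (y : Euc N) :
    ∑ i, pd i (kQ x σ) y ^ 2 = 4 * kQ x σ y - 4 * (4 * x 0 ^ 2) * σ * (1 - σ) := by
  have : ∀ i, pd i (kQ x σ) y ^ 2 = 4 * (x i - y i) ^ 2 +
      (if i = 0 then 16 * x 0 * σ * (y 0 - x 0) + 16 * x 0 ^ 2 * σ ^ 2 else 0) := by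
    intro i
    rw [pd_kQ]
    split_ifs with h
    · subst h; ring
    · ring
  simp_rw [this, Finset.sum_add_distrib, ← Finset.mul_sum]
  rw [Finset.sum_ite_eq' Finset.univ (0 : Fin N)]
  unfold kQ
  rw [EuclideanSpace.real_norm_sq_eq]
  simp
  ring

/-- The density of the polyharmonic Green function of the half-space of order `k + 1`. -/
noncomputable def kh (k : ℕ) (x : Euc N) (σ : ℝ) (y : Euc N) : ℝ :=
  (4 * x 0 * y 0) ^ (k + 1) * σ ^ k * kQ x σ y ^ (-((N : ℝ) / 2))

/-- The boundary term arising when `lap` is applied to `kh`. -/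
noncomputable def kB (k : ℕ) (x : Euc N) (σ : ℝ) (y : Euc N) : ℝ :=
  σ ^ k * (4 * x 0 * y 0) ^ k *
    (4 * ((N : ℝ) / 2) * (4 * x 0 ^ 2) * σ * (1 - σ) * kQ x σ y ^ (-((N : ℝ) / 2) - 1)
      + 4 * k * (x 0 / y 0 * σ + 1) * kQ x σ y ^ (-((N : ℝ) / 2)))

lemma kQ_pos {x y : Euc N} {σ : ℝ} (hx : 0 < x 0) (hy : 0 < y 0) (hσ : 0 < σ) : 0 < kQ x σ y := by
  unfold kQ; positivity

lemma isOpen_half : IsOpen {x : Euc N | 0 < x 0} :=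
  isOpen_lt continuous_const (by fun_prop)

lemma lap_kh (k : ℕ) {x y : Euc N} {σ : ℝ} (hx : 0 < x 0) (hy : 0 < y 0) (hσ : 0 < σ) :
    HasDerivAt (fun σ => kB k x σ y) (lap (kh k x σ) y + 4 * k ^ 2 * kh (k - 1) x σ y) σ := by
  have hQ := kQ_pos hx hy hσ
  have hU : IsOpen {x : Euc N | 0 < x 0} := isOpen_half
  set p : ℝ := (N : ℝ) / 2 with hp
  have c1 : ContDiffOn ℝ 2 (fun y : Euc N => (y 0) ^ (k + 1)) {x : Euc N | 0 < x 0} :=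
    ((contDiff_coord 0).pow _).contDiffOn
  have c2 : ContDiffOn ℝ 2 (fun y : Euc N => kQ x σ y ^ (-p)) {x : Euc N | 0 < x 0} :=
    (contDiff_kQ x σ).contDiffOn.rpow_const_of_ne fun y hy => (kQ_pos hx hy hσ).ne'
  have l1 := lap_comp (f := fun y : Euc N => y 0) (φ := fun s => s ^ (k + 1))
    (φ₁ := fun s => (k + 1) * s ^ k) (φ₂ := fun s => (k + 1) * (k * s ^ (k - 1)))
    hU (contDiff_coord 0).contDiffOn (V := univ) (by simp)
    (fun s _ => by simpa using hasDerivAt_pow (k + 1) s)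
    (fun s _ => by simpa using (hasDerivAt_pow k s).const_mul ((k : ℝ) + 1)) (x := y) hy
  have l2 := lap_comp (f := kQ x σ) (φ := fun s => s ^ (-p))
    (φ₁ := fun s => -p * s ^ (-p - 1)) (φ₂ := fun s => -p * ((-p - 1) * s ^ (-p - 1 - 1)))
    hU (contDiff_kQ x σ).contDiffOn (V := Ioi 0) (fun y hy => kQ_pos hx hy hσ)
    (fun s hs => Real.hasDerivAt_rpow_const (Or.inl (ne_of_gt hs)))
    (fun s hs => (Real.hasDerivAt_rpow_const (Or.inl (ne_of_gt hs))).const_mul _) (x := y) hy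
  have l3 : ∑ i, pd i (fun y : Euc N => (y 0) ^ (k + 1)) y * pd i (fun y => kQ x σ y ^ (-p)) y =
      (k + 1) * y 0 ^ k * (-p * kQ x σ y ^ (-p - 1)) * (2 * (y 0 - x 0) + 4 * x 0 * σ) := by
    have e1 : ∀ i, pd i (fun y : Euc N => (y 0) ^ (k + 1)) y =
        (k + 1) * y 0 ^ k * (if i = 0 then 1 else 0) := by
      intro i
      rw [pd_comp (φ := fun s => s ^ (k + 1)) (d := (k + 1) * y 0 ^ k)
        (by simpa using hasDerivAt_pow (k + 1) (y 0)) (by fun_prop), pd_coord]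
    have e2 : ∀ i, pd i (fun y : Euc N => kQ x σ y ^ (-p)) y =
        (-p * kQ x σ y ^ (-p - 1)) * pd i (kQ x σ) y := by
      intro i
      exact pd_comp (φ := fun s => s ^ (-p)) (Real.hasDerivAt_rpow_const (Or.inl hQ.ne'))
        ((contDiff_kQ (n := 1) x σ).differentiable one_ne_zero _)
    simp_rw [e1, e2, pd_kQ]
    simp
    ring
  have hk : kh k x σ = fun y => ((4 * x 0) ^ (k + 1) * σ ^ k) * ((y 0) ^ (k + 1) * kQ x σ y ^ (-p)) := by
    funext y; unfold kh; rw [mul_pow]; ring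
  have hlap : lap (kh k x σ) y = (4 * x 0) ^ (k + 1) * σ ^ k *
      (((k + 1) * (k * y 0 ^ (k - 1))) * kQ x σ y ^ (-p) + 2 * ((k + 1) * y 0 ^ k * (-p * kQ x σ y ^ (-p - 1)) * (2 * (y 0 - x 0) + 4 * x 0 * σ)) +
      y 0 ^ (k + 1) * (-p * ((-p - 1) * kQ x σ y ^ (-p - 1 - 1)) * (4 * kQ x σ y - 4 * (4 * x 0 ^ 2) * σ * (1 - σ)) + -p * kQ x σ y ^ (-p - 1) * (2 * N))) := by
    rw [hk, lap_const_mul hU (c1.mul c2) _ hy, lap_mul hU c1 c2 hy, l1, l2, l3, lap_coord,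
      sum_pd_kQ_sq, lap_kQ]
    simp [pd_coord]
  have dQ : HasDerivAt (fun σ => kQ x σ y) (4 * x 0 * y 0) σ := by
    unfold kQ
    simpa using ((hasDerivAt_id σ).const_mul (4 * x 0 * y 0)).const_add (‖x - y‖ ^ 2)
  have dP : ∀ r : ℝ, HasDerivAt (fun σ => kQ x σ y ^ r)
      (r * kQ x σ y ^ (r - 1) * (4 * x 0 * y 0)) σ := fun r => by
    have := dQ.rpow_const (p := r) (Or.inl hQ.ne')
    convert this using 1
    ring
  have dB := (((hasDerivAt_pow k σ).mul_const ((4 * x 0 * y 0) ^ k)).mul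
    (((((hasDerivAt_id σ).const_mul (4 * p * (4 * x 0 ^ 2))).mul
      ((hasDerivAt_id σ).const_sub 1)).mul (dP (-p - 1))).add
      ((((hasDerivAt_id σ).const_mul (x 0 / y 0)).add_const 1).const_mul (4 * (k : ℝ)) |>.mul (dP (-p)))))
  refine (dB.congr_of_eventuallyEq (Eventually.of_forall fun s => ?_)).congr_deriv ?_
  · simp [kB, hp]
  · rw [hlap]
    unfold kh
    rw [← hp]
    have hN : (N : ℝ) = 2 * p := by rw [hp]; ring
    have r1 : kQ x σ y ^ (-p - 1) = kQ x σ y ^ (-p - 1 - 1) * kQ x σ y := by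
      conv_lhs => rw [show -p - 1 = (-p - 1 - 1) + 1 by ring, Real.rpow_add_one hQ.ne']
    have r2 : kQ x σ y ^ (-p) = kQ x σ y ^ (-p - 1 - 1) * kQ x σ y ^ 2 := by
      conv_lhs => rw [show -p = (-p - 1 - 1) + (2 : ℕ) by push_cast; ring, Real.rpow_add_natCast hQ.ne']
    simp only [hN, r2, r1, id, Pi.mul_apply, Pi.add_apply]
    generalize kQ x σ y ^ (-p - 1 - 1) = R
    generalize kQ x σ y = Q at *
    rcases k with _ | k
    · simp
      ring
    · simp only [Nat.add_sub_cancel]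
      push_cast
      field_simp
      ring

end Kernel

section Param
variable {N : ℕ} {P : Type*} [NormedAddCommGroup P] [NormedSpace ℝ P]
  {U : Set (Euc N × P)} {K : Euc N × P → ℝ}

lemma contDiffOn_pd_param (hU : IsOpen U) (hK : ContDiffOn ℝ ∞ K U) (i : Fin N) :
    ContDiffOn ℝ ∞ (fun z : Euc N × P => pd i (fun y => K (y, z.2)) z.1) U := by
  have h1 : ContDiffOn ℝ ∞ (fun z => fderiv ℝ K z (bv i, 0)) U :=
    (hK.fderiv_of_isOpen hU (m := ∞) (by simp)).clm_apply contDiffOn_const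
  refine h1.congr fun z hz => ?_
  have hd : HasFDerivAt K (fderiv ℝ K z) (z.1, z.2) :=
    ((hK.differentiableOn (by simp)).differentiableAt (hU.mem_nhds hz)).hasFDerivAt
  have h2 : HasFDerivAt (fun y : Euc N => (y, z.2)) (ContinuousLinearMap.inl ℝ (Euc N) P) z.1 :=
    hasFDerivAt_prodMk_left z.1 z.2
  have h3 := hd.comp z.1 h2
  rw [pd_eq_fderiv (f := fun y => K (y, z.2)) h3.differentiableAt]
  have := h3.fderiv
  simp only [Function.comp_def] at this
  rw [this]; simp

lemma contDiffOn_lap_param (hU : IsOpen U) (hK : ContDiffOn ℝ ∞ K U) :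
    ContDiffOn ℝ ∞ (fun z : Euc N × P => lap (fun y => K (y, z.2)) z.1) U := by
  simp_rw [lap_eq_sum]
  exact ContDiffOn.sum fun i _ => contDiffOn_pd_param hU (contDiffOn_pd_param hU hK i) i

lemma contDiffOn_lap_iter_param (hU : IsOpen U) (n : ℕ) : ∀ {K : Euc N × P → ℝ}, ContDiffOn ℝ ∞ K U →
    ContDiffOn ℝ ∞ (fun z : Euc N × P => lap^[n] (fun y => K (y, z.2)) z.1) U := by
  induction n with
  | zero => intro K hK; simpa using hK
  | succ n ih => intro K hK; exact ih (contDiffOn_lap_param hU hK)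

end Param

section KernelInt
variable {N : ℕ} [NeZero N]

lemma integrableOn_norm_rpow (R : ℝ) {r : ℝ} (hr : -(N : ℝ) < r) :
    IntegrableOn (fun x : Euc N => ‖x‖ ^ r) (Metric.ball 0 R) := by
  rw [integrableOn_fun_norm_addHaar (μ := volume) (f := fun s => s ^ r)]
  have hN : 0 < N := Nat.pos_of_ne_zero (NeZero.ne N)
  have h : IntegrableOn (fun y : ℝ => y ^ ((N : ℝ) - 1 + r)) (Ioo 0 R) := by
    rcases le_or_gt R 0 with h0 | h0
    · simp [Ioo_eq_empty (not_lt.2 h0)]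
    · have := intervalIntegral.intervalIntegrable_rpow' (a := 0) (b := R) (r := (N : ℝ) - 1 + r) (by linarith)
      rw [intervalIntegrable_iff_integrableOn_Ioo_of_le h0.le] at this
      exact this
  refine h.congr_fun (fun y hy => ?_) measurableSet_Ioo
  simp only [finrank_euclideanSpace, Fintype.card_fin, smul_eq_mul]
  rw [Real.rpow_add hy.1, ← Real.rpow_natCast, Nat.cast_sub hN, Nat.cast_one]

lemma integrableOn_norm_sub_rpow (x : Euc N) (R : ℝ) {r : ℝ} (hr : -(N : ℝ) < r) :
    IntegrableOn (fun y : Euc N => ‖x - y‖ ^ r) (Metric.ball x R) := by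
  have h := (integrableOn_norm_rpow (N := N) R hr)
  rw [← integrable_indicator_iff measurableSet_ball] at h ⊢
  refine (h.comp_sub_left x).congr (Eventually.of_forall fun y => ?_)
  simp only [indicator, Metric.mem_ball, dist_zero_right]
  rw [dist_comm, dist_eq_norm]

/-- The polyharmonic Green function (up to a factor) of order `k + 1`. -/
noncomputable def gk (k : ℕ) (x y : Euc N) : ℝ := ∫ σ in Ioc (0 : ℝ) 1, kh k x σ y

lemma measurable_kh (k : ℕ) : Measurable (fun z : Euc N × ℝ × Euc N => kh k z.1 z.2.1 z.2.2) := by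
  unfold kh kQ
  fun_prop

lemma kh_nonneg {k : ℕ} {x y : Euc N} {σ : ℝ} (hx : 0 ≤ x 0) (hy : 0 ≤ y 0) (hσ : 0 ≤ σ) :
    0 ≤ kh k x σ y := by
  unfold kh kQ; positivity

/-- The singular majorant of the kernel. -/
noncomputable def sing (x y : Euc N) : ℝ := ‖x - y‖ ^ (-((N : ℝ) - 1 / 2))

lemma rpow_kQ_le {x y : Euc N} {σ : ℝ} (hx : 0 < x 0) (hy : 0 < y 0) (hσ : 0 < σ) (hxy : x ≠ y) :
    kQ x σ y ^ (-((N : ℝ) / 2)) ≤ sing x y * ((4 * x 0 * y 0) ^ (-(1 / 4 : ℝ)) * σ ^ (-(1 / 4 : ℝ))) := by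
  have hN : (1 : ℝ) ≤ N := by exact_mod_cast Nat.one_le_iff_ne_zero.2 (NeZero.ne N)
  have hr : 0 < ‖x - y‖ := norm_pos_iff.2 (sub_ne_zero.2 hxy)
  have hQ := kQ_pos hx hy hσ
  have e1 : sing x y = (‖x - y‖ ^ 2) ^ (-((N : ℝ) / 2 - 1 / 4)) := by
    unfold sing
    rw [← Real.rpow_natCast, ← Real.rpow_mul hr.le]
    congr 1; push_cast; ring
  rw [e1, ← Real.mul_rpow (by positivity) hσ.le,
    show -((N : ℝ) / 2) = -((N : ℝ) / 2 - 1 / 4) + -(1 / 4) by ring, Real.rpow_add hQ]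
  refine mul_le_mul ?_ ?_ (by positivity) (by positivity)
  · exact Real.rpow_le_rpow_of_nonpos (by positivity) (by unfold kQ; nlinarith [mul_pos (mul_pos hx hy) hσ]) (by linarith)
  · exact Real.rpow_le_rpow_of_nonpos (by positivity) (by unfold kQ; nlinarith [sq_nonneg ‖x - y‖]) (by linarith)

lemma kh_le (k : ℕ) {x y : Euc N} {σ : ℝ} (hx : 0 < x 0) (hy : 0 < y 0) (hσ : 0 < σ) (hσ1 : σ ≤ 1)
    (hxy : x ≠ y) :
    kh k x σ y ≤ (4 * x 0 * y 0) ^ ((k : ℝ) + 3 / 4) * sing x y * σ ^ (-(1 / 4 : ℝ)) := by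
  have ht : 0 < 4 * x 0 * y 0 := by positivity
  have h := rpow_kQ_le hx hy hσ hxy
  have e : (4 * x 0 * y 0) ^ ((k : ℝ) + 3 / 4) = (4 * x 0 * y 0) ^ (k + 1) * (4 * x 0 * y 0) ^ (-(1 / 4 : ℝ)) := by
    rw [← Real.rpow_natCast, ← Real.rpow_add ht]; congr 1; push_cast; ring
  unfold kh
  rw [e]
  have h1 : σ ^ k ≤ 1 := pow_le_one₀ hσ.le hσ1
  have hs : 0 ≤ sing x y := by unfold sing; positivity
  calc (4 * x 0 * y 0) ^ (k + 1) * σ ^ k * kQ x σ y ^ (-((N : ℝ) / 2))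
      ≤ (4 * x 0 * y 0) ^ (k + 1) * 1 * (sing x y * ((4 * x 0 * y 0) ^ (-(1 / 4 : ℝ)) * σ ^ (-(1 / 4 : ℝ)))) := by
        gcongr
        exact Real.rpow_nonneg (kQ_pos hx hy hσ).le _
    _ = _ := by ring

lemma integrable_sigma : IntegrableOn (fun σ : ℝ => σ ^ (-(1 / 4 : ℝ))) (Ioc 0 1) := by
  have := intervalIntegral.intervalIntegrable_rpow' (a := 0) (b := 1) (r := -(1 / 4 : ℝ)) (by norm_num)
  rwa [intervalIntegrable_iff_integrableOn_Ioc_of_le zero_le_one] at this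

lemma integral_sigma : ∫ σ in Ioc (0 : ℝ) 1, σ ^ (-(1 / 4 : ℝ)) = 4 / 3 := by
  rw [← intervalIntegral.integral_of_le zero_le_one, integral_rpow (Or.inl (by norm_num))]
  norm_num

lemma integrableOn_kh (k : ℕ) {x y : Euc N} (hx : 0 < x 0) (hy : 0 < y 0) (hxy : x ≠ y) :
    IntegrableOn (fun σ => kh k x σ y) (Ioc 0 1) := by
  refine Integrable.mono' (integrable_sigma.const_mul ((4 * x 0 * y 0) ^ ((k : ℝ) + 3 / 4) * sing x y))
    ?_ ?_
  · exact ((measurable_kh k).comp (measurable_const.prodMk (measurable_id.prodMk measurable_const))).aestronglyMeasurable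
  · refine (ae_restrict_iff' measurableSet_Ioc).2 (Eventually.of_forall fun σ hσ => ?_)
    rw [Real.norm_of_nonneg (kh_nonneg hx.le hy.le hσ.1.le)]
    exact kh_le k hx hy hσ.1 hσ.2 hxy

lemma gk_nonneg {k : ℕ} {x y : Euc N} (hx : 0 ≤ x 0) (hy : 0 ≤ y 0) : 0 ≤ gk k x y :=
  setIntegral_nonneg measurableSet_Ioc fun σ hσ => kh_nonneg hx hy hσ.1.le

lemma gk_le (k : ℕ) {x y : Euc N} (hx : 0 < x 0) (hy : 0 < y 0) (hxy : x ≠ y) :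
    gk k x y ≤ 4 / 3 * ((4 * x 0 * y 0) ^ ((k : ℝ) + 3 / 4) * sing x y) := by
  have := setIntegral_mono_on (integrableOn_kh k hx hy hxy)
    (integrable_sigma.const_mul ((4 * x 0 * y 0) ^ ((k : ℝ) + 3 / 4) * sing x y)) measurableSet_Ioc
    (fun σ hσ => kh_le k hx hy hσ.1 hσ.2 hxy)
  rw [integral_const_mul, integral_sigma] at this
  unfold gk; linarith

/-- Joint integrability of the kernel density against bounded functions of bounded support. -/
lemma integrable_kh_mul (k : ℕ) {x : Euc N} (hx : 0 < x 0) {g : Euc N → ℝ} {M R : ℝ}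
    (hg : AEStronglyMeasurable g) (hM : ∀ y, |g y| ≤ M) (hR : ∀ y, g y ≠ 0 → 0 < y 0 ∧ ‖x - y‖ < R) :
    Integrable (fun z : ℝ × Euc N => kh k x z.1 z.2 * g z.2)
      ((volume.restrict (Ioc (0 : ℝ) 1)).prod volume) := by
  have hs : Integrable (fun y => (Metric.ball x R).indicator (sing x) y) := by
    rw [integrable_indicator_iff measurableSet_ball]
    exact integrableOn_norm_sub_rpow x R (by linarith)
  have hM0 : 0 ≤ M := (abs_nonneg _).trans (hM x)
  have hC : 0 ≤ 4 * x 0 * (|x 0| + |R|) := by positivity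
  set C := (4 * x 0 * (|x 0| + |R|)) ^ ((k : ℝ) + 3 / 4) * M with hCdef
  have hb := (Integrable.mul_prod (μ := volume.restrict (Ioc (0 : ℝ) 1)) (ν := (volume : Measure (Euc N)))
    integrable_sigma (hs.const_mul C))
  refine hb.mono' ?_ ?_
  · refine AEStronglyMeasurable.mul ?_ hg.comp_snd
    exact ((measurable_kh k).comp (measurable_const.prodMk measurable_id)).aestronglyMeasurable
  · have h1 : ∀ᵐ z : ℝ × Euc N ∂((volume.restrict (Ioc (0 : ℝ) 1)).prod volume), z.1 ∈ Ioc (0 : ℝ) 1 :=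
      Measure.quasiMeasurePreserving_fst.ae (ae_restrict_mem measurableSet_Ioc)
    have h2 : ∀ᵐ z : ℝ × Euc N ∂((volume.restrict (Ioc (0 : ℝ) 1)).prod volume), z.2 ≠ x :=
      Measure.quasiMeasurePreserving_snd.ae (Measure.ae_ne volume x)
    filter_upwards [h1, h2] with z hz1 hz2
    rw [norm_mul, Real.norm_eq_abs, Real.norm_eq_abs]
    by_cases hg0 : g z.2 = 0
    · rw [hg0, abs_zero, mul_zero]
      have : 0 ≤ (Metric.ball x R).indicator (sing x) z.2 := indicator_nonneg (fun y _ => by unfold sing; positivity) _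
      have := Real.rpow_nonneg hz1.1.le (-(1 / 4 : ℝ))
      positivity
    · obtain ⟨hy, hyR⟩ := hR _ hg0
      have hmem : z.2 ∈ Metric.ball x R := by rw [Metric.mem_ball, dist_comm, dist_eq_norm]; exact hyR
      rw [indicator_of_mem hmem, abs_of_nonneg (kh_nonneg hx.le hy.le hz1.1.le)]
      have h3 := kh_le k hx hy hz1.1 hz1.2 hz2.symm
      have h4 : z.2 0 ≤ |x 0| + |R| := by
        have : |(z.2 - x) 0| ≤ ‖z.2 - x‖ := PiLp.norm_apply_le (z.2 - x) 0
        rw [norm_sub_rev] at this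
        simp only [PiLp.sub_apply] at this
        linarith [abs_le.1 this |>.2, le_abs_self (x 0), le_abs_self R]
      have h5 : (4 * x 0 * z.2 0) ^ ((k : ℝ) + 3 / 4) ≤ (4 * x 0 * (|x 0| + |R|)) ^ ((k : ℝ) + 3 / 4) := by
        gcongr
      have h6 : 0 ≤ sing x z.2 := by unfold sing; positivity
      calc kh k x z.1 z.2 * |g z.2| ≤ ((4 * x 0 * (|x 0| + |R|)) ^ ((k : ℝ) + 3 / 4) * sing x z.2 * z.1 ^ (-(1 / 4 : ℝ))) * M := by
            refine mul_le_mul (h3.trans ?_) (hM _) (abs_nonneg _) ?_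
            · gcongr
              exact Real.rpow_nonneg hz1.1.le _
            · have := Real.rpow_nonneg hz1.1.le (-(1 / 4 : ℝ))
              positivity
        _ = _ := by rw [hCdef]; ring

lemma integral_gk_mul (k : ℕ) {x : Euc N} (hx : 0 < x 0) {g : Euc N → ℝ} {M R : ℝ}
    (hg : AEStronglyMeasurable g) (hM : ∀ y, |g y| ≤ M) (hR : ∀ y, g y ≠ 0 → 0 < y 0 ∧ ‖x - y‖ < R) :
    Integrable (fun y => gk k x y * g y) ∧
    IntegrableOn (fun σ => ∫ y, kh k x σ y * g y) (Ioc 0 1) ∧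
    ∫ y, gk k x y * g y = ∫ σ in Ioc (0 : ℝ) 1, ∫ y, kh k x σ y * g y := by
  have h := integrable_kh_mul k hx hg hM hR
  refine ⟨?_, h.integral_prod_left, ?_⟩
  · have := h.integral_prod_right
    refine this.congr (Eventually.of_forall fun y => ?_)
    simp only [gk, integral_mul_const]
  · rw [integral_integral_swap (f := fun σ y => kh k x σ y * g y) h]
    simp only [gk, integral_mul_const]

end KernelInt

lemma natCast_le_infty (n : ℕ) : (n : WithTop ℕ∞) ≤ ∞ := by
  exact_mod_cast (le_top : (n : ℕ∞) ≤ ⊤)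

lemma two_le_infty : (2 : WithTop ℕ∞) ≤ ∞ := natCast_le_infty 2

section Almansi
variable {N : ℕ} {U : Set (Euc N)}

lemma pd_comm (hU : IsOpen U) {f : Euc N → ℝ} (hf : ContDiffOn ℝ 2 f U) (i j : Fin N) {x : Euc N}
    (hx : x ∈ U) : pd i (pd j f) x = pd j (pd i f) x := by
  have key : ∀ a b : Fin N, pd a (pd b f) x = fderiv ℝ (fderiv ℝ f) x (bv a) (bv b) := by
    intro a b
    have h : EqOn (pd b f) (fun y => fderiv ℝ f y (bv b)) U := fun y hy =>
      pd_eq_fderiv (hf.diffAt hU one_le_two hy)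
    have e : (1 : WithTop ℕ∞) + 1 ≤ 2 := by rw [one_add_one_eq_two]
    have hd : DifferentiableAt ℝ (fderiv ℝ f) x :=
      ((hf.fderiv_of_isOpen hU e).differentiableOn one_ne_zero).differentiableAt (hU.mem_nhds hx)
    rw [pd_congr hU h a hx, pd_eq_fderiv (hd.clm_apply (differentiableAt_const _)),
      fderiv_clm_apply hd (differentiableAt_const _)]
    simp
  rw [key, key]
  exact ((hf.contDiffAt (hU.mem_nhds hx)).isSymmSndFDerivAt (by simp)).eq _ _

lemma lap_pd_eq_zero (hU : IsOpen U) {h : Euc N → ℝ} (hh : ContDiffOn ℝ ∞ h U)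
    (h0 : ∀ y ∈ U, lap h y = 0) (j : Fin N) : ∀ y ∈ U, lap (pd j h) y = 0 := by
  intro y hy
  have c1 : ∀ i, ContDiffOn ℝ ∞ (pd i h) U := fun i => hh.pd hU (by simp) i
  have c2 : ∀ i, ContDiffOn ℝ ∞ (pd i (pd i h)) U := fun i => (c1 i).pd hU (by simp) i
  have e1 : ∀ i, pd i (pd i (pd j h)) y = pd j (pd i (pd i h)) y := by
    intro i
    have : EqOn (pd i (pd j h)) (pd j (pd i h)) U := fun z hz =>
      pd_comm hU (hh.of_le two_le_infty) i j hz
    rw [pd_congr hU this i hy, pd_comm hU ((c1 i).of_le two_le_infty) i j hy]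
  rw [lap_eq_sum]
  simp_rw [e1]
  have hd : ∀ i, DifferentiableAt ℝ (pd i (pd i h)) y := fun i => (c2 i).diffAt hU (by simp) hy
  have : pd j (lap h) y = ∑ i, pd j (pd i (pd i h)) y := by
    have : lap h = fun y => ∑ i, pd i (pd i h) y := funext fun y => lap_eq_sum h y
    rw [this, pd_eq_fderiv (DifferentiableAt.fun_sum fun i _ => hd i), fderiv_fun_sum fun i _ => hd i]
    simp only [sum_apply]
    exact Finset.sum_congr rfl fun i _ => (pd_eq_fderiv (hd i)).symm
  rw [← this, pd_congr hU (show EqOn (lap h) (fun _ => 0) U from h0) j hy, pd_const]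

lemma almansi [NeZero N] (hU : IsOpen U) (j : ℕ) : ∀ {h : Euc N → ℝ}, ContDiffOn ℝ ∞ h U →
    (∀ y ∈ U, lap h y = 0) → ∀ n, j < n → ∀ y ∈ U, lap^[n] (fun y => y 0 ^ j * h y) y = 0 := by
  induction j using Nat.strong_induction_on with
  | _ j ih =>
  intro h hh h0 n hn y hy
  obtain ⟨n, rfl⟩ : ∃ n', n = n' + 1 := ⟨n - 1, by omega⟩
  have le2 : ∀ {f : Euc N → ℝ}, ContDiffOn ℝ ∞ f U → ContDiffOn ℝ 2 f U := fun h =>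
    h.of_le two_le_infty
  have len : ∀ {f : Euc N → ℝ}, ContDiffOn ℝ ∞ f U → ContDiffOn ℝ (2 * n : ℕ) f U := fun h =>
    h.of_le (natCast_le_infty _)
  have cp : ∀ i : ℕ, ContDiffOn ℝ ∞ (fun y : Euc N => y 0 ^ i) U := fun i =>
    ((contDiff_coord 0).pow i).contDiffOn
  have hp : ContDiffOn ℝ ∞ (pd 0 h) U := hh.pd hU (by simp) 0
  rw [Function.iterate_succ_apply]
  have key : EqOn (lap (fun y : Euc N => y 0 ^ j * h y))
      (fun y => (j * ((j - 1 : ℕ) : ℝ)) * (y 0 ^ (j - 1 - 1) * h y) + (2 * j) * (y 0 ^ (j - 1) * pd 0 h y)) U := by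
    intro z hz
    have l1 := lap_comp (f := fun y : Euc N => y 0) (φ := fun s => s ^ j)
      (φ₁ := fun s => j * s ^ (j - 1)) (φ₂ := fun s => j * ((j - 1 : ℕ) * s ^ (j - 1 - 1)))
      hU (contDiff_coord 0).contDiffOn (V := univ) (by simp)
      (fun s _ => by simpa using hasDerivAt_pow j s)
      (fun s _ => by simpa using (hasDerivAt_pow (j - 1) s).const_mul (j : ℝ)) (x := z) hz
    have e1 : ∀ i, pd i (fun y : Euc N => (y 0) ^ j) z =
        j * z 0 ^ (j - 1) * (if i = 0 then 1 else 0) := by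
      intro i
      rw [pd_comp (φ := fun s => s ^ j) (d := j * z 0 ^ (j - 1))
        (by simpa using hasDerivAt_pow j (z 0)) (by fun_prop), pd_coord]
    rw [lap_mul hU (le2 (cp j)) (le2 hh) hz, l1, h0 z hz, lap_coord]
    simp_rw [e1, pd_coord]
    simp
    ring
  rw [lap_iter_congr hU key n hy,
    lap_iter_add hU n (len (contDiffOn_const.mul ((cp _).mul hh))) (len (contDiffOn_const.mul ((cp _).mul hp))) hy]
  beta_reduce
  rw [lap_iter_const_mul hU _ n (len ((cp _).mul hh)) hy, lap_iter_const_mul hU _ n (len ((cp _).mul hp)) hy]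
  beta_reduce
  rcases j with _ | _ | j
  · simp
  · have i1 := ih 0 (by simp) hp (lap_pd_eq_zero hU hh h0 0) n (by omega) y hy
    simp only [zero_add, tsub_self] at i1 ⊢
    rw [i1]
    simp
  · have i1 := ih (j + 1) (by omega) hp (lap_pd_eq_zero hU hh h0 0) n (by omega) y hy
    have i2 := ih j (by omega) hh h0 n (by omega) y hy
    simp only [add_tsub_cancel_right] at i1 i2 ⊢
    rw [i1, i2]
    simp

end Almansi

section Boundary
variable {N : ℕ} [NeZero N]

lemma contDiffOn_kQ_rpow (x : Euc N) {σ : ℝ} (hx : 0 < x 0) (hσ : 0 < σ) (r : ℝ) {n : WithTop ℕ∞} :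
    ContDiffOn ℝ n (fun y : Euc N => kQ x σ y ^ r) {y : Euc N | 0 < y 0} :=
  (contDiff_kQ x σ).contDiffOn.rpow_const_of_ne fun _ hy => (kQ_pos hx hy hσ).ne'

lemma lap_poisson {x : Euc N} (hx : 0 < x 0) : ∀ y ∈ {y : Euc N | 0 < y 0},
    lap (fun y : Euc N => (x 0 + y 0) * kQ x 1 y ^ (-((N : ℝ) / 2))) y = 0 := by
  intro y hy
  have hU : IsOpen {x : Euc N | 0 < x 0} := isOpen_half
  have hQ := kQ_pos hx hy one_pos
  set p : ℝ := (N : ℝ) / 2 with hp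
  have l2 := lap_comp (f := kQ x 1) (φ := fun s => s ^ (-p))
    (φ₁ := fun s => -p * s ^ (-p - 1)) (φ₂ := fun s => -p * ((-p - 1) * s ^ (-p - 1 - 1)))
    hU (contDiff_kQ x 1).contDiffOn (V := Ioi 0) (fun y hy => kQ_pos hx hy one_pos)
    (fun s hs => Real.hasDerivAt_rpow_const (Or.inl (ne_of_gt hs)))
    (fun s hs => (Real.hasDerivAt_rpow_const (Or.inl (ne_of_gt hs))).const_mul _) (x := y) hy
  have hpd : ∀ i (z : Euc N), pd i (fun y : Euc N => x 0 + y 0) z = if i = 0 then 1 else 0 := by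
    intro i z
    rw [pd_add (by fun_prop) (by fun_prop), pd_const, pd_coord, zero_add]
  have l1 : lap (fun y : Euc N => x 0 + y 0) y = 0 := by
    rw [lap_eq_sum]
    refine Finset.sum_eq_zero fun i _ => ?_
    have : pd i (fun y : Euc N => x 0 + y 0) = fun y => if i = 0 then 1 else 0 := funext (hpd i)
    rw [this, pd_const]
  have e2 : ∀ i, pd i (fun y : Euc N => kQ x 1 y ^ (-p)) y =
      (-p * kQ x 1 y ^ (-p - 1)) * pd i (kQ x 1) y := by
    intro i
    exact pd_comp (φ := fun s => s ^ (-p)) (Real.hasDerivAt_rpow_const (Or.inl hQ.ne'))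
      ((contDiff_kQ (n := 1) x 1).differentiable one_ne_zero _)
  rw [lap_mul hU (by fun_prop) (contDiffOn_kQ_rpow x hx one_pos _) hy, l1, l2, sum_pd_kQ_sq, lap_kQ]
  simp_rw [e2, hpd, pd_kQ]
  have hN : (N : ℝ) = 2 * p := by rw [hp]; ring
  have r1 : kQ x 1 y ^ (-p - 1) = kQ x 1 y ^ (-p - 1 - 1) * kQ x 1 y := by
    conv_lhs => rw [show -p - 1 = (-p - 1 - 1) + 1 by ring, Real.rpow_add_one hQ.ne']
  rw [hN, r1]
  simp
  ring

lemma lap_iter_kB_one (k : ℕ) {x : Euc N} (hx : 0 < x 0) : ∀ y ∈ {y : Euc N | 0 < y 0},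
    lap^[k] (kB k x 1) y = 0 := by
  have hU : IsOpen {x : Euc N | 0 < x 0} := isOpen_half
  rcases k with _ | k
  · intro y hy
    simp [kB]
  intro y hy
  have hc : ContDiffOn ℝ ∞ (fun y : Euc N => (x 0 + y 0) * kQ x 1 y ^ (-((N : ℝ) / 2))) {y : Euc N | 0 < y 0} :=
    ContDiffOn.mul (by fun_prop) (contDiffOn_kQ_rpow x hx one_pos _)
  have : EqOn (kB (k + 1) x 1) (fun y => (4 * ((k + 1 : ℕ) : ℝ) * (4 * x 0) ^ (k + 1)) *
      (y 0 ^ k * ((x 0 + y 0) * kQ x 1 y ^ (-((N : ℝ) / 2))))) {y : Euc N | 0 < y 0} := by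
    intro y hy
    have : y 0 ≠ 0 := ne_of_gt hy
    simp only [kB]
    field_simp
    ring
  rw [lap_iter_congr hU this _ hy, lap_iter_const_mul hU _ _
    ((((contDiff_coord 0).pow k).contDiffOn.mul hc).of_le (natCast_le_infty _)) hy]
  beta_reduce
  rw [almansi hU k hc (lap_poisson hx) (k + 1) (by omega) y hy, mul_zero]

lemma contDiffOn_kB (k : ℕ) {x : Euc N} (hx : 0 < x 0) {σ : ℝ} (hσ : 0 < σ) {n : WithTop ℕ∞} :
    ContDiffOn ℝ n (kB k x σ) {y : Euc N | 0 < y 0} := by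
  unfold kB
  have h1 := contDiffOn_kQ_rpow (n := n) x hx hσ (-((N : ℝ) / 2))
  have h2 := contDiffOn_kQ_rpow (n := n) x hx hσ (-((N : ℝ) / 2) - 1)
  have h3 : ContDiffOn ℝ n (fun y : Euc N => x 0 / y 0) {y : Euc N | 0 < y 0} :=
    contDiffOn_const.div (contDiff_coord 0).contDiffOn fun y hy => ne_of_gt hy
  exact (contDiffOn_const.mul ((contDiff_const.mul (contDiff_coord 0)).pow k).contDiffOn).mul
    ((contDiffOn_const.mul h2).add ((contDiffOn_const.mul ((h3.mul contDiffOn_const).add contDiffOn_const)).mul h1))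

lemma integral_kB_one (k : ℕ) {x : Euc N} (hx : 0 < x 0) {φ : Euc N → ℝ} (hφ : ContDiff ℝ (2 * k : ℕ) φ)
    (hc : HasCompactSupport φ) (hs : tsupport φ ⊆ {y : Euc N | 0 < y 0}) :
    ∫ y, kB k x 1 y * lap^[k] φ y = 0 := by
  rw [integral_mul_lap_iter isOpen_half hc hs k (contDiffOn_kB k hx one_pos) hφ]
  refine integral_eq_zero_of_ae (Eventually.of_forall fun y => ?_)
  by_cases hy : y ∈ tsupport φ
  · simp [lap_iter_kB_one k hx y (hs hy)]
  · simp [image_eq_zero_of_notMem_tsupport hy]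

end Boundary

section Joint
variable {N : ℕ} [NeZero N]

lemma contDiff_kQ_joint {n : WithTop ℕ∞} :
    ContDiff ℝ n (fun z : Euc N × (Euc N × ℝ) => kQ z.2.1 z.2.2 z.1) := by
  unfold kQ
  have h0 : ContDiff ℝ n (fun z : Euc N × (Euc N × ℝ) => z.2.1) := contDiff_fst.comp contDiff_snd
  have h2 : ContDiff ℝ n (fun z : Euc N × (Euc N × ℝ) => z.2.2) := contDiff_snd.comp contDiff_snd
  have h3 : ContDiff ℝ n (fun z : Euc N × (Euc N × ℝ) => z.1 0) := (contDiff_coord 0).comp contDiff_fst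
  have h4 : ContDiff ℝ n (fun z : Euc N × (Euc N × ℝ) => z.2.1 0) := (contDiff_coord 0).comp h0
  exact ((h0.sub contDiff_fst).norm_sq ℝ).add (((contDiff_const.mul h4).mul h3).mul h2)

lemma contDiffOn_kh_joint (k : ℕ) {n : WithTop ℕ∞} :
    ContDiffOn ℝ n (fun z : Euc N × (Euc N × ℝ) => kh k z.2.1 z.2.2 z.1)
      {z | 0 < kQ z.2.1 z.2.2 z.1} := by
  unfold kh
  have h0 : ContDiff ℝ n (fun z : Euc N × (Euc N × ℝ) => z.2.1) := contDiff_fst.comp contDiff_snd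
  have h2 : ContDiff ℝ n (fun z : Euc N × (Euc N × ℝ) => z.2.2) := contDiff_snd.comp contDiff_snd
  have h3 : ContDiff ℝ n (fun z : Euc N × (Euc N × ℝ) => z.1 0) := (contDiff_coord 0).comp contDiff_fst
  have h4 : ContDiff ℝ n (fun z : Euc N × (Euc N × ℝ) => z.2.1 0) := (contDiff_coord 0).comp h0
  exact ((((contDiff_const.mul h4).mul h3).pow (k + 1)).mul (h2.pow k)).contDiffOn.mul
    (contDiff_kQ_joint.contDiffOn.rpow_const_of_ne fun z hz => ne_of_gt hz)

lemma contDiffOn_kh_right (k : ℕ) {x : Euc N} (hx : 0 < x 0) {n : WithTop ℕ∞} :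
    ContDiffOn ℝ n (fun z : Euc N × ℝ => kh k x z.2 z.1) {z | 0 < z.1 0 ∧ 0 < z.2} := by
  have : ContDiff ℝ n (fun z : Euc N × ℝ => (z.1, (x, z.2))) :=
    contDiff_fst.prodMk (contDiff_const.prodMk contDiff_snd)
  exact (contDiffOn_kh_joint k).comp this.contDiffOn fun z hz => kQ_pos hx hz.1 hz.2

lemma isOpen_half_prod : IsOpen {z : Euc N × ℝ | 0 < z.1 0 ∧ 0 < z.2} :=
  (isOpen_lt (f := fun _ => (0 : ℝ)) (g := fun z : Euc N × ℝ => z.1 0) continuous_const (by fun_prop)).inter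
    (isOpen_lt continuous_const continuous_snd)

lemma contDiffOn_kh (k : ℕ) {x : Euc N} (hx : 0 < x 0) {σ : ℝ} (hσ : 0 < σ) {n : WithTop ℕ∞} :
    ContDiffOn ℝ n (kh k x σ) {y : Euc N | 0 < y 0} := by
  have : ContDiff ℝ n (fun y : Euc N => (y, σ)) := contDiff_id.prodMk contDiff_const
  exact (contDiffOn_kh_right k hx).comp this.contDiffOn fun y hy => ⟨hy, hσ⟩

end Joint

section Deriv
variable {N : ℕ} [NeZero N]

lemma hasDerivAt_integral_of_compact {F F' : ℝ → Euc N → ℝ} {g : Euc N → ℝ} (hg : Continuous g)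
    (hc : HasCompactSupport g) (hs : tsupport g ⊆ {y | 0 < y 0})
    (hF : ∀ σ, 0 < σ → ContinuousOn (F σ) {y | 0 < y 0})
    (hF' : ContinuousOn (fun z : Euc N × ℝ => F' z.2 z.1) {z | 0 < z.1 0 ∧ 0 < z.2})
    (hd : ∀ σ, 0 < σ → ∀ y : Euc N, 0 < y 0 → HasDerivAt (fun σ => F σ y) (F' σ y) σ)
    {σ : ℝ} (hσ : 0 < σ) :
    HasDerivAt (fun σ => ∫ y, F σ y * g y) (∫ y, F' σ y * g y) σ := by
  have hK : IsCompact (tsupport g ×ˢ Icc (σ / 2) (2 * σ)) := hc.isCompact.prod isCompact_Icc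
  have hcont : ContinuousOn (fun z : Euc N × ℝ => F' z.2 z.1 * g z.1) (tsupport g ×ˢ Icc (σ / 2) (2 * σ)) := by
    refine ContinuousOn.mul (hF'.mono ?_) (by fun_prop)
    rintro ⟨y, s⟩ ⟨hy, h1⟩
    exact ⟨hs hy, by simp at h1 ⊢; linarith⟩
  obtain ⟨C, hC⟩ := hK.exists_bound_of_continuousOn hcont
  have hF'c : ∀ s, 0 < s → ContinuousOn (F' s) {y | 0 < y 0} := fun s h =>
    hF'.comp (Continuous.continuousOn (f := fun y : Euc N => (y, s)) (by fun_prop)) fun y hy => ⟨hy, h⟩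
  refine (hasDerivAt_integral_of_dominated_loc_of_deriv_le (s := Ioo (σ / 2) (2 * σ))
    (bound := (tsupport g).indicator fun _ => C) (F' := fun σ y => F' σ y * g y)
    (Ioo_mem_nhds (by linarith) (by linarith)) ?_ ?_ ?_ ?_ ?_ ?_).2
  · filter_upwards [Ioi_mem_nhds hσ] with s h
    exact (continuous_mul_of_tsupport isOpen_half (hF s h) hg hs).aestronglyMeasurable
  · exact integrable_mul_of_tsupport isOpen_half (hF σ hσ) hg hc hs
  · exact (continuous_mul_of_tsupport isOpen_half (hF'c σ hσ) hg hs).aestronglyMeasurable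
  · refine Eventually.of_forall fun y s h => ?_
    by_cases hy : y ∈ tsupport g
    · rw [indicator_of_mem hy]
      exact hC (y, s) ⟨hy, Ioo_subset_Icc_self h⟩
    · simp [image_eq_zero_of_notMem_tsupport hy, hy]
  · rw [integrable_indicator_iff (isClosed_tsupport g).measurableSet]
    exact integrableOn_const hc.isCompact.measure_lt_top.ne
  · refine Eventually.of_forall fun y s h => ?_
    by_cases hy : y ∈ tsupport g
    · exact (hd s (by linarith [h.1]) y (hs hy)).mul_const _
    · simp only [image_eq_zero_of_notMem_tsupport hy, mul_zero]
      exact hasDerivAt_const _ _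

lemma hasDerivAt_integral_kB (k : ℕ) {x : Euc N} (hx : 0 < x 0) {g : Euc N → ℝ} (hg : Continuous g)
    (hc : HasCompactSupport g) (hs : tsupport g ⊆ {y | 0 < y 0}) {σ : ℝ} (hσ : 0 < σ) :
    HasDerivAt (fun σ => ∫ y, kB k x σ y * g y)
      (∫ y, (lap (kh k x σ) y + 4 * k ^ 2 * kh (k - 1) x σ y) * g y) σ := by
  refine hasDerivAt_integral_of_compact hg hc hs (F := kB k x)
    (F' := fun σ y => lap (kh k x σ) y + 4 * k ^ 2 * kh (k - 1) x σ y)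
    (fun s h => (contDiffOn_kB (n := 0) k hx h).continuousOn) ?_
    (fun s h y hy => lap_kh k hx hy h) hσ
  exact (contDiffOn_lap_param isOpen_half_prod (contDiffOn_kh_right k hx)).continuousOn.add
    (continuousOn_const.mul (contDiffOn_kh_right (n := 0) (k - 1) hx).continuousOn)

end Deriv

section ApproxId
variable {N : ℕ} [NeZero N]

/-- The mass of the conformal kernel `(1 + |z|²)^{-N/2-1}`. -/
noncomputable def kmass (N : ℕ) : ℝ := ∫ z : Euc N, (1 + ‖z‖ ^ 2) ^ (-((N : ℝ) / 2) - 1)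

lemma integrable_kmass : Integrable (fun z : Euc N => (1 + ‖z‖ ^ 2) ^ (-((N : ℝ) / 2) - 1)) := by
  have := integrable_rpow_neg_one_add_norm_sq (E := Euc N) (μ := volume) (r := N + 2) (by simp)
  convert this using 3
  ring

lemma kmass_pos : 0 < kmass N := by
  unfold kmass
  rw [integral_pos_iff_support_of_nonneg (fun z => by positivity) integrable_kmass]
  have : Function.support (fun z : Euc N => (1 + ‖z‖ ^ 2) ^ (-((N : ℝ) / 2) - 1)) = univ := by
    ext z
    simp only [Function.mem_support, mem_univ, iff_true]
    positivity
  rw [this]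
  exact Measure.measure_univ_pos.2 (NeZero.ne _)

lemma kQ_eq (x : Euc N) (σ : ℝ) (y : Euc N) :
    kQ x σ y = ‖y - (x - (2 * x 0 * σ) • bv 0)‖ ^ 2 + 4 * x 0 ^ 2 * σ * (1 - σ) := by
  have e : y - (x - (2 * x 0 * σ) • bv 0) = (2 * x 0 * σ) • bv 0 - (x - y) := by abel
  rw [e, norm_sub_sq_real, norm_smul, real_inner_smul_left]
  have hi : inner ℝ (bv 0) (x - y) = x 0 - y 0 := by
    simp [bv, EuclideanSpace.inner_single_left]
  rw [hi]
  unfold kQ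
  simp [mul_pow]
  ring

lemma kQ_scaled (x : Euc N) {σ : ℝ} (h0 : 0 ≤ σ) (h1 : σ ≤ 1) (z : Euc N) :
    kQ x σ ((x - (2 * x 0 * σ) • bv 0) + √(4 * x 0 ^ 2 * σ * (1 - σ)) • z) =
      4 * x 0 ^ 2 * σ * (1 - σ) * (1 + ‖z‖ ^ 2) := by
  have : 0 ≤ 4 * x 0 ^ 2 * σ * (1 - σ) := mul_nonneg (by positivity) (by linarith)
  rw [kQ_eq, add_sub_cancel_left, norm_smul, mul_pow, Real.norm_of_nonneg (Real.sqrt_nonneg _),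
    Real.sq_sqrt this]
  ring

lemma integral_kQ_scaled {x : Euc N} (hx : 0 < x 0) {σ : ℝ} (h0 : 0 < σ) (h1 : σ < 1) (f : Euc N → ℝ) :
    4 * x 0 ^ 2 * σ * (1 - σ) * ∫ y, kQ x σ y ^ (-((N : ℝ) / 2) - 1) * f y =
      ∫ z, (1 + ‖z‖ ^ 2) ^ (-((N : ℝ) / 2) - 1) *
        f ((x - (2 * x 0 * σ) • bv 0) + √(4 * x 0 ^ 2 * σ * (1 - σ)) • z) := by
  set e := 4 * x 0 ^ 2 * σ * (1 - σ) with he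
  have hepos : 0 < e := mul_pos (by positivity) (by linarith)
  set c := x - (2 * x 0 * σ) • bv 0 with hc
  set F : Euc N → ℝ := fun y => kQ x σ y ^ (-((N : ℝ) / 2) - 1) * f y with hF
  have key : ∀ z, (1 + ‖z‖ ^ 2) ^ (-((N : ℝ) / 2) - 1) * f (c + √e • z) =
      e ^ ((N : ℝ) / 2 + 1) * F (c + √e • z) := by
    intro z
    simp only [hF]
    rw [kQ_scaled x h0.le h1.le z, ← he, Real.mul_rpow hepos.le (by positivity), ← mul_assoc, ← mul_assoc,
      ← Real.rpow_add hepos]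
    ring_nf
    simp
  simp_rw [key]
  rw [integral_const_mul, Measure.integral_comp_smul_of_nonneg (μ := volume) (fun z => F (c + z)) (√e) (hR := Real.sqrt_nonneg _),
    integral_add_left_eq_self F c]
  have : (√e ^ N)⁻¹ = e ^ (-((N : ℝ) / 2)) := by
    rw [Real.sqrt_eq_rpow, ← Real.rpow_natCast, ← Real.rpow_mul hepos.le, ← Real.rpow_neg hepos.le]
    ring_nf
  simp only [finrank_euclideanSpace, Fintype.card_fin, this, smul_eq_mul]
  rw [← mul_assoc, ← Real.rpow_add hepos]
  rw [show (N : ℝ) / 2 + 1 + -((N : ℝ) / 2) = 1 by ring, Real.rpow_one]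

lemma tendsto_approx_id {x : Euc N} (hx : 0 < x 0) {G : ℝ → Euc N → ℝ} {K : Set (Euc N)}
    (hK : IsCompact K) (hG : ContinuousOn (fun z : ℝ × Euc N => G z.1 z.2) (Iio 1 ×ˢ univ))
    (h0 : ∀ σ, ∀ y ∉ K, G σ y = 0) :
    Tendsto (fun σ => 4 * x 0 ^ 2 * σ * (1 - σ) * ∫ y, kQ x σ y ^ (-((N : ℝ) / 2) - 1) * G σ y)
      (𝓝[>] 0) (𝓝 (kmass N * G 0 x)) := by
  obtain ⟨C, hC⟩ := (isCompact_Icc (a := (0 : ℝ)) (b := 1 / 2)).prod hK |>.exists_bound_of_continuousOn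
    (hG.mono (prod_mono (fun s hs => by simp at hs ⊢; linarith) (subset_univ _)))
  have hC' : ∀ σ ∈ Icc (0 : ℝ) (1 / 2), ∀ y, ‖G σ y‖ ≤ |C| := by
    intro σ hσ y
    by_cases hy : y ∈ K
    · exact (hC (σ, y) ⟨hσ, hy⟩).trans (le_abs_self C)
    · rw [h0 σ y hy]; simp
  have hev : ∀ᶠ σ : ℝ in 𝓝[>] 0, σ ∈ Ioo (0 : ℝ) (1 / 2) := Ioo_mem_nhdsGT (by norm_num)
  have hcong : (fun σ => ∫ z, (1 + ‖z‖ ^ 2) ^ (-((N : ℝ) / 2) - 1) *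
        G σ ((x - (2 * x 0 * σ) • bv 0) + √(4 * x 0 ^ 2 * σ * (1 - σ)) • z)) =ᶠ[𝓝[>] 0]
      (fun σ => 4 * x 0 ^ 2 * σ * (1 - σ) * ∫ y, kQ x σ y ^ (-((N : ℝ) / 2) - 1) * G σ y) := by
    filter_upwards [hev] with σ hσ
    exact (integral_kQ_scaled hx hσ.1 (by linarith [hσ.2]) _).symm
  refine Tendsto.congr' hcong ?_
  unfold kmass
  rw [← integral_mul_const]
  have hpos : ∀ z : Euc N, 0 ≤ (1 + ‖z‖ ^ 2) ^ (-((N : ℝ) / 2) - 1) := fun z => by positivity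
  refine tendsto_integral_filter_of_dominated_convergence
    (fun z => (1 + ‖z‖ ^ 2) ^ (-((N : ℝ) / 2) - 1) * |C|) ?_ ?_ (integrable_kmass.mul_const _) ?_
  · filter_upwards [hev] with σ hσ
    refine Continuous.aestronglyMeasurable ?_
    have hGc : Continuous (G σ) := by
      rw [← continuousOn_univ]
      exact hG.comp (Continuous.continuousOn (f := fun y : Euc N => (σ, y)) (by fun_prop))
        fun y _ => ⟨by simp; linarith [hσ.2], mem_univ _⟩
    refine Continuous.mul ?_ (hGc.comp (by fun_prop))
    exact Continuous.rpow_const (by fun_prop) fun z => Or.inl (by positivity)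
  · filter_upwards [hev] with σ hσ
    refine Eventually.of_forall fun z => ?_
    rw [norm_mul, Real.norm_of_nonneg (hpos z)]
    exact mul_le_mul_of_nonneg_left (hC' σ (Ioo_subset_Icc_self hσ) _) (hpos z)
  · refine Eventually.of_forall fun z => Tendsto.const_mul _ ?_
    have hcont : ContinuousAt (fun z : ℝ × Euc N => G z.1 z.2) (0, x) :=
      hG.continuousAt ((isOpen_Iio.prod isOpen_univ).mem_nhds ⟨by simp, mem_univ _⟩)
    have ht : Tendsto (fun σ : ℝ => (σ, (x - (2 * x 0 * σ) • bv 0) + √(4 * x 0 ^ 2 * σ * (1 - σ)) • z))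
        (𝓝[>] 0) (𝓝 (0, x)) := by
      refine tendsto_nhdsWithin_of_tendsto_nhds ?_
      have : Continuous (fun σ : ℝ => (σ, (x - (2 * x 0 * σ) • bv (0 : Fin N)) + √(4 * x 0 ^ 2 * σ * (1 - σ)) • z)) := by
        fun_prop
      simpa using this.tendsto 0
    exact hcont.tendsto.comp ht

lemma tendsto_integral_kB (k : ℕ) {x : Euc N} (hx : 0 < x 0) {g : Euc N → ℝ} (hg : Continuous g)
    (hc : HasCompactSupport g) (hs : tsupport g ⊆ {y | 0 < y 0}) :
    Tendsto (fun σ => ∫ y, kB k x σ y * g y) (𝓝[>] 0)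
      (𝓝 (kmass N * (2 * N * (0 : ℝ) ^ k * g x))) := by
  set G : ℝ → Euc N → ℝ := fun σ y =>
    (σ ^ k * (4 * x 0 * y 0) ^ k * (2 * N) + 4 * k * σ ^ (k - 1) * (4 * x 0 * y 0) ^ k * kQ x σ y / (4 * x 0 ^ 2 * (1 - σ))) * g y
    + 4 * k * σ ^ k * x 0 * (4 * x 0 * y 0) ^ k * kQ x σ y / (4 * x 0 ^ 2 * (1 - σ)) * ((y 0)⁻¹ * g y) with hGdef
  have hinv : Continuous (fun y : Euc N => (y 0)⁻¹ * g y) :=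
    continuous_mul_of_tsupport isOpen_half
      (ContinuousOn.inv₀ (by fun_prop) fun y hy => ne_of_gt hy) hg hs
  have hcont : ContinuousOn (fun z : ℝ × Euc N => G z.1 z.2) (Iio 1 ×ˢ univ) := by
    have hq : Continuous (fun z : ℝ × Euc N => kQ x z.1 z.2) := by unfold kQ; fun_prop
    have hden : ∀ z ∈ (Iio 1 ×ˢ univ : Set (ℝ × Euc N)), 4 * x 0 ^ 2 * (1 - z.1) ≠ 0 := by
      rintro ⟨s, y⟩ ⟨h1, -⟩
      have : s < 1 := h1
      have : (0 : ℝ) < 4 * x 0 ^ 2 * (1 - s) := mul_pos (by positivity) (by linarith)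
      exact this.ne'
    have hi := hinv.comp (continuous_snd (X := ℝ))
    simp only [hGdef]
    refine ContinuousOn.add (ContinuousOn.mul (ContinuousOn.add (by fun_prop) (ContinuousOn.div ?_ (by fun_prop) hden)) (by fun_prop))
      (ContinuousOn.mul (ContinuousOn.div ?_ (by fun_prop) hden) hi.continuousOn)
    · exact ContinuousOn.mul (by fun_prop) hq.continuousOn
    · exact ContinuousOn.mul (by fun_prop) hq.continuousOn
  have h := tendsto_approx_id hx hc.isCompact hcont (fun σ y hy => by
    simp [hGdef, image_eq_zero_of_notMem_tsupport hy])
  have hG0 : G 0 x = 2 * N * (0 : ℝ) ^ k * g x := by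
    have : kQ x 0 x = 0 := by simp [kQ]
    simp only [hGdef, this]
    rcases k with _ | k
    · simp
    · simp
  rw [hG0] at h
  refine h.congr' ?_
  filter_upwards [Ioo_mem_nhdsGT (show (0 : ℝ) < 1 by norm_num)] with σ hσ
  rw [← integral_const_mul]
  refine integral_congr_ae (Eventually.of_forall fun y => ?_)
  by_cases hy : y ∈ tsupport g
  · have hy0 : 0 < y 0 := hs hy
    have hQ := kQ_pos hx hy0 hσ.1
    have r : kQ x σ y ^ (-((N : ℝ) / 2)) = kQ x σ y ^ (-((N : ℝ) / 2) - 1) * kQ x σ y := by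
      conv_lhs => rw [show -((N : ℝ) / 2) = (-((N : ℝ) / 2) - 1) + 1 by ring, Real.rpow_add_one hQ.ne']
    have h1 : 1 - σ ≠ 0 := by linarith [hσ.2]
    have h2 := hσ.1.ne'
    simp only [hGdef, kB, r]
    generalize kQ x σ y ^ (-((N : ℝ) / 2) - 1) = R
    generalize kQ x σ y = Q
    rcases k with _ | k
    · simp; ring
    · simp only [Nat.add_sub_cancel]
      field_simp
      ring
  · simp [hGdef, image_eq_zero_of_notMem_tsupport hy]

end ApproxId

section GreenRep
variable {N : ℕ} [NeZero N]

lemma bound_of_continuous_compact {g : Euc N → ℝ} (hg : Continuous g) (hc : HasCompactSupport g) (x : Euc N)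
    (hs : tsupport g ⊆ {y | 0 < y 0}) :
    ∃ M R : ℝ, (∀ y, |g y| ≤ M) ∧ ∀ y, g y ≠ 0 → 0 < y 0 ∧ ‖x - y‖ < R := by
  obtain ⟨M, hM⟩ := hc.exists_bound_of_continuous hg
  obtain ⟨R, hR⟩ := hc.isCompact.isBounded.subset_ball x
  refine ⟨M, R, hM, fun y hy => ⟨hs (subset_tsupport g hy), ?_⟩⟩
  have := hR (subset_tsupport g hy)
  rwa [Metric.mem_ball, dist_comm, dist_eq_norm] at this

lemma integral_gk_lap (k : ℕ) {x : Euc N} (hx : 0 < x 0) {g : Euc N → ℝ} (hg : ContDiff ℝ 2 g)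
    (hc : HasCompactSupport g) (hs : tsupport g ⊆ {y | 0 < y 0})
    (h1 : ∫ y, kB k x 1 y * g y = 0) :
    ∫ y, gk k x y * lap g y =
      -(kmass N * (2 * N * (0 : ℝ) ^ k * g x)) - 4 * k ^ 2 * ∫ y, gk (k - 1) x y * g y := by
  have hlc : Continuous (lap g) := (hg.lap_contDiff (m := 0) (by simp)).continuous
  obtain ⟨M, R, hM, hR⟩ := bound_of_continuous_compact hg.continuous hc x hs
  obtain ⟨M', R', hM', hR'⟩ := bound_of_continuous_compact hlc
    (hc.mono_tsupport (tsupport_lap_subset g)) x ((tsupport_lap_subset g).trans hs)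
  obtain ⟨-, i1, e1⟩ := integral_gk_mul k hx hlc.aestronglyMeasurable hM' hR'
  obtain ⟨-, i2, e2⟩ := integral_gk_mul (k - 1) hx hg.continuous.aestronglyMeasurable hM hR
  have hder : ∀ σ ∈ Ioo (0 : ℝ) 1, HasDerivAt (fun σ => ∫ y, kB k x σ y * g y)
      ((∫ y, kh k x σ y * lap g y) + 4 * k ^ 2 * ∫ y, kh (k - 1) x σ y * g y) σ := by
    intro σ hσ
    refine (hasDerivAt_integral_kB k hx hg.continuous hc hs hσ.1).congr_deriv ?_
    rw [integral_mul_lap isOpen_half (contDiffOn_kh k hx hσ.1) hg hc hs, ← integral_const_mul,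
      ← integral_add]
    · refine integral_congr_ae (Eventually.of_forall fun y => ?_)
      simp only; ring
    · exact integrable_mul_of_tsupport isOpen_half
        ((contDiffOn_kh k hx hσ.1 (n := ∞)).lap isOpen_half (m := 0) (by simpa using two_le_infty)).continuousOn hg.continuous hc hs
    · exact (integrable_mul_of_tsupport isOpen_half
        (contDiffOn_kh (n := 0) (k - 1) hx hσ.1).continuousOn hg.continuous hc hs).const_mul _
  have hInt : IntervalIntegrable (fun σ => (∫ y, kh k x σ y * lap g y) + 4 * k ^ 2 * ∫ y, kh (k - 1) x σ y * g y)
      volume 0 1 := by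
    rw [intervalIntegrable_iff_integrableOn_Ioc_of_le zero_le_one]
    exact i1.add (i2.const_mul _)
  have hlim1 : Tendsto (fun σ => ∫ y, kB k x σ y * g y) (𝓝[<] 1) (𝓝 0) := by
    have := (hasDerivAt_integral_kB k hx hg.continuous hc hs one_pos).continuousAt.tendsto
    rw [h1] at this
    exact this.mono_left nhdsWithin_le_nhds
  have h := intervalIntegral.integral_eq_sub_of_hasDerivAt_of_tendsto zero_lt_one hder hInt
    (tendsto_integral_kB k hx hg.continuous hc hs) hlim1
  rw [intervalIntegral.integral_of_le zero_le_one, integral_add i1 (i2.const_mul _),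
    integral_const_mul, ← e1, ← e2] at h
  linarith

/-- The normalising constant of the Green function `gk`. -/
noncomputable def kap (N : ℕ) : ℕ → ℝ
  | 0 => 2 * N * kmass N
  | k + 1 => 4 * ((k : ℝ) + 1) ^ 2 * kap N k

lemma kap_pos (k : ℕ) : 0 < kap N k := by
  have := kmass_pos (N := N)
  have hN : (0 : ℝ) < N := by exact_mod_cast Nat.pos_of_ne_zero (NeZero.ne N)
  induction k with
  | zero => unfold kap; positivity
  | succ k ih => unfold kap; positivity

lemma green_rep (k : ℕ) {x : Euc N} (hx : 0 < x 0) {φ : Euc N → ℝ}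
    (hφ : ContDiff ℝ (2 * (k + 1) : ℕ) φ) (hc : HasCompactSupport φ)
    (hs : tsupport φ ⊆ {y | 0 < y 0}) :
    ∫ y, gk k x y * polyLap (k + 1) φ y = kap N k * φ x := by
  unfold polyLap
  induction k with
  | zero =>
    have h1 := integral_kB_one 0 hx (φ := φ) (hφ.of_le (by simp)) hc hs
    simp only [Function.iterate_zero, id] at h1
    have := integral_gk_lap 0 hx (hφ.of_le (by simp)) hc hs h1
    simp only [zero_add, Function.iterate_one, pow_one, neg_one_mul, mul_neg, integral_neg, this, kap]
    simp
    ring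
  | succ k ih =>
    have e : ((2 * (k + 1 + 1) : ℕ) : WithTop ℕ∞) = 2 + (2 * (k + 1) : ℕ) := by
      rw [mul_add 2 (k + 1) 1, mul_one, add_comm]; push_cast; rfl
    have hle : ((2 * (k + 1) : ℕ) : WithTop ℕ∞) ≤ (2 * (k + 1 + 1) : ℕ) := by
      exact_mod_cast (by omega)
    have hg : ContDiff ℝ 2 (lap^[k + 1] φ) := ContDiff.lap_iter_contDiff (k + 1) (by rw [← e]; exact hφ)
    have ht := tsupport_lap_iter_subset (k + 1) φ
    have h := integral_gk_lap (k + 1) hx hg (hc.mono_tsupport ht) (ht.trans hs)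
      (integral_kB_one (k + 1) hx (hφ.of_le hle) hc hs)
    have ih' := ih (hφ.of_le hle)
    simp_rw [mul_left_comm _ ((-1 : ℝ) ^ _), integral_const_mul] at ih' ⊢
    rw [Function.iterate_succ_apply' lap (k + 1), h, kap]
    simp only [Nat.add_sub_cancel, pow_succ (-1 : ℝ) (k + 1)]
    push_cast
    simp only [pow_succ (0 : ℝ) k, mul_zero, zero_mul, neg_zero, zero_sub]
    linear_combination 4 * ((k : ℝ) + 1) ^ 2 * ih'

end GreenRep

lemma sum_range_shift_le {a : ℕ → ℝ} (ha : ∀ j, 0 ≤ a j) {n c M : ℕ} (h : n + c ≤ M) :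
    ∑ j ∈ Finset.range n, a (j + c) ≤ ∑ j ∈ Finset.range M, a j := by
  rw [Finset.range_eq_Ico, Finset.sum_Ico_add' a 0 n c, Finset.range_eq_Ico]
  exact Finset.sum_le_sum_of_subset_of_nonneg (Finset.Ico_subset_Ico (by omega) h) fun _ _ _ => ha _

section CutoffEstimate
variable {N : ℕ} [NeZero N]

lemma lap_iter_zeta_bound (n : ℕ) : ∀ {ψ : Euc N → ℝ}, ContDiff ℝ ∞ ψ → HasCompactSupport ψ →
    ∃ C, 0 ≤ C ∧ ∀ ζ : ℝ → ℝ, ContDiff ℝ ∞ ζ → ∀ y : Euc N,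
      |lap^[n] (fun y => ζ (y 0) * ψ y) y| ≤ C * ∑ j ∈ Finset.range (2 * n + 1), |iteratedDeriv j ζ (y 0)| := by
  induction n with
  | zero =>
    intro ψ hψ hc
    obtain ⟨C, hC⟩ := hc.exists_bound_of_continuous hψ.continuous
    refine ⟨C, (norm_nonneg _).trans (hC 0), fun ζ hζ y => ?_⟩
    simp only [Function.iterate_zero, id, mul_zero, zero_add, Finset.sum_range_one, iteratedDeriv_zero]
    rw [abs_mul, mul_comm]
    exact mul_le_mul_of_nonneg_right (hC y) (abs_nonneg _)
  | succ n ih =>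
    intro ψ hψ hc
    have hp : ContDiff ℝ ∞ (pd 0 ψ) := hψ.pd_contDiff (by simp) 0
    have hl : ContDiff ℝ ∞ (lap ψ) := hψ.lap_contDiff (le_of_eq rfl)
    obtain ⟨C1, h1, H1⟩ := ih hψ hc
    obtain ⟨C2, h2, H2⟩ := ih hp (hc.mono_tsupport (tsupport_pd_subset 0 ψ))
    obtain ⟨C3, h3, H3⟩ := ih hl (hc.mono_tsupport (tsupport_lap_subset ψ))
    refine ⟨C1 + 2 * C2 + C3, by positivity, fun ζ hζ y => ?_⟩
    have hζ1 : ContDiff ℝ ∞ (deriv ζ) := (contDiff_infty_iff_deriv.1 hζ).2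
    have hζ2 : ContDiff ℝ ∞ (deriv (deriv ζ)) := (contDiff_infty_iff_deriv.1 hζ1).2
    have cz : ∀ {ζ : ℝ → ℝ} {ψ : Euc N → ℝ}, ContDiff ℝ ∞ ζ → ContDiff ℝ ∞ ψ →
        ContDiff ℝ ∞ (fun y : Euc N => ζ (y 0) * ψ y) := fun h1 h2 =>
      (h1.comp (contDiff_coord 0)).mul h2
    have key : lap (fun y : Euc N => ζ (y 0) * ψ y) = fun y =>
        (deriv (deriv ζ) (y 0) * ψ y + 2 * (deriv ζ (y 0) * pd 0 ψ y)) + ζ (y 0) * lap ψ y := by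
      funext z
      have d1 : ∀ s, HasDerivAt ζ (deriv ζ s) s := fun s => (hζ.differentiable (by simp) s).hasDerivAt
      have d2 : ∀ s, HasDerivAt (deriv ζ) (deriv (deriv ζ) s) s := fun s =>
        (hζ1.differentiable (by simp) s).hasDerivAt
      have l1 := lap_comp (f := fun y : Euc N => y 0) (φ := ζ) (φ₁ := deriv ζ) (φ₂ := deriv (deriv ζ))
        isOpen_univ (contDiff_coord 0).contDiffOn (V := univ) (by simp)
        (fun s _ => d1 s) (fun s _ => d2 s) (x := z) (mem_univ _)
      have e1 : ∀ i, pd i (fun y : Euc N => ζ (y 0)) z = deriv ζ (z 0) * (if i = 0 then 1 else 0) := by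
        intro i
        rw [pd_comp (φ := ζ) (d1 (z 0)) (by fun_prop), pd_coord]
      have hζc : ContDiffOn ℝ 2 (fun y : Euc N => ζ (y 0)) univ :=
        ((hζ.comp (contDiff_coord 0)).of_le two_le_infty).contDiffOn
      rw [lap_mul isOpen_univ hζc (hψ.of_le two_le_infty).contDiffOn (mem_univ z), l1, lap_coord]
      simp_rw [e1, pd_coord]
      simp
    have b1 : ContDiff ℝ (2 * n : ℕ) (fun y : Euc N => deriv (deriv ζ) (y 0) * ψ y) :=
      (cz hζ2 hψ).of_le (natCast_le_infty _)
    have b2 : ContDiff ℝ (2 * n : ℕ) (fun y : Euc N => deriv ζ (y 0) * pd 0 ψ y) :=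
      (cz hζ1 hp).of_le (natCast_le_infty _)
    have b3 : ContDiff ℝ (2 * n : ℕ) (fun y : Euc N => ζ (y 0) * lap ψ y) :=
      (cz hζ hl).of_le (natCast_le_infty _)
    rw [Function.iterate_succ_apply, key,
      lap_iter_add isOpen_univ n (b1.add (contDiff_const.mul b2)).contDiffOn b3.contDiffOn (mem_univ y)]
    beta_reduce
    rw [lap_iter_add isOpen_univ n b1.contDiffOn (contDiff_const.mul b2).contDiffOn (mem_univ y)]
    beta_reduce
    rw [lap_iter_const_mul isOpen_univ 2 n b2.contDiffOn (mem_univ y)]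
    beta_reduce
    set S := ∑ j ∈ Finset.range (2 * (n + 1) + 1), |iteratedDeriv j ζ (y 0)| with hS
    have s3 : ∑ j ∈ Finset.range (2 * n + 1), |iteratedDeriv j ζ (y 0)| ≤ S :=
      Finset.sum_le_sum_of_subset_of_nonneg (Finset.range_mono (by omega)) fun _ _ _ => abs_nonneg _
    have s2 : ∑ j ∈ Finset.range (2 * n + 1), |iteratedDeriv j (deriv ζ) (y 0)| ≤ S := by
      simp_rw [← iteratedDeriv_succ']
      exact sum_range_shift_le (a := fun j => |iteratedDeriv j ζ (y 0)|) (fun _ => abs_nonneg _) (c := 1) (by omega)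
    have s1 : ∑ j ∈ Finset.range (2 * n + 1), |iteratedDeriv j (deriv (deriv ζ)) (y 0)| ≤ S := by
      simp_rw [← iteratedDeriv_succ']
      exact sum_range_shift_le (a := fun j => |iteratedDeriv j ζ (y 0)|) (fun _ => abs_nonneg _) (c := 2) (by omega)
    have t1 := (H1 _ hζ2 y).trans (mul_le_mul_of_nonneg_left s1 h1)
    have t2 := (H2 _ hζ1 y).trans (mul_le_mul_of_nonneg_left s2 h2)
    have t3 := (H3 _ hζ y).trans (mul_le_mul_of_nonneg_left s3 h3)
    refine (abs_add_le _ _).trans ?_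
    have := abs_add_le (lap^[n] (fun y : Euc N => deriv (deriv ζ) (y 0) * ψ y) y)
      (2 * lap^[n] (fun y : Euc N => deriv ζ (y 0) * pd 0 ψ y) y)
    rw [abs_mul, abs_two] at this
    nlinarith

end CutoffEstimate

section Zeta

/-- A smooth function vanishing for `s ≤ δ` and equal to `s ^ m` for `s ≥ 2δ`. -/
noncomputable def zcut (m : ℕ) (δ s : ℝ) : ℝ := s ^ m * Real.smoothTransition (δ⁻¹ * s - 1)

lemma contDiff_zcut (m : ℕ) (δ : ℝ) : ContDiff ℝ ∞ (zcut m δ) := by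
  unfold zcut
  exact (contDiff_id.pow m).mul (Real.smoothTransition.contDiff.comp (by fun_prop))

lemma zcut_of_le {m : ℕ} {δ s : ℝ} (hδ : 0 < δ) (h : s ≤ δ) : zcut m δ s = 0 := by
  unfold zcut
  rw [Real.smoothTransition.zero_of_nonpos, mul_zero]
  rw [sub_nonpos, inv_mul_le_one₀ hδ]
  exact h

lemma zcut_of_ge {m : ℕ} {δ s : ℝ} (hδ : 0 < δ) (h : 2 * δ ≤ s) : zcut m δ s = s ^ m := by
  unfold zcut
  rw [Real.smoothTransition.one_of_one_le, mul_one]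
  have : 2 ≤ δ⁻¹ * s := by
    rw [inv_mul_eq_div, le_div_iff₀ hδ]; exact h
  linarith

lemma abs_zcut_le {m : ℕ} {δ s : ℝ} : |zcut m δ s| ≤ |s| ^ m := by
  unfold zcut
  rw [abs_mul, abs_pow, abs_of_nonneg (Real.smoothTransition.nonneg _)]
  exact mul_le_of_le_one_right (by positivity) (Real.smoothTransition.le_one _)

lemma zcut_scale (m : ℕ) {δ : ℝ} (hδ : 0 < δ) : zcut m δ = fun s => δ ^ m * zcut m 1 (δ⁻¹ * s) := by
  funext s
  unfold zcut
  rw [mul_pow, inv_one, one_mul, ← mul_assoc, ← mul_assoc, ← mul_pow, mul_inv_cancel₀ hδ.ne', one_pow,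
    one_mul]

lemma iteratedDeriv_zcut_one_bound (m j : ℕ) :
    ∃ C, 0 ≤ C ∧ ∀ s, 0 < s → |iteratedDeriv j (zcut m 1) s| * s ^ j ≤ C * s ^ m := by
  have hcont : Continuous (iteratedDeriv j (zcut m 1)) :=
    (contDiff_zcut m 1).continuous_iteratedDeriv j (natCast_le_infty _)
  obtain ⟨C, hC⟩ := (isCompact_Icc (a := (1 : ℝ)) (b := 2)).exists_bound_of_continuousOn
    (f := fun s => iteratedDeriv j (zcut m 1) s * s ^ j) (by fun_prop)
  have hC0 : 0 ≤ C := (norm_nonneg _).trans (hC 1 (by norm_num))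
  refine ⟨C + m.descFactorial j, by positivity, fun s hs => ?_⟩
  rcases lt_or_ge s 1 with h1 | h1
  · have : iteratedDeriv j (zcut m 1) s = 0 := by
      have e : zcut m 1 =ᶠ[𝓝 s] fun _ => 0 := by
        filter_upwards [Iio_mem_nhds h1] with r hr
        exact zcut_of_le one_pos (le_of_lt hr)
      rw [e.iteratedDeriv_eq, iteratedDeriv_const]
      split_ifs <;> rfl
    rw [this, abs_zero, zero_mul]
    positivity
  rcases le_or_gt s 2 with h2 | h2
  · have := hC s ⟨h1, h2⟩
    rw [Real.norm_eq_abs, abs_mul, abs_of_pos (pow_pos hs j)] at this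
    have h3 : 1 ≤ s ^ m := one_le_pow₀ h1
    have h4 : (0 : ℝ) ≤ m.descFactorial j := by positivity
    nlinarith
  · have e : zcut m 1 =ᶠ[𝓝 s] fun r => r ^ m := by
      filter_upwards [Ioi_mem_nhds h2] with r hr
      exact zcut_of_ge one_pos (by simpa using le_of_lt hr)
    rw [e.iteratedDeriv_eq, iteratedDeriv_pow]
    rcases le_or_gt j m with hj | hj
    · rw [abs_of_nonneg (by positivity), mul_assoc, ← pow_add, Nat.sub_add_cancel hj]
      have := pow_pos hs m
      nlinarith
    · rw [Nat.descFactorial_eq_zero_iff_lt.2 hj]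
      simp
      positivity

lemma iteratedDeriv_zcut_bound (m j : ℕ) :
    ∃ C, 0 ≤ C ∧ ∀ δ, 0 < δ → ∀ s, 0 < s → |iteratedDeriv j (zcut m δ) s| * s ^ j ≤ C * s ^ m := by
  obtain ⟨C, h0, hC⟩ := iteratedDeriv_zcut_one_bound m j
  refine ⟨C, h0, fun δ hδ s hs => ?_⟩
  have hs' : 0 < δ⁻¹ * s := by positivity
  have e : iteratedDeriv j (zcut m δ) s = δ ^ m * (δ⁻¹ ^ j * iteratedDeriv j (zcut m 1) (δ⁻¹ * s)) := by
    rw [zcut_scale m hδ, iteratedDeriv_const_mul_field,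
      iteratedDeriv_comp_const_mul ((contDiff_zcut m 1).of_le (natCast_le_infty _))]
  have h := mul_le_mul_of_nonneg_left (hC _ hs') (pow_pos hδ m).le
  rw [e, abs_mul, abs_mul, abs_of_pos (pow_pos hδ m), abs_of_pos (pow_pos (inv_pos.2 hδ) j)]
  calc _ = δ ^ m * (|iteratedDeriv j (zcut m 1) (δ⁻¹ * s)| * (δ⁻¹ * s) ^ j) := by rw [mul_pow]; ring
    _ ≤ _ := h
    _ = C * (δ * δ⁻¹) ^ m * s ^ m := by simp only [mul_pow]; ring
    _ = _ := by rw [mul_inv_cancel₀ hδ.ne', one_pow, mul_one]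

end Zeta

section BoundaryDecay
variable {N : ℕ} [NeZero N]

lemma uniqueDiffOn_half : UniqueDiffOn ℝ {x : Euc N | 0 ≤ x 0} := by
  refine uniqueDiffOn_convex ?_ ⟨bv 0, ?_⟩
  · intro x hx y hy a b ha hb _
    simp only [mem_ofPred_eq, PiLp.add_apply, PiLp.smul_apply, smul_eq_mul] at *
    positivity
  · refine interior_maximal (fun y hy => ?_) (isOpen_half (N := N)) (by simp [bv])
    exact le_of_lt (show 0 < y 0 from hy)

lemma boundary_decay {k : ℕ} {q : ℝ} {u : Euc N → ℝ} (hsol : IsBCSol N (k + 1) q u) :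
    ∃ C, 0 ≤ C ∧ ∀ y : Euc N, 0 ≤ y 0 → |u y| ≤ C * y 0 ^ (k + 1) := by
  obtain ⟨-, hc, hb, -, hd⟩ := hsol
  obtain ⟨C, hC⟩ := hb (k + 1) (by omega)
  set H : Set (Euc N) := {y | 0 ≤ y 0} with hH
  have hC0 : 0 ≤ C := (norm_nonneg _).trans (hC 0 (by simp))
  refine ⟨C, hC0, ?_⟩
  have hline : ∀ (p : Euc N), p 0 = 0 → ∀ s : ℝ, 0 ≤ s → p + s • e1 N ∈ H := by
    intro p hp s hs
    simp [hH, e1, hp, hs]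
  have main : ∀ i, i ≤ k + 1 → ∀ p : Euc N, p 0 = 0 → ∀ s : ℝ, 0 ≤ s →
      |iteratedFDerivWithin ℝ (k + 1 - i) u H (p + s • e1 N) (fun _ => e1 N)| ≤ C * s ^ i := by
    intro i
    induction i with
    | zero =>
      intro _ p hp s hs
      rw [pow_zero, mul_one]
      refine (ContinuousMultilinearMap.le_opNorm
        (iteratedFDerivWithin ℝ (k + 1 - 0) u H (p + s • e1 N)) (fun _ => e1 N)).trans ?_
      simp only [e1, PiLp.norm_single, norm_one, Finset.prod_const_one, mul_one]
      exact hC _ (hline p hp s hs)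
    | succ i ih =>
      intro hi p hp s hs
      obtain ⟨j, hj⟩ : ∃ j, k + 1 - i = j + 1 := ⟨k - i, by omega⟩
      have hj' : k + 1 - (i + 1) = j := by omega
      rw [hj']
      have hder : ∀ r, 0 ≤ r → HasDerivWithinAt
          (fun s : ℝ => iteratedFDerivWithin ℝ j u H (p + s • e1 N) (fun _ => e1 N))
          (iteratedFDerivWithin ℝ (j + 1) u H (p + r • e1 N) (fun _ => e1 N)) (Ici 0) r := by
        intro r hr
        have h1 : DifferentiableWithinAt ℝ (iteratedFDerivWithin ℝ j u H) H (p + r • e1 N) := by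
          refine hc.differentiableOn_iteratedFDerivWithin ?_ uniqueDiffOn_half _ (hline p hp r hr)
          exact_mod_cast (by omega : j < 2 * (k + 1) - 1)
        have h2 : HasDerivWithinAt (fun s : ℝ => p + s • e1 N) (e1 N) (Ici 0) r := by
          simpa using (((hasDerivAt_id r).smul_const (e1 N)).const_add p).hasDerivWithinAt
        have h3 := h1.hasFDerivWithinAt.comp_hasDerivWithinAt (t := H) r h2 (fun s hs => hline p hp s hs)
        have h4 := (ContinuousMultilinearMap.apply ℝ (fun _ : Fin j => Euc N) ℝ (fun _ => e1 N)).hasFDerivAt.comp_hasDerivWithinAt r h3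
        rw [iteratedFDerivWithin_succ_apply_left]
        exact h4
      have hle : ∀ r ∈ Icc (0 : ℝ) s,
          ‖iteratedFDerivWithin ℝ (j + 1) u H (p + r • e1 N) (fun _ => e1 N)‖ ≤ C * s ^ i := by
        intro r hr
        have := ih (by omega) p hp r hr.1
        rw [hj] at this
        exact this.trans (mul_le_mul_of_nonneg_left (pow_le_pow_left₀ hr.1 hr.2 i) hC0)
      have := (convex_Icc (0 : ℝ) s).norm_image_sub_le_of_norm_hasDerivWithin_le
        (fun r hr => (hder r hr.1).mono Icc_subset_Ici_self) hle (left_mem_Icc.2 hs) (right_mem_Icc.2 hs)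
      rw [zero_smul, add_zero, hd j (by omega) p hp, sub_zero, sub_zero, Real.norm_eq_abs, Real.norm_eq_abs,
        abs_of_nonneg hs] at this
      rw [pow_succ, ← mul_assoc]
      exact this
  intro y hy
  have := main (k + 1) le_rfl (y - y 0 • e1 N) (by simp [e1]) (y 0) hy
  rw [sub_add_cancel] at this
  have e : k + 1 - (k + 1) = 0 := Nat.sub_self _
  rw [e, iteratedFDerivWithin_zero_apply] at this
  exact this

end BoundaryDecay

section Basics
variable {N : ℕ} [NeZero N] {k : ℕ} {q : ℝ} {u : Euc N → ℝ}

lemma IsBCSol.continuousOn (hsol : IsBCSol N (k + 1) q u) : ContinuousOn u {x : Euc N | 0 ≤ x 0} :=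
  hsol.2.1.continuousOn

lemma IsBCSol.exists_bound (hsol : IsBCSol N (k + 1) q u) :
    ∃ M, 0 ≤ M ∧ ∀ x : Euc N, 0 ≤ x 0 → |u x| ≤ M := by
  obtain ⟨C, hC⟩ := hsol.2.2.1 0 (by omega)
  refine ⟨C, (norm_nonneg _).trans (hC 0 (by simp)), fun x hx => ?_⟩
  have := hC x hx
  rwa [norm_iteratedFDerivWithin_zero] at this

lemma half_subset : {x : Euc N | 0 < x 0} ⊆ {x : Euc N | 0 ≤ x 0} := fun x hx =>
  le_of_lt (show 0 < x 0 from hx)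

lemma IsBCSol.continuousOn_rpow (hsol : IsBCSol N (k + 1) q u) (hq : 0 ≤ q) :
    ContinuousOn (fun y => u y ^ q) {x : Euc N | 0 < x 0} :=
  (hsol.continuousOn.mono half_subset).rpow_const fun _ _ => Or.inr hq

lemma measurableSet_half : MeasurableSet {x : Euc N | 0 < x 0} := isOpen_half.measurableSet

end Basics

section Weak
variable {N : ℕ} [NeZero N] {k : ℕ} {q : ℝ} {u : Euc N → ℝ}

/-- The equation tested against functions vanishing only to order `m` on the boundary. -/
lemma weak_form (hsol : IsBCSol N (k + 1) q u) (hq : 0 ≤ q) {ψ : Euc N → ℝ} (hψ : ContDiff ℝ ∞ ψ)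
    (hc : HasCompactSupport ψ) :
    IntegrableOn (fun y => u y * polyLap (k + 1) (fun y => y 0 ^ (k + 1) * ψ y) y) {y | 0 < y 0} ∧
    ∫ y in {y : Euc N | 0 < y 0}, u y * polyLap (k + 1) (fun y => y 0 ^ (k + 1) * ψ y) y =
      ∫ y in {y : Euc N | 0 < y 0}, u y ^ q * (y 0 ^ (k + 1) * ψ y) := by
  set m := k + 1 with hm
  obtain ⟨Cu, hCu0, hCu⟩ := boundary_decay hsol
  obtain ⟨M, hM0, hM⟩ := hsol.exists_bound
  have cφ : ∀ {ζ : ℝ → ℝ}, ContDiff ℝ ∞ ζ → ContDiff ℝ ∞ (fun y : Euc N => ζ (y 0) * ψ y) := fun h =>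
    (h.comp (contDiff_coord 0)).mul hψ
  have tφ : ∀ {ζ : ℝ → ℝ}, tsupport (fun y : Euc N => ζ (y 0) * ψ y) ⊆ tsupport ψ := fun {ζ} =>
    tsupport_mul_subset_right (f := fun y : Euc N => ζ (y 0)) (g := ψ)
  set φ : ℕ → Euc N → ℝ := fun n y => zcut m (1 / ((n : ℝ) + 1)) (y 0) * ψ y with hφ
  have hδ : ∀ n : ℕ, (0 : ℝ) < 1 / ((n : ℝ) + 1) := fun n => Nat.one_div_pos_of_nat
  have hsφ : ∀ n, tsupport (φ n) ⊆ {y | 0 < y 0} := by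
    intro n
    have hcl : IsClosed {y : Euc N | 1 / ((n : ℝ) + 1) ≤ y 0} := isClosed_le (by fun_prop) (by fun_prop)
    have : tsupport (φ n) ⊆ {y : Euc N | 1 / ((n : ℝ) + 1) ≤ y 0} := by
      refine closure_minimal (fun y hy => ?_) hcl
      by_contra h
      exact hy (by simp only [hφ]; rw [zcut_of_le (hδ n) (le_of_lt (not_le.1 h)), zero_mul])
    exact this.trans fun y hy => (hδ n).trans_le hy
  have hev : ∀ y : Euc N, 0 < y 0 → ∀ᶠ n : ℕ in atTop, φ n =ᶠ[𝓝 y] fun y => y 0 ^ m * ψ y := by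
    intro y hy
    have : ∀ᶠ n : ℕ in atTop, 1 / ((n : ℝ) + 1) < y 0 / 4 :=
      (tendsto_one_div_add_atTop_nhds_zero_nat (𝕜 := ℝ)).eventually_lt_const (by positivity)
    filter_upwards [this] with n hn
    have ho : IsOpen {z : Euc N | y 0 / 2 < z 0} := isOpen_lt (by fun_prop) (by fun_prop)
    filter_upwards [ho.mem_nhds (show y 0 / 2 < y 0 by linarith)] with z hz
    have hz : y 0 / 2 < z 0 := hz
    simp only [hφ]
    rw [zcut_of_ge (hδ n) (by linarith)]
  have hev2 : ∀ y : Euc N, 0 < y 0 → ∀ᶠ n : ℕ in atTop,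
      lap^[m] (φ n) y = lap^[m] (fun y => y 0 ^ m * ψ y) y := by
    intro y hy
    filter_upwards [hev y hy] with n hn
    obtain ⟨V, hVs, hV, hyV⟩ := eventually_nhds_iff.1 hn
    exact lap_iter_congr hV (fun z hz => hVs z hz) m hyV
  have hid : ∀ n, ∫ y in {y : Euc N | 0 < y 0}, u y * polyLap m (φ n) y =
      ∫ y in {y : Euc N | 0 < y 0}, u y ^ q * φ n y := by
    intro n
    have h := integral_mul_lap_iter isOpen_half (hc.mono_tsupport tφ) (hsφ n) m hsol.1
      ((cφ (contDiff_zcut m _)).of_le (natCast_le_infty _))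
    have s1 : ∀ y ∉ {y : Euc N | 0 < y 0}, u y * polyLap m (φ n) y = 0 := by
      intro y hy
      have : y ∉ tsupport (lap^[m] (φ n)) := fun h => hy (hsφ n (tsupport_lap_iter_subset m _ h))
      simp [polyLap, image_eq_zero_of_notMem_tsupport this]
    have s2 : ∀ y ∉ {y : Euc N | 0 < y 0}, φ n y = 0 := by
      intro y hy
      exact image_eq_zero_of_notMem_tsupport fun h => hy (hsφ n h)
    rw [setIntegral_eq_integral_of_forall_compl_eq_zero s1,
      setIntegral_eq_integral_of_forall_compl_eq_zero (fun y hy => by rw [s2 y hy, mul_zero])]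
    have e1 : ∀ y, u y * polyLap m (φ n) y = (-1) ^ m * (u y * lap^[m] (φ n) y) := fun y => by
      unfold polyLap; ring
    simp_rw [e1]
    rw [integral_const_mul, h, ← integral_const_mul]
    refine integral_congr_ae (Eventually.of_forall fun y => ?_)
    by_cases hy : 0 < y 0
    · have := hsol.2.2.2.1 y hy
      unfold polyLap at this
      simp only
      rw [← this]; ring
    · have hy' := s2 y hy
      simp only [hφ] at hy' ⊢
      simp only [hy', mul_zero]
  obtain ⟨R, hR0, hR⟩ : ∃ R : ℝ, 1 ≤ R ∧ ∀ y ∈ tsupport ψ, y 0 ≤ R := by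
    obtain ⟨R, hR⟩ := hc.isCompact.exists_bound_of_continuousOn (f := fun y : Euc N => y 0) (by fun_prop)
    exact ⟨max R 1, le_max_right _ _, fun y hy => ((le_abs_self _).trans (hR y hy)).trans (le_max_left _ _)⟩
  obtain ⟨C1, hC10, hC1⟩ := lap_iter_zeta_bound m hψ hc
  choose C2 hC20 hC2 using fun j => iteratedDeriv_zcut_bound m j
  set B := Cu * (C1 * ∑ j ∈ Finset.range (2 * m + 1), C2 j * R ^ (2 * m)) with hB
  have hB0 : 0 ≤ B := by
    have : 0 ≤ ∑ j ∈ Finset.range (2 * m + 1), C2 j * R ^ (2 * m) :=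
      Finset.sum_nonneg fun j _ => mul_nonneg (hC20 j) (by positivity)
    positivity
  have hbound : ∀ n (y : Euc N), 0 < y 0 → |u y * polyLap m (φ n) y| ≤ (tsupport ψ).indicator (fun _ => B) y := by
    intro n y hy
    by_cases hyt : y ∈ tsupport ψ
    · rw [indicator_of_mem hyt, abs_mul]
      have h1 : |polyLap m (φ n) y| ≤ C1 * ∑ j ∈ Finset.range (2 * m + 1), |iteratedDeriv j (zcut m (1 / ((n : ℝ) + 1))) (y 0)| := by
        unfold polyLap
        rw [abs_mul, abs_pow, abs_neg, abs_one, one_pow, one_mul]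
        exact hC1 _ (contDiff_zcut m _) y
      have h2 : y 0 ^ m * ∑ j ∈ Finset.range (2 * m + 1), |iteratedDeriv j (zcut m (1 / ((n : ℝ) + 1))) (y 0)| ≤
          ∑ j ∈ Finset.range (2 * m + 1), C2 j * R ^ (2 * m) := by
        rw [Finset.mul_sum]
        refine Finset.sum_le_sum fun j hj => ?_
        have hj' : j ≤ 2 * m := by simpa [Nat.lt_succ_iff] using hj
        have h3 := hC2 j _ (hδ n) _ hy
        have h4 : y 0 ^ m * |iteratedDeriv j (zcut m (1 / ((n : ℝ) + 1))) (y 0)| ≤ C2 j * y 0 ^ (2 * m - j) := by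
          refine le_of_mul_le_mul_right ?_ (pow_pos hy j)
          calc _ = y 0 ^ m * (|iteratedDeriv j (zcut m (1 / ((n : ℝ) + 1))) (y 0)| * y 0 ^ j) := by ring
            _ ≤ y 0 ^ m * (C2 j * y 0 ^ m) := by gcongr
            _ = C2 j * y 0 ^ (2 * m - j + j) := by rw [Nat.sub_add_cancel hj']; ring
            _ = _ := by rw [pow_add]; ring
        refine h4.trans ?_
        gcongr
        · exact hC20 j
        calc y 0 ^ (2 * m - j) ≤ R ^ (2 * m - j) := pow_le_pow_left₀ hy.le (hR y hyt) _
          _ ≤ R ^ (2 * m) := pow_le_pow_right₀ hR0 (by omega)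
      calc |u y| * |polyLap m (φ n) y| ≤ (Cu * y 0 ^ m) * (C1 * ∑ j ∈ Finset.range (2 * m + 1), |iteratedDeriv j (zcut m (1 / ((n : ℝ) + 1))) (y 0)|) :=
            mul_le_mul (hCu y hy.le) h1 (abs_nonneg _) (by positivity)
        _ = Cu * (C1 * (y 0 ^ m * ∑ j ∈ Finset.range (2 * m + 1), |iteratedDeriv j (zcut m (1 / ((n : ℝ) + 1))) (y 0)|)) := by ring
        _ ≤ B := by rw [hB]; gcongr
    · have : y ∉ tsupport (lap^[m] (φ n)) := fun h => hyt (tφ (tsupport_lap_iter_subset m _ h))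
      rw [indicator_of_notMem hyt]
      simp [polyLap, image_eq_zero_of_notMem_tsupport this]
  have hInt : ∀ c : ℝ, Integrable ((tsupport ψ).indicator fun _ => c) (volume.restrict {y : Euc N | 0 < y 0}) := by
    intro c
    refine Integrable.integrableOn ?_
    rw [integrable_indicator_iff (isClosed_tsupport ψ).measurableSet]
    exact integrableOn_const hc.isCompact.measure_lt_top.ne
  have hlim : ∀ y : Euc N, 0 < y 0 → Tendsto (fun n => u y * polyLap m (φ n) y) atTop
      (𝓝 (u y * polyLap m (fun y => y 0 ^ m * ψ y) y)) := by
    intro y hy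
    refine tendsto_const_nhds.congr' ?_
    filter_upwards [hev2 y hy] with n hn
    simp only [polyLap, hn]
  have hmeas : ∀ n, AEStronglyMeasurable (fun y => u y * polyLap m (φ n) y) (volume.restrict {y : Euc N | 0 < y 0}) := by
    intro n
    refine ContinuousOn.aestronglyMeasurable ?_ measurableSet_half
    refine (hsol.continuousOn.mono half_subset).mul (Continuous.continuousOn ?_)
    unfold polyLap
    exact continuous_const.mul (ContDiff.lap_iter_contDiff (m := 0) m ((cφ (contDiff_zcut m _)).of_le (by rw [zero_add]; exact natCast_le_infty _))).continuous
  have L1 := tendsto_integral_of_dominated_convergence _ hmeas (hInt B)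
    (fun n => (ae_restrict_iff' measurableSet_half).2 (Eventually.of_forall fun y hy => hbound n y hy))
    ((ae_restrict_iff' measurableSet_half).2 (Eventually.of_forall hlim))
  obtain ⟨Cψ, hCψ⟩ := hc.exists_bound_of_continuous hψ.continuous
  have L2 : Tendsto (fun n => ∫ y in {y : Euc N | 0 < y 0}, u y ^ q * φ n y) atTop
      (𝓝 (∫ y in {y : Euc N | 0 < y 0}, u y ^ q * (y 0 ^ m * ψ y))) := by
    refine tendsto_integral_of_dominated_convergence _ ?_ (hInt (M ^ q * (R ^ m * Cψ))) ?_ ?_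
    · intro n
      refine ContinuousOn.aestronglyMeasurable ?_ measurableSet_half
      exact (hsol.continuousOn_rpow hq).mul (cφ (contDiff_zcut m _)).continuous.continuousOn
    · intro n
      refine (ae_restrict_iff' measurableSet_half).2 (Eventually.of_forall fun y hy => ?_)
      have hy : 0 < y 0 := hy
      by_cases hyt : y ∈ tsupport ψ
      · rw [indicator_of_mem hyt, norm_mul, hφ]
        simp only [norm_mul]
        have h1 : ‖u y ^ q‖ ≤ M ^ q := by
          refine (Real.abs_rpow_le_abs_rpow _ _).trans ?_
          exact Real.rpow_le_rpow (abs_nonneg _) (hM y hy.le) hq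
        have h2 : ‖zcut m (1 / ((n : ℝ) + 1)) (y 0)‖ ≤ R ^ m := by
          refine abs_zcut_le.trans ?_
          rw [abs_of_pos hy]
          exact pow_le_pow_left₀ hy.le (hR y hyt) _
        have := hCψ y
        gcongr
      · rw [indicator_of_notMem hyt]
        simp [hφ, image_eq_zero_of_notMem_tsupport hyt]
    · refine (ae_restrict_iff' measurableSet_half).2 (Eventually.of_forall fun y hy => ?_)
      refine tendsto_const_nhds.congr' ?_
      filter_upwards [hev y hy] with n hn
      rw [hn.self_of_nhds]
  refine ⟨?_, tendsto_nhds_unique L1 (L2.congr fun n => (hid n).symm)⟩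
  refine (hInt B).mono' (aestronglyMeasurable_of_tendsto_ae atTop hmeas
    ((ae_restrict_iff' measurableSet_half).2 (Eventually.of_forall hlim))) ?_
  refine (ae_restrict_iff' measurableSet_half).2 (Eventually.of_forall fun y hy => ?_)
  exact le_of_tendsto (hlim y hy).norm (Eventually.of_forall fun n => hbound n y hy)

end Weak

section Scale
variable {N : ℕ}

lemma lap_scale (a c : ℝ) (f : Euc N → ℝ) (x : Euc N) :
    lap (fun y => a * f (c • y)) x = a * c ^ 2 * lap f (c • x) := by
  unfold lap
  rw [Finset.mul_sum]
  refine Finset.sum_congr rfl fun i _ => ?_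
  rw [iteratedDeriv_succ, iteratedDeriv_one, iteratedDeriv_succ, iteratedDeriv_one]
  set g : ℝ → ℝ := fun s => f (c • x + s • EuclideanSpace.single i (1 : ℝ)) with hg
  have e : (fun t : ℝ => a * f (c • (x + t • EuclideanSpace.single i (1 : ℝ)))) = fun t => a * g (c * t) := by
    funext t
    simp only [hg]
    rw [smul_add, smul_smul]
  have e2 : deriv (fun t => a * g (c * t)) = fun t => (a * c) * deriv g (c * t) := by
    funext t
    rw [deriv_const_mul_field, deriv_comp_mul_left, smul_eq_mul, mul_assoc]
  rw [e, e2, deriv_const_mul_field, deriv_comp_mul_left, smul_eq_mul, mul_zero]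
  ring

lemma lap_iter_scale (a c : ℝ) (f : Euc N → ℝ) (n : ℕ) (x : Euc N) :
    lap^[n] (fun y => a * f (c • y)) x = a * c ^ (2 * n) * lap^[n] f (c • x) := by
  induction n generalizing x with
  | zero => simp
  | succ n ih =>
    rw [Function.iterate_succ_apply', Function.iterate_succ_apply', funext ih, lap_scale]
    ring

end Scale

section Annulus
variable {N : ℕ} [NeZero N] {k : ℕ}

/-- The kernel `kh` without the power of the height of the pole. -/
noncomputable def kr (k : ℕ) (x : Euc N) (σ : ℝ) (y : Euc N) : ℝ :=
  (4 * y 0) ^ (k + 1) * σ ^ k * kQ x σ y ^ (-((N : ℝ) / 2))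

lemma kh_eq_kr (k : ℕ) (x : Euc N) (σ : ℝ) (y : Euc N) : kh k x σ y = x 0 ^ (k + 1) * kr k x σ y := by
  unfold kh kr
  rw [show 4 * x 0 * y 0 = x 0 * (4 * y 0) by ring, mul_pow]; ring

lemma kQ_smul (c : ℝ) (x : Euc N) (σ : ℝ) (y : Euc N) : kQ (c • x) σ (c • y) = c ^ 2 * kQ x σ y := by
  unfold kQ
  rw [← smul_sub, norm_smul, mul_pow, Real.norm_eq_abs, sq_abs]
  simp only [PiLp.smul_apply, smul_eq_mul]
  ring

lemma kr_scale {c : ℝ} (hc : 0 < c) {x y : Euc N} {σ : ℝ} (hQ : 0 ≤ kQ x σ y) :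
    kr k x σ y = c ^ N * (c⁻¹) ^ (k + 1) * kr k (c • x) σ (c • y) := by
  unfold kr
  rw [kQ_smul, Real.mul_rpow (by positivity) hQ]
  have : (c ^ 2) ^ (-((N : ℝ) / 2)) = (c ^ N)⁻¹ := by
    rw [← Real.rpow_natCast c 2, ← Real.rpow_mul hc.le, ← Real.rpow_natCast, ← Real.rpow_neg hc.le]
    congr 1; push_cast; ring
  rw [this]
  simp only [PiLp.smul_apply, smul_eq_mul]
  rw [show 4 * (c * y 0) = c * (4 * y 0) by ring, mul_pow c, inv_pow]
  field_simp

lemma contDiffOn_kr_joint (k : ℕ) {χ : Euc N → ℝ} (hχ : ContDiff ℝ ∞ χ) :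
    ContDiffOn ℝ ∞ (fun z : Euc N × (Euc N × ℝ) => kr k z.2.1 z.2.2 z.1 * χ z.1)
      {z | 0 < kQ z.2.1 z.2.2 z.1} := by
  unfold kr
  refine ((ContDiff.contDiffOn ?_).mul (contDiff_kQ_joint.contDiffOn.rpow_const_of_ne fun z hz => ne_of_gt hz)).mul
    (hχ.comp contDiff_fst).contDiffOn
  refine ((contDiff_const.mul ((contDiff_coord 0).comp contDiff_fst)).pow _).mul ((contDiff_snd.comp contDiff_snd).pow _)

lemma kr_annulus_bound (k : ℕ) {χ : Euc N → ℝ} (hχ : ContDiff ℝ ∞ χ) :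
    ∃ C, 0 ≤ C ∧ ∀ (a η : Euc N) (σ : ℝ), 0 ≤ a 0 → ‖a‖ ≤ 1 / 2 → σ ∈ Icc (0 : ℝ) 1 → 0 ≤ η 0 → 1 ≤ ‖η‖ →
      ‖η‖ ≤ 2 → |lap^[k + 1] (fun y => kr k a σ y * χ y) η| ≤ C := by
  have hU : IsOpen {z : Euc N × (Euc N × ℝ) | 0 < kQ z.2.1 z.2.2 z.1} :=
    isOpen_lt continuous_const (contDiff_kQ_joint (n := 0)).continuous
  have h := (contDiffOn_lap_iter_param hU (k + 1) (contDiffOn_kr_joint k hχ)).continuousOn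
  set S1 : Set (Euc N) := Metric.closedBall 0 2 ∩ ({η | 1 ≤ ‖η‖} ∩ {η | 0 ≤ η 0}) with hS1
  set S2 : Set (Euc N) := Metric.closedBall 0 (1 / 2) ∩ {a | 0 ≤ a 0} with hS2
  have c1 : IsCompact S1 := (isCompact_closedBall _ _).inter_right
    ((isClosed_le (by fun_prop) (by fun_prop)).inter (isClosed_le (by fun_prop) (by fun_prop)))
  have c2 : IsCompact S2 := (isCompact_closedBall _ _).inter_right (isClosed_le (by fun_prop) (by fun_prop))
  have c3 : IsCompact (S1 ×ˢ (S2 ×ˢ Icc (0 : ℝ) 1)) := c1.prod (c2.prod isCompact_Icc)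
  have hsub : S1 ×ˢ (S2 ×ˢ Icc (0 : ℝ) 1) ⊆ {z : Euc N × (Euc N × ℝ) | 0 < kQ z.2.1 z.2.2 z.1} := by
    rintro ⟨η, a, σ⟩ ⟨⟨_, h1, h2⟩, ⟨h3, h4⟩, h5, _⟩
    have h1 : 1 ≤ ‖η‖ := h1
    have h2 : 0 ≤ η 0 := h2
    have h4 : 0 ≤ a 0 := h4
    have h3 : ‖a‖ ≤ 1 / 2 := by simpa using h3
    have h5 : 0 ≤ σ := h5
    have h6 : 1 / 2 ≤ ‖a - η‖ := by
      have := norm_sub_norm_le η a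
      rw [norm_sub_rev] at this; linarith
    show 0 < kQ a σ η
    unfold kQ
    have : 0 < ‖a - η‖ := by linarith
    positivity
  obtain ⟨C, hC⟩ := c3.exists_bound_of_continuousOn (h.mono hsub)
  refine ⟨max C 0, le_max_right _ _, fun a η σ h1 h2 h3 h4 h5 h6 => ?_⟩
  exact (hC (η, (a, σ)) ⟨⟨by simpa using h6, h5, h4⟩, ⟨by simpa using h2, h1⟩, h3⟩).trans (le_max_left _ _)

lemma kh_annulus_bound (k : ℕ) {χ : Euc N → ℝ} (hχ : ContDiff ℝ ∞ χ) :
    ∃ C, 0 ≤ C ∧ ∀ (x y : Euc N) (σ R : ℝ), 0 < x 0 → 0 < R → 2 * ‖x‖ ≤ R → σ ∈ Ioc (0 : ℝ) 1 → 0 < y 0 →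
      R ≤ ‖y‖ → ‖y‖ ≤ 2 * R →
      |lap^[k + 1] (fun y => kh k x σ y * χ (R⁻¹ • y)) y| ≤ x 0 ^ (k + 1) * R⁻¹ ^ (N + (k + 1)) * C := by
  obtain ⟨C, hC0, hC⟩ := kr_annulus_bound k hχ
  refine ⟨C, hC0, fun x y σ R hx hR hxR hσ hy h1 h2 => ?_⟩
  have hc : 0 < R⁻¹ := inv_pos.2 hR
  have e : EqOn (fun y : Euc N => kh k x σ y * χ (R⁻¹ • y)) (fun y => (x 0 ^ (k + 1) * (R⁻¹ ^ N * R ^ (k + 1))) *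
      ((fun y => kr k (R⁻¹ • x) σ y * χ y) (R⁻¹ • y))) {y | 0 < y 0} := by
    intro y hy
    have hy : 0 < y 0 := hy
    simp only
    rw [kh_eq_kr, kr_scale hc (kQ_pos hx hy hσ.1).le, inv_inv]
    ring
  rw [(lap_iter_congr isOpen_half e (k + 1) hy).trans
    (lap_iter_scale _ R⁻¹ (fun y => kr k (R⁻¹ • x) σ y * χ y) (k + 1) y), abs_mul]
  have hb := hC (R⁻¹ • x) (R⁻¹ • y) σ (by simp only [PiLp.smul_apply, smul_eq_mul]; positivity)
    (by rw [norm_smul, Real.norm_of_nonneg hc.le, inv_mul_le_iff₀ hR]; linarith) ⟨hσ.1.le, hσ.2⟩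
    (by simp only [PiLp.smul_apply, smul_eq_mul]; positivity)
    (by rw [norm_smul, Real.norm_of_nonneg hc.le, le_inv_mul_iff₀ hR]; linarith)
    (by rw [norm_smul, Real.norm_of_nonneg hc.le, inv_mul_le_iff₀ hR]; linarith)
  have ec : x 0 ^ (k + 1) * (R⁻¹ ^ N * R ^ (k + 1)) * R⁻¹ ^ (2 * (k + 1)) = x 0 ^ (k + 1) * R⁻¹ ^ (N + (k + 1)) := by
    have key : ∀ S A : ℝ, R * S = 1 → A * (S ^ N * R ^ (k + 1)) * S ^ (2 * (k + 1)) = A * S ^ (N + (k + 1)) := by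
      intro S A hS
      calc _ = A * S ^ (N + (k + 1)) * (R * S) ^ (k + 1) := by rw [mul_pow]; ring
        _ = _ := by rw [hS, one_pow, mul_one]
    exact key _ _ (mul_inv_cancel₀ hR.ne')
  rw [ec, abs_of_nonneg (by positivity)]
  gcongr

lemma kh_strip_bound (k : ℕ) {x : Euc N} (hx : 0 < x 0) (R : ℝ) :
    ∃ C, 0 ≤ C ∧ ∀ (y : Euc N) (σ : ℝ), σ ∈ Icc (0 : ℝ) 1 → 0 ≤ y 0 → y 0 ≤ x 0 / 2 →
      ‖y‖ ≤ R → |lap^[k + 1] (kh k x σ) y| ≤ C := by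
  have hU : IsOpen {z : Euc N × (Euc N × ℝ) | 0 < kQ z.2.1 z.2.2 z.1} :=
    isOpen_lt continuous_const (contDiff_kQ_joint (n := 0)).continuous
  have h := (contDiffOn_lap_iter_param hU (k + 1) (contDiffOn_kh_joint k)).continuousOn
  set S1 : Set (Euc N) := Metric.closedBall 0 R ∩ ({η | η 0 ≤ x 0 / 2} ∩ {η | 0 ≤ η 0}) with hS1
  have c1 : IsCompact S1 := (isCompact_closedBall _ _).inter_right
    ((isClosed_le (by fun_prop) (by fun_prop)).inter (isClosed_le (by fun_prop) (by fun_prop)))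
  have c3 : IsCompact (S1 ×ˢ (({x} : Set (Euc N)) ×ˢ Icc (0 : ℝ) 1)) := c1.prod (isCompact_singleton.prod isCompact_Icc)
  have hsub : S1 ×ˢ (({x} : Set (Euc N)) ×ˢ Icc (0 : ℝ) 1) ⊆ {z : Euc N × (Euc N × ℝ) | 0 < kQ z.2.1 z.2.2 z.1} := by
    rintro ⟨η, a, σ⟩ ⟨⟨_, h1, h2⟩, h3, h5, _⟩
    have h1 : η 0 ≤ x 0 / 2 := h1
    have h2 : 0 ≤ η 0 := h2
    have h3 : a = x := h3
    have h5 : 0 ≤ σ := h5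
    have : 0 < ‖x - η‖ := by
      rw [norm_pos_iff, sub_ne_zero]
      rintro rfl
      linarith
    show 0 < kQ a σ η
    rw [h3]
    unfold kQ
    positivity
  obtain ⟨C, hC⟩ := c3.exists_bound_of_continuousOn (h.mono hsub)
  refine ⟨max C 0, le_max_right _ _, fun y σ h1 h2 h3 h4 => ?_⟩
  exact (hC (y, (x, σ)) ⟨⟨by simpa using h4, h3, h2⟩, rfl, h1⟩).trans (le_max_left _ _)

end Annulus

section Chi
variable {N : ℕ}

/-- A cut-off function equal to one on the unit ball. -/
noncomputable def chi (N : ℕ) : Euc N → ℝ := fun y => (⟨1, 2, one_pos, one_lt_two⟩ : ContDiffBump (0 : Euc N)) y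

lemma contDiff_chi : ContDiff ℝ ∞ (chi N) := ContDiffBump.contDiff _

lemma chi_nonneg (y : Euc N) : 0 ≤ chi N y := ContDiffBump.nonneg _

lemma chi_le_one (y : Euc N) : chi N y ≤ 1 := ContDiffBump.le_one _

lemma chi_of_le {y : Euc N} (h : ‖y‖ ≤ 1) : chi N y = 1 :=
  ContDiffBump.one_of_mem_closedBall _ (by simpa using h)

lemma chi_of_ge {y : Euc N} (h : 2 ≤ ‖y‖) : chi N y = 0 :=
  ContDiffBump.zero_of_le_dist _ (by simpa using h)

lemma chi_smul_of_le {R : ℝ} (hR : 0 < R) {y : Euc N} (h : ‖y‖ ≤ R) : chi N (R⁻¹ • y) = 1 :=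
  chi_of_le (by rw [norm_smul, norm_inv, Real.norm_of_nonneg hR.le, inv_mul_le_iff₀ hR]; linarith)

lemma chi_smul_of_ge {R : ℝ} (hR : 0 < R) {y : Euc N} (h : 2 * R ≤ ‖y‖) : chi N (R⁻¹ • y) = 0 :=
  chi_of_ge (by rw [norm_smul, norm_inv, Real.norm_of_nonneg hR.le, le_inv_mul_iff₀ hR]; linarith)

lemma tsupport_chi_smul {R : ℝ} (hR : 0 < R) :
    tsupport (fun y : Euc N => chi N (R⁻¹ • y)) ⊆ Metric.closedBall 0 (2 * R) := by
  refine closure_minimal (fun y hy => ?_) Metric.isClosed_closedBall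
  by_contra h
  refine hy (chi_smul_of_ge hR ?_)
  have : ¬ ‖y‖ ≤ 2 * R := by simpa using h
  exact (not_le.1 this).le

end Chi

section Rep
variable {N : ℕ} [NeZero N] {k : ℕ} {q : ℝ} {u : Euc N → ℝ}

/-- Comparison of the two ways of cutting off the kernel. -/
lemma cutoff_diff_bound (N k : ℕ) [NeZero N] : ∃ C1, 0 ≤ C1 ∧ ∀ (x : Euc N), 0 < x 0 → ∀ R : ℝ, 0 < R → 2 * ‖x‖ ≤ R →
    ∃ C2, 0 ≤ C2 ∧ ∀ δ : ℝ, 0 < δ → 2 * δ ≤ x 0 / 2 → ∀ σ ∈ Ioc (0 : ℝ) 1, ∀ y : Euc N, 0 < y 0 →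
      |lap^[k + 1] (kh k x σ) y * (zcut 0 δ (y 0) * chi N (R⁻¹ • y)) -
        lap^[k + 1] (fun y => kh k x σ y * chi N (R⁻¹ • y)) y| ≤
      (Metric.closedBall (0 : Euc N) (2 * R)).indicator (fun _ => x 0 ^ (k + 1) * R⁻¹ ^ (N + (k + 1)) * C1) y +
      (Metric.closedBall (0 : Euc N) (2 * R) ∩ {y | y 0 < 2 * δ}).indicator (fun _ => C2) y := by
  obtain ⟨Ca, ha0, ha⟩ := kh_annulus_bound (N := N) k contDiff_chi
  obtain ⟨Cb, hb0, hb⟩ := kh_annulus_bound (N := N) k (χ := fun _ => 1) contDiff_const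
  refine ⟨Ca + Cb, by positivity, fun x hx R hR hxR => ?_⟩
  obtain ⟨C2, hC20, hC2⟩ := kh_strip_bound k hx (2 * R)
  refine ⟨C2, hC20, fun δ hδ hδx σ hσ y hy => ?_⟩
  have hRi : 0 < R⁻¹ := inv_pos.2 hR
  have hz : |zcut 0 δ (y 0)| ≤ 1 := by simpa using abs_zcut_le (m := 0) (δ := δ) (s := y 0)
  have nn2 : 0 ≤ (Metric.closedBall (0 : Euc N) (2 * R) ∩ {y | y 0 < 2 * δ}).indicator (fun _ => C2) y :=
    indicator_nonneg (fun _ _ => hC20) _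
  rcases lt_or_ge (2 * R) ‖y‖ with h | h
  · have ho : IsOpen {z : Euc N | 2 * R < ‖z‖} := isOpen_lt (by fun_prop) (by fun_prop)
    have e : EqOn (fun y => kh k x σ y * chi N (R⁻¹ • y)) (fun y => 0 * (fun _ => (0 : ℝ)) ((1 : ℝ) • y)) {z : Euc N | 2 * R < ‖z‖} := by
      intro z hz
      have hz : 2 * R < ‖z‖ := hz
      simp only
      rw [chi_smul_of_ge hR hz.le]; simp
    rw [(lap_iter_congr ho e (k + 1) h).trans (lap_iter_scale 0 1 (fun _ => (0 : ℝ)) (k + 1) y), chi_smul_of_ge hR h.le]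
    have : y ∉ Metric.closedBall (0 : Euc N) (2 * R) := by simpa using h
    simp [this]
  have hyb : y ∈ Metric.closedBall (0 : Euc N) (2 * R) := by simpa using h
  rw [indicator_of_mem hyb]
  rcases le_or_gt R ‖y‖ with h1 | h1
  · have h2 := ha x y σ R hx hR hxR hσ hy h1 h
    have h3 := hb x y σ R hx hR hxR hσ hy h1 h
    simp only [mul_one] at h3
    have h4 : |lap^[k + 1] (kh k x σ) y * (zcut 0 δ (y 0) * chi N (R⁻¹ • y))| ≤ |lap^[k + 1] (kh k x σ) y| := by
      rw [abs_mul, abs_mul, abs_of_nonneg (chi_nonneg _)]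
      refine mul_le_of_le_one_right (abs_nonneg _) (mul_le_one₀ hz (chi_nonneg _) (chi_le_one _))
    refine (abs_sub _ _).trans ?_
    have h5 : |lap^[k + 1] (kh k x σ) y| ≤ x 0 ^ (k + 1) * R⁻¹ ^ (N + (k + 1)) * Cb := h3
    linarith
  · have ho : IsOpen {z : Euc N | ‖z‖ < R} := isOpen_lt (by fun_prop) (by fun_prop)
    have e : EqOn (fun y => kh k x σ y * chi N (R⁻¹ • y)) (kh k x σ) {z : Euc N | ‖z‖ < R} := by
      intro z hz
      have hz : ‖z‖ < R := hz
      simp only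
      rw [chi_smul_of_le hR hz.le, mul_one]
    rw [lap_iter_congr ho e (k + 1) h1, chi_smul_of_le hR h1.le, mul_one]
    rcases le_or_gt (2 * δ) (y 0) with h2 | h2
    · rw [zcut_of_ge hδ h2]
      simp only [pow_zero, mul_one, sub_self, abs_zero]
      positivity
    · rw [indicator_of_mem (show y ∈ Metric.closedBall (0 : Euc N) (2 * R) ∩ {y | y 0 < 2 * δ} from ⟨hyb, h2⟩)]
      have h3 := hC2 y σ ⟨hσ.1.le, hσ.2⟩ hy.le (by linarith) h
      rw [show lap^[k + 1] (kh k x σ) y * zcut 0 δ (y 0) - lap^[k + 1] (kh k x σ) y = lap^[k + 1] (kh k x σ) y * (zcut 0 δ (y 0) - 1) by ring, abs_mul]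
      have h4 : |zcut 0 δ (y 0) - 1| ≤ 1 := by
        unfold zcut
        rw [pow_zero, one_mul, abs_le]
        constructor <;> linarith [Real.smoothTransition.nonneg (δ⁻¹ * y 0 - 1), Real.smoothTransition.le_one (δ⁻¹ * y 0 - 1)]
      have : 0 ≤ x 0 ^ (k + 1) * R⁻¹ ^ (N + (k + 1)) * (Ca + Cb) := by positivity
      have h5 := mul_le_of_le_one_right (abs_nonneg (lap^[k + 1] (kh k x σ) y)) h4
      linarith

end Rep

section RepCut
variable {N : ℕ} [NeZero N] {k : ℕ} {q : ℝ} {u : Euc N → ℝ}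

lemma kQ_pos_of_lt {x : Euc N} (hx : 0 < x 0) {σ : ℝ} (h0 : 0 < σ) (h1 : σ < 1) (y : Euc N) : 0 < kQ x σ y := by
  rw [kQ_eq]
  have : 0 < 4 * x 0 ^ 2 * σ * (1 - σ) := by
    have := sub_pos.2 h1
    positivity
  positivity

lemma measurable_indicator_rpow (hsol : IsBCSol N (k + 1) q u) (hq : 0 ≤ q) :
    AEStronglyMeasurable ({y : Euc N | 0 < y 0}.indicator fun y => u y ^ q) volume := by
  rw [aestronglyMeasurable_indicator_iff measurableSet_half]
  exact (hsol.continuousOn_rpow hq).aestronglyMeasurable measurableSet_half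

lemma integral_kh_diff (hsol : IsBCSol N (k + 1) q u) (hq : 0 ≤ q) {M : ℝ}
    (hM : ∀ y : Euc N, 0 ≤ y 0 → |u y| ≤ M) {x : Euc N} (hx : 0 < x 0) {σ : ℝ} (hσ0 : 0 < σ) (hσ1 : σ < 1)
    {R : ℝ} (hR : 0 < R) {c : ℝ → ℝ} (hc : ContDiff ℝ ∞ c)
    (hs : tsupport (fun y : Euc N => c (y 0) * chi N (R⁻¹ • y)) ⊆ {y | 0 < y 0})
    {B : Euc N → ℝ} (hBi : IntegrableOn B {y | 0 < y 0})
    (hB : ∀ y : Euc N, 0 < y 0 → |lap^[k + 1] (kh k x σ) y * (c (y 0) * chi N (R⁻¹ • y)) -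
        lap^[k + 1] (fun y => kh k x σ y * chi N (R⁻¹ • y)) y| ≤ B y) :
    |(∫ y, kh k x σ y * polyLap (k + 1) (fun y => u y * (c (y 0) * chi N (R⁻¹ • y))) y) -
      ∫ y, kh k x σ y * ({y : Euc N | 0 < y 0}.indicator (fun y => u y ^ q) y * chi N (R⁻¹ • y))| ≤
      ∫ y in {y : Euc N | 0 < y 0}, M * B y := by
  set m := k + 1 with hm
  have hchi : ContDiff ℝ ∞ fun y : Euc N => chi N (R⁻¹ • y) := contDiff_chi.comp (contDiff_const_smul _)
  have hchic : HasCompactSupport fun y : Euc N => chi N (R⁻¹ • y) :=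
    HasCompactSupport.of_support_subset_isCompact (isCompact_closedBall (0 : Euc N) (2 * R))
      ((subset_tsupport _).trans (tsupport_chi_smul hR))
  set cut : Euc N → ℝ := fun y => c (y 0) * chi N (R⁻¹ • y) with hcut
  have hcutd : ContDiff ℝ ∞ cut := (hc.comp (contDiff_coord 0)).mul hchi
  have hcutc : HasCompactSupport cut := hchic.mul_left
  have hφd : ContDiff ℝ (2 * m : ℕ) fun y => u y * cut y :=
    contDiff_mul_of_tsupport isOpen_half hsol.1 (hcutd.of_le (natCast_le_infty _)) hs
  have hφs : tsupport (fun y => u y * cut y) ⊆ {y | 0 < y 0} := (tsupport_mul_subset_right).trans hs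
  have hφc : HasCompactSupport fun y => u y * cut y := hcutc.mul_left
  have hkh : ContDiffOn ℝ ∞ (kh k x σ) {y | 0 < y 0} := contDiffOn_kh k hx hσ0
  have i1 := integral_mul_lap_iter isOpen_half hφc hφs m (hkh.of_le (natCast_le_infty _)) hφd
  have hL := (ContDiffOn.lap_iter_infty isOpen_half m hkh).continuousOn
  have i1i : Integrable fun y => lap^[m] (kh k x σ) y * (u y * cut y) :=
    integrable_mul_of_tsupport isOpen_half hL hφd.continuous hφc hφs
  set ψ : Euc N → ℝ := fun y => (4 * x 0) ^ m * σ ^ k * kQ x σ y ^ (-((N : ℝ) / 2)) * chi N (R⁻¹ • y) with hψ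
  have hψd : ContDiff ℝ ∞ ψ :=
    (contDiff_const.mul ((contDiff_kQ x σ).rpow_const_of_ne fun y => (kQ_pos_of_lt hx hσ0 hσ1 y).ne')).mul hchi
  have hψc : HasCompactSupport ψ := hchic.mul_left
  have eψ : (fun y : Euc N => y 0 ^ (k + 1) * ψ y) = fun y => kh k x σ y * chi N (R⁻¹ • y) := by
    funext y
    simp only [hψ, kh, hm]
    rw [show 4 * x 0 * y 0 = y 0 * (4 * x 0) by ring, mul_pow (y 0)]; ring
  have i2 := weak_form hsol hq hψd hψc
  rw [eψ] at i2
  have e1 : ∫ y, kh k x σ y * polyLap m (fun y => u y * cut y) y =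
      ∫ y in {y : Euc N | 0 < y 0}, u y * ((-1) ^ m * (lap^[m] (kh k x σ) y * cut y)) := by
    have : ∀ y, kh k x σ y * polyLap m (fun y => u y * cut y) y =
        (-1) ^ m * (kh k x σ y * lap^[m] (fun y => u y * cut y) y) := fun y => by unfold polyLap; ring
    simp_rw [this]
    rw [integral_const_mul, i1, ← integral_const_mul, ← setIntegral_eq_integral_of_forall_compl_eq_zero (s := {y : Euc N | 0 < y 0})]
    · refine integral_congr_ae (Eventually.of_forall fun y => ?_)
      simp only; ring
    · intro y hy
      rw [image_eq_zero_of_notMem_tsupport (f := cut) fun h => hy (hs h)]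
      simp
  have e2 : ∫ y, kh k x σ y * ({y : Euc N | 0 < y 0}.indicator (fun y => u y ^ q) y * chi N (R⁻¹ • y)) =
      ∫ y in {y : Euc N | 0 < y 0}, u y * polyLap m (fun y => kh k x σ y * chi N (R⁻¹ • y)) y := by
    rw [i2.2, ← setIntegral_eq_integral_of_forall_compl_eq_zero (s := {y : Euc N | 0 < y 0})]
    · refine setIntegral_congr_fun measurableSet_half fun y hy => ?_
      simp only
      have := congrFun eψ y
      simp only at this
      rw [indicator_of_mem hy, this]; ring
    · intro y hy
      rw [indicator_of_notMem hy]; ring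
  rw [e1, e2, ← integral_sub _ i2.1]
  · rw [← Real.norm_eq_abs]
    refine norm_integral_le_of_norm_le (hBi.const_mul M) ((ae_restrict_iff' measurableSet_half).2 (Eventually.of_forall fun y hy => ?_))
    have hy : 0 < y 0 := hy
    have : u y * ((-1) ^ m * (lap^[m] (kh k x σ) y * cut y)) - u y * polyLap m (fun y => kh k x σ y * chi N (R⁻¹ • y)) y =
        u y * ((-1) ^ m * (lap^[m] (kh k x σ) y * cut y - lap^[m] (fun y => kh k x σ y * chi N (R⁻¹ • y)) y)) := by
      unfold polyLap; ring
    rw [this, norm_mul, norm_mul, norm_pow, norm_neg, norm_one, one_pow, one_mul, Real.norm_eq_abs, Real.norm_eq_abs]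
    exact mul_le_mul (hM y hy.le) (hB y hy) (abs_nonneg _) ((abs_nonneg _).trans (hM y hy.le))
  · refine ((i1i.const_mul ((-1) ^ m)).integrableOn (s := {y : Euc N | 0 < y 0})).congr (Eventually.of_forall fun y => ?_)
    simp only; ring

lemma rep_cut (hsol : IsBCSol N (k + 1) q u) (hq : 0 ≤ q) {x : Euc N} (hx : 0 < x 0) :
    ∃ C, ∀ R : ℝ, 0 < R → 2 * ‖x‖ ≤ R →
      Integrable (fun y => gk k x y * ({y : Euc N | 0 < y 0}.indicator (fun y => u y ^ q) y * chi N (R⁻¹ • y))) ∧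
      |kap N k * u x - ∫ y, gk k x y * ({y : Euc N | 0 < y 0}.indicator (fun y => u y ^ q) y * chi N (R⁻¹ • y))| ≤
        C * R⁻¹ ^ (k + 1) := by
  obtain ⟨C1, hC10, hC1⟩ := cutoff_diff_bound N k
  obtain ⟨M, hM0, hM⟩ := hsol.exists_bound
  refine ⟨M * (x 0 ^ (k + 1) * C1 * (2 ^ N * volume.real (Metric.ball (0 : Euc N) 1))), fun R hR hxR => ?_⟩
  obtain ⟨C2, hC20, hC2⟩ := hC1 x hx R hR hxR
  set g : Euc N → ℝ := fun y => {y : Euc N | 0 < y 0}.indicator (fun y => u y ^ q) y * chi N (R⁻¹ • y) with hg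
  have hchi : ContDiff ℝ ∞ fun y : Euc N => chi N (R⁻¹ • y) := contDiff_chi.comp (contDiff_const_smul _)
  have hchic : HasCompactSupport fun y : Euc N => chi N (R⁻¹ • y) :=
    HasCompactSupport.of_support_subset_isCompact (isCompact_closedBall (0 : Euc N) (2 * R))
      ((subset_tsupport _).trans (tsupport_chi_smul hR))
  have hgm : AEStronglyMeasurable g volume := (measurable_indicator_rpow hsol hq).mul hchi.continuous.aestronglyMeasurable
  have hgb : ∀ y, |g y| ≤ M ^ q := by
    intro y
    simp only [hg]
    rw [abs_mul, abs_of_nonneg (chi_nonneg _)]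
    refine (mul_le_of_le_one_right (abs_nonneg _) (chi_le_one _)).trans ?_
    by_cases hy : y ∈ {y : Euc N | 0 < y 0}
    · rw [indicator_of_mem hy]
      refine (Real.abs_rpow_le_abs_rpow _ _).trans ?_
      exact Real.rpow_le_rpow (abs_nonneg _) (hM y (half_subset hy)) hq
    · rw [indicator_of_notMem hy, abs_zero]; positivity
  have hgs : ∀ y, g y ≠ 0 → 0 < y 0 ∧ ‖x - y‖ < ‖x‖ + 2 * R := by
    intro y hy
    constructor
    · by_contra h
      exact hy (by simp only [hg]; rw [indicator_of_notMem (show y ∉ {y : Euc N | 0 < y 0} from h), zero_mul])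
    · by_contra h
      refine hy ?_
      simp only [hg]
      rw [chi_smul_of_ge hR, mul_zero]
      have := norm_sub_le x y
      linarith
  obtain ⟨g1, g2, g3⟩ := integral_gk_mul k hx hgm hgb hgs
  refine ⟨g1, ?_⟩
  set I1 : Euc N → ℝ := (Metric.closedBall (0 : Euc N) (2 * R)).indicator (fun _ => x 0 ^ (k + 1) * R⁻¹ ^ (N + (k + 1)) * C1) with hI1
  set δ : ℕ → ℝ := fun n => x 0 / 4 * (1 / ((n : ℝ) + 1)) with hδdef
  have hδ : ∀ n, 0 < δ n := fun n => by simp only [hδdef]; positivity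
  have hδ2 : ∀ n, 2 * δ n ≤ x 0 / 2 := by
    intro n
    have : 1 / ((n : ℝ) + 1) ≤ 1 := by
      rw [div_le_one (by positivity)]
      linarith [(Nat.cast_nonneg n : (0 : ℝ) ≤ n)]
    simp only [hδdef]
    nlinarith
  set I2 : ℕ → Euc N → ℝ := fun n => (Metric.closedBall (0 : Euc N) (2 * R) ∩ {y | y 0 < 2 * δ n}).indicator (fun _ => C2) with hI2
  have hInt : ∀ c : ℝ, Integrable ((Metric.closedBall (0 : Euc N) (2 * R)).indicator fun _ => c) := by
    intro c
    rw [integrable_indicator_iff Metric.isClosed_closedBall.measurableSet]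
    exact integrableOn_const (isCompact_closedBall _ _).measure_lt_top.ne
  have hmS : ∀ n, MeasurableSet (Metric.closedBall (0 : Euc N) (2 * R) ∩ {y | y 0 < 2 * δ n}) := fun n =>
    Metric.isClosed_closedBall.measurableSet.inter (isOpen_lt (by fun_prop) (by fun_prop)).measurableSet
  have hI2i : ∀ n, Integrable (I2 n) := by
    intro n
    rw [integrable_indicator_iff (hmS n)]
    exact integrableOn_const (measure_lt_top_of_subset inter_subset_left (isCompact_closedBall _ _).measure_lt_top.ne).ne
  have main : ∀ n, |kap N k * u x - ∫ y, gk k x y * g y| ≤ ∫ y in {y : Euc N | 0 < y 0}, M * (I1 y + I2 n y) := by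
    intro n
    have hz := contDiff_zcut 0 (δ n)
    set cut : Euc N → ℝ := fun y => zcut 0 (δ n) (y 0) * chi N (R⁻¹ • y) with hcut
    have hcutd : ContDiff ℝ ∞ cut := (hz.comp (contDiff_coord 0)).mul hchi
    have hcutc : HasCompactSupport cut := hchic.mul_left
    have hs : tsupport cut ⊆ {y | 0 < y 0} := by
      have hcl : IsClosed {y : Euc N | δ n ≤ y 0} := isClosed_le (by fun_prop) (by fun_prop)
      have : tsupport cut ⊆ {y : Euc N | δ n ≤ y 0} := by
        refine closure_minimal (fun y hy => ?_) hcl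
        by_contra h
        exact hy (by simp only [hcut]; rw [zcut_of_le (hδ n) (le_of_lt (not_le.1 h)), zero_mul])
      exact this.trans fun y hy => (hδ n).trans_le hy
    set φ : Euc N → ℝ := fun y => u y * cut y with hφ
    have hφd : ContDiff ℝ (2 * (k + 1) : ℕ) φ :=
      contDiff_mul_of_tsupport isOpen_half hsol.1 (hcutd.of_le (natCast_le_infty _)) hs
    have hφs : tsupport φ ⊆ {y | 0 < y 0} := (tsupport_mul_subset_right).trans hs
    have hφc : HasCompactSupport φ := hcutc.mul_left
    have hgr := green_rep k hx hφd hφc hφs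
    have hφx : φ x = u x := by
      simp only [hφ, hcut]
      rw [zcut_of_ge (hδ n) (by linarith [hδ2 n]), chi_smul_of_le hR (by linarith [norm_nonneg x]), pow_zero, mul_one, mul_one]
    rw [hφx] at hgr
    have hpc : Continuous (polyLap (k + 1) φ) := by
      unfold polyLap
      exact continuous_const.mul (ContDiff.lap_iter_contDiff (m := 0) (k + 1) (by rw [zero_add]; exact hφd)).continuous
    have hps : tsupport (polyLap (k + 1) φ) ⊆ tsupport φ :=
      (tsupport_mul_subset_right (f := fun _ : Euc N => (-1 : ℝ) ^ (k + 1)) (g := lap^[k + 1] φ)).trans (tsupport_lap_iter_subset _ _)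
    obtain ⟨M', R', hM', hR'⟩ := bound_of_continuous_compact hpc (hφc.mono_tsupport hps) x (hps.trans hφs)
    obtain ⟨p1, p2, p3⟩ := integral_gk_mul k hx hpc.aestronglyMeasurable hM' hR'
    rw [← hgr, p3, g3, ← integral_sub p2 g2]
    have hvol : volume.real (Ioc (0 : ℝ) 1) = 1 := by simp
    have hne : ∀ᵐ σ ∂(volume.restrict (Ioc (0 : ℝ) 1)), σ ≠ 1 := ae_restrict_of_ae (Measure.ae_ne volume 1)
    have := norm_setIntegral_le_of_norm_le_const_ae (μ := volume) (s := Ioc (0 : ℝ) 1)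
      (f := fun σ => (∫ y, kh k x σ y * polyLap (k + 1) φ y) - ∫ y, kh k x σ y * g y)
      (C := ∫ y in {y : Euc N | 0 < y 0}, M * (I1 y + I2 n y)) (by simp) ?_
    · rwa [hvol, mul_one, Real.norm_eq_abs] at this
    · have hmem : ∀ᵐ σ ∂(volume.restrict (Ioc (0 : ℝ) 1)), σ ∈ Ioc (0 : ℝ) 1 := ae_restrict_mem measurableSet_Ioc
      filter_upwards [hne, hmem] with σ h1 h2
      exact integral_kh_diff hsol hq hM hx h2.1 (lt_of_le_of_ne h2.2 h1) hR hz hs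
        (B := fun y => I1 y + I2 n y) ((hInt _).add (hI2i n)).integrableOn (fun y hy => hC2 (δ n) (hδ n) (hδ2 n) σ h2 y hy)
  have hlim : Tendsto (fun n => ∫ y in {y : Euc N | 0 < y 0}, M * (I1 y + I2 n y)) atTop
      (𝓝 (∫ y in {y : Euc N | 0 < y 0}, M * I1 y)) := by
    refine tendsto_integral_of_dominated_convergence
      (fun y => M * (I1 y + (Metric.closedBall (0 : Euc N) (2 * R)).indicator (fun _ => C2) y)) ?_ ?_ ?_ ?_
    · exact fun n => (((hInt _).add (hI2i n)).const_mul M).integrableOn.aestronglyMeasurable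
    · exact (((hInt _).add (hInt _)).const_mul M).integrableOn
    · refine fun n => Eventually.of_forall fun y => ?_
      have h1 : 0 ≤ I1 y := indicator_nonneg (fun _ _ => by positivity) _
      have h2 : 0 ≤ I2 n y := indicator_nonneg (fun _ _ => hC20) _
      rw [Real.norm_of_nonneg (by positivity)]
      gcongr
      exact indicator_le_indicator_of_subset inter_subset_left (fun _ => hC20) y
    · refine (ae_restrict_iff' measurableSet_half).2 (Eventually.of_forall fun y hy => ?_)
      have hy : 0 < y 0 := hy
      refine tendsto_const_nhds.congr' ?_
      have : Tendsto (fun n => 2 * δ n) atTop (𝓝 (2 * (x 0 / 4 * 0))) :=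
        (tendsto_one_div_add_atTop_nhds_zero_nat.const_mul _).const_mul _
      simp only [mul_zero] at this
      filter_upwards [this.eventually_lt_const hy] with n hn
      have : I2 n y = 0 := indicator_of_notMem (fun h => by
        have : y 0 < 2 * δ n := h.2
        linarith) _
      rw [this, add_zero]
  refine (ge_of_tendsto' hlim main).trans ?_
  calc ∫ y in {y : Euc N | 0 < y 0}, M * I1 y ≤ ∫ y, M * I1 y :=
        setIntegral_le_integral ((hInt _).const_mul M) (Eventually.of_forall fun y =>
          mul_nonneg hM0 (indicator_nonneg (fun _ _ => by positivity) _))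
    _ = M * (volume.real (Metric.closedBall (0 : Euc N) (2 * R)) * (x 0 ^ (k + 1) * R⁻¹ ^ (N + (k + 1)) * C1)) := by
        rw [integral_const_mul, hI1, integral_indicator Metric.isClosed_closedBall.measurableSet, setIntegral_const, smul_eq_mul]
    _ = _ := by
        rw [Measure.addHaar_real_closedBall volume 0 (by positivity), finrank_euclideanSpace_fin]
        have key : ∀ S A B : ℝ, R * S = 1 → (2 * R) ^ N * B * (A * S ^ (N + (k + 1)) * C1) = A * C1 * (2 ^ N * B) * S ^ (k + 1) := by
          intro S A B hS
          calc _ = A * C1 * (2 ^ N * B) * S ^ (k + 1) * (R * S) ^ N := by rw [mul_pow, mul_pow]; ring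
            _ = _ := by rw [hS, one_pow, mul_one]
        rw [key _ _ _ (mul_inv_cancel₀ hR.ne')]; ring

/-- The integral representation of solutions. -/
lemma integral_rep (hsol : IsBCSol N (k + 1) q u) (hq : 0 ≤ q) (hpos : ∀ x : Euc N, 0 ≤ x 0 → 0 ≤ u x)
    {x : Euc N} (hx : 0 < x 0) :
    IntegrableOn (fun y => gk k x y * u y ^ q) {y | 0 < y 0} ∧
      ∫ y in {y : Euc N | 0 < y 0}, gk k x y * u y ^ q = kap N k * u x := by
  obtain ⟨C, hC⟩ := rep_cut hsol hq hx
  set G : Euc N → ℝ := fun y => gk k x y * {y : Euc N | 0 < y 0}.indicator (fun y => u y ^ q) y with hG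
  have hGi : G = {y : Euc N | 0 < y 0}.indicator fun y => gk k x y * u y ^ q := by
    funext y
    simp only [hG, indicator]
    split_ifs <;> simp
  have hG0 : ∀ y, 0 ≤ G y := by
    intro y
    rw [hGi]
    refine indicator_nonneg (fun y hy => ?_) _
    have hy : 0 < y 0 := hy
    exact mul_nonneg (gk_nonneg hx.le hy.le) (Real.rpow_nonneg (hpos y hy.le) _)
  set R : ℕ → ℝ := fun n => n + 1 + 2 * ‖x‖ with hR
  have hR0 : ∀ n, 0 < R n := fun n => by simp only [hR]; positivity
  have hRx : ∀ n, 2 * ‖x‖ ≤ R n := fun n => by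
    simp only [hR]; linarith [(Nat.cast_nonneg n : (0 : ℝ) ≤ n)]
  have hRt : Tendsto R atTop atTop := by
    refine tendsto_atTop_add_const_right _ _ (tendsto_atTop_add_const_right _ _ tendsto_natCast_atTop_atTop)
  set Gn : ℕ → Euc N → ℝ := fun n y => gk k x y * ({y : Euc N | 0 < y 0}.indicator (fun y => u y ^ q) y * chi N ((R n)⁻¹ • y)) with hGn
  have hGn' : ∀ n y, Gn n y = G y * chi N ((R n)⁻¹ • y) := fun n y => by simp only [hGn, hG]; ring
  have h1 : ∀ n, Integrable (Gn n) := fun n => (hC (R n) (hR0 n) (hRx n)).1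
  have h2 : ∀ n, |kap N k * u x - ∫ y, Gn n y| ≤ C * (R n)⁻¹ ^ (k + 1) := fun n => (hC (R n) (hR0 n) (hRx n)).2
  have ht : Tendsto (fun n => ∫ y, Gn n y) atTop (𝓝 (kap N k * u x)) := by
    have h3 : Tendsto (fun n => C * (R n)⁻¹ ^ (k + 1)) atTop (𝓝 (C * 0 ^ (k + 1))) :=
      ((tendsto_inv_atTop_zero.comp hRt).pow _).const_mul _
    rw [zero_pow (by omega), mul_zero] at h3
    rw [tendsto_iff_dist_tendsto_zero]
    refine squeeze_zero (fun _ => dist_nonneg) (fun n => ?_) h3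
    rw [Real.dist_eq, abs_sub_comm]
    exact h2 n
  have hpt : ∀ y, Tendsto (fun n => Gn n y) atTop (𝓝 (G y)) := by
    intro y
    refine tendsto_const_nhds.congr' ?_
    filter_upwards [hRt.eventually_ge_atTop ‖y‖] with n hn
    rw [hGn', chi_smul_of_le (hR0 n) hn, mul_one]
  have hGint : Integrable G := by
    refine ⟨aestronglyMeasurable_of_tendsto_ae _ (fun n => (h1 n).aestronglyMeasurable) (Eventually.of_forall hpt), ?_⟩
    have e0 : ∀ y, ‖G y‖ₑ = liminf (fun n => ‖Gn n y‖ₑ) atTop := fun y => ((hpt y).enorm.liminf_eq).symm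
    rw [HasFiniteIntegral, lintegral_congr e0]
    refine (lintegral_liminf_le' (fun n => (h1 n).aestronglyMeasurable.enorm)).trans_lt ?_
    have e : ∀ n, ∫⁻ y, ‖Gn n y‖ₑ = ENNReal.ofReal (∫ y, Gn n y) := by
      intro n
      have h0 : ∀ y, 0 ≤ Gn n y := fun y => by rw [hGn']; exact mul_nonneg (hG0 y) (chi_nonneg _)
      rw [ofReal_integral_eq_lintegral_ofReal (h1 n) (Eventually.of_forall h0)]
      exact lintegral_congr fun y => Real.enorm_of_nonneg (h0 y)
    simp_rw [e]
    have hl := ((ENNReal.continuous_ofReal.tendsto _).comp ht).liminf_eq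
    simp only [Function.comp_def] at hl
    rw [hl]
    exact ENNReal.ofReal_lt_top
  have ht2 : Tendsto (fun n => ∫ y, Gn n y) atTop (𝓝 (∫ y, G y)) := by
    refine tendsto_integral_of_dominated_convergence G (fun n => (h1 n).aestronglyMeasurable) hGint
      (fun n => Eventually.of_forall fun y => ?_) (Eventually.of_forall hpt)
    rw [hGn', norm_mul, Real.norm_of_nonneg (hG0 y), Real.norm_of_nonneg (chi_nonneg _)]
    exact mul_le_of_le_one_right (hG0 y) (chi_le_one _)
  have hfin := tendsto_nhds_unique ht2 ht
  rw [hGi] at hGint hfin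
  rw [integral_indicator measurableSet_half] at hfin
  exact ⟨(integrable_indicator_iff measurableSet_half).1 hGint, hfin⟩

end RepCut

section KernelProfile

/-- The Green function as a function of the squared distance and the product of the heights. -/
noncomputable def Fk (k : ℕ) (p ρ t : ℝ) : ℝ :=
  ∫ σ in Ioc (0 : ℝ) 1, t ^ (k + 1) * σ ^ k * (ρ + t * σ) ^ (-p)

variable {k : ℕ} {p ρ t : ℝ}

lemma gk_eq_Fk {N : ℕ} [NeZero N] (k : ℕ) (x y : Euc N) :
    gk k x y = Fk k ((N : ℝ) / 2) (‖x - y‖ ^ 2) (4 * x 0 * y 0) := rfl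

lemma Fk_base_pos (hρ : 0 < ρ) (ht : 0 ≤ t) {σ : ℝ} (hσ : 0 ≤ σ) : 0 < ρ + t * σ := by positivity

lemma continuousOn_Fk_integrand (hρ : 0 < ρ) (ht : 0 ≤ t) (p : ℝ) :
    ContinuousOn (fun σ : ℝ => t ^ (k + 1) * σ ^ k * (ρ + t * σ) ^ (-p)) (Icc 0 1) := by
  refine ContinuousOn.mul (by fun_prop) (ContinuousOn.rpow_const (by fun_prop) fun σ hσ => ?_)
  exact Or.inl (Fk_base_pos hρ ht hσ.1).ne'

lemma integrableOn_Fk_integrand (hρ : 0 < ρ) (ht : 0 ≤ t) (p : ℝ) :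
    IntegrableOn (fun σ : ℝ => t ^ (k + 1) * σ ^ k * (ρ + t * σ) ^ (-p)) (Ioc 0 1) :=
  (continuousOn_Fk_integrand hρ ht p).integrableOn_Icc.mono_set Ioc_subset_Icc_self

lemma Fk_scale {a : ℝ} (ha : 0 < a) (hρ : 0 ≤ ρ) (ht : 0 < t) :
    Fk k p (a * ρ) (a * t) = a ^ ((k : ℝ) + 1 - p) * Fk k p ρ t := by
  unfold Fk
  rw [← integral_const_mul]
  refine setIntegral_congr_fun measurableSet_Ioc fun σ hσ => ?_
  rw [show a * ρ + a * t * σ = a * (ρ + t * σ) by ring,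
    Real.mul_rpow ha.le (by have := hσ.1.le; positivity),
    show (k : ℝ) + 1 - p = ((k + 1 : ℕ) : ℝ) + -p by push_cast; ring, Real.rpow_add ha,
    Real.rpow_natCast, mul_pow]
  ring

lemma Fk_nonneg (hρ : 0 ≤ ρ) (ht : 0 ≤ t) : 0 ≤ Fk k p ρ t := by
  refine setIntegral_nonneg measurableSet_Ioc fun σ hσ => ?_
  have := hσ.1.le
  positivity

lemma Fk_strictAnti {ρ' : ℝ} (hρ : 0 < ρ) (h : ρ < ρ') (ht : 0 < t) (hp : 0 < p) :
    Fk k p ρ' t < Fk k p ρ t := by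
  unfold Fk
  rw [← intervalIntegral.integral_of_le zero_le_one, ← intervalIntegral.integral_of_le zero_le_one]
  have key : ∀ σ : ℝ, 0 < σ → t ^ (k + 1) * σ ^ k * (ρ' + t * σ) ^ (-p) <
      t ^ (k + 1) * σ ^ k * (ρ + t * σ) ^ (-p) := fun σ hσ => by
    have : (ρ' + t * σ) ^ (-p) < (ρ + t * σ) ^ (-p) :=
      Real.rpow_lt_rpow_of_neg (by positivity) (by linarith) (by linarith)
    gcongr
  refine intervalIntegral.integral_lt_integral_of_continuousOn_of_le_of_exists_lt zero_lt_one
    (continuousOn_Fk_integrand (hρ.trans h) ht.le p) (continuousOn_Fk_integrand hρ ht.le p)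
    (fun σ hσ => (key σ hσ.1).le) ⟨1, by simp, key 1 one_pos⟩

lemma Fk_lower (hρ : 0 < ρ) (ht : 0 < t) (hp : 0 < p) :
    t ^ (k + 1) * (ρ + t) ^ (-p) / (k + 1) ≤ Fk k p ρ t := by
  unfold Fk
  rw [← intervalIntegral.integral_of_le zero_le_one]
  have e : t ^ (k + 1) * (ρ + t) ^ (-p) / (k + 1) = ∫ σ in (0 : ℝ)..1, t ^ (k + 1) * (ρ + t) ^ (-p) * σ ^ k := by
    rw [intervalIntegral.integral_const_mul, integral_pow]
    simp; ring
  rw [e]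
  refine intervalIntegral.integral_mono_on zero_le_one (by apply Continuous.intervalIntegrable; fun_prop) ?_ ?_
  · exact (continuousOn_Fk_integrand hρ ht.le p).intervalIntegrable_of_Icc zero_le_one
  · intro σ hσ
    have : (ρ + t) ^ (-p) ≤ (ρ + t * σ) ^ (-p) :=
      Real.rpow_le_rpow_of_nonpos (Fk_base_pos hρ ht.le hσ.1) (by nlinarith [hσ.2]) (by linarith)
    have := hσ.1
    calc t ^ (k + 1) * (ρ + t) ^ (-p) * σ ^ k = t ^ (k + 1) * σ ^ k * (ρ + t) ^ (-p) := by ring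
      _ ≤ _ := by gcongr

end KernelProfile

section Inversion
variable {N : ℕ} [NeZero N]

/-- Inversion in the sphere of radius `r` centred at the origin. -/
noncomputable def sinv (r : ℝ) (x : Euc N) : Euc N := (r / ‖x‖) ^ 2 • x

lemma sinv_eq (r : ℝ) (x : Euc N) : sinv r x = EuclideanGeometry.inversion 0 r x := by
  simp [sinv, EuclideanGeometry.inversion]

lemma sinv_apply_zero (r : ℝ) (x : Euc N) : sinv r x 0 = (r / ‖x‖) ^ 2 * x 0 := rfl

lemma norm_sinv {r : ℝ} (x : Euc N) (hx : x ≠ 0) : ‖sinv r x‖ = r ^ 2 / ‖x‖ := by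
  have := norm_pos_iff.2 hx
  rw [sinv, norm_smul, Real.norm_eq_abs, abs_of_nonneg (by positivity)]
  field_simp

lemma sinv_sinv {r : ℝ} (hr : r ≠ 0) (x : Euc N) : sinv r (sinv r x) = x := by
  rw [sinv_eq, sinv_eq, EuclideanGeometry.inversion_inversion _ hr]

lemma ne_zero_of_half {x : Euc N} (hx : 0 < x 0) : x ≠ 0 := by
  rintro rfl; simp at hx

lemma sinv_half {r : ℝ} (hr : 0 < r) {x : Euc N} (hx : 0 < x 0) : 0 < sinv r x 0 := by
  have := norm_pos_iff.2 (ne_zero_of_half hx)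
  rw [sinv_apply_zero]; positivity

lemma normSq_sub_sinv {r : ℝ} (hr : 0 < r) (x : Euc N) {z : Euc N} (hz : z ≠ 0) :
    ‖x - sinv r z‖ ^ 2 = (r / ‖z‖) ^ 2 *
      (‖x - z‖ ^ 2 + (r ^ 2 - ‖x‖ ^ 2) * (r ^ 2 - ‖z‖ ^ 2) / r ^ 2) := by
  have := norm_pos_iff.2 hz
  rw [norm_sub_sq_real, norm_sub_sq_real, norm_sinv z hz, sinv, inner_smul_right]
  field_simp
  ring

lemma normSq_sinv_sub_sinv {r : ℝ} (hr : 0 < r) {x z : Euc N} (hx : x ≠ 0) (hz : z ≠ 0) :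
    ‖sinv r x - sinv r z‖ ^ 2 = (r / ‖x‖) ^ 2 * (r / ‖z‖) ^ 2 * ‖x - z‖ ^ 2 := by
  have := norm_pos_iff.2 hz
  have := norm_pos_iff.2 hx
  rw [norm_sub_sq_real, norm_sub_sq_real, norm_sinv z hz, norm_sinv x hx, sinv, sinv, inner_smul_right,
    inner_smul_left]
  simp
  field_simp
  ring

lemma gk_sinv_right (k : ℕ) {r : ℝ} (hr : 0 < r) {x z : Euc N} (hx : 0 < x 0) (hz : 0 < z 0)
    (hxr : ‖x‖ ≤ r) (hzr : ‖z‖ ≤ r) :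
    gk k x (sinv r z) = (r / ‖z‖) ^ (2 * ((k : ℝ) + 1) - N) * Fk k ((N : ℝ) / 2)
      (‖x - z‖ ^ 2 + (r ^ 2 - ‖x‖ ^ 2) * (r ^ 2 - ‖z‖ ^ 2) / r ^ 2) (4 * x 0 * z 0) := by
  have hz0 := ne_zero_of_half hz
  have hzp := norm_pos_iff.2 hz0
  rw [gk_eq_Fk, normSq_sub_sinv hr x hz0, sinv_apply_zero,
    show 4 * x 0 * ((r / ‖z‖) ^ 2 * z 0) = (r / ‖z‖) ^ 2 * (4 * x 0 * z 0) by ring,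
    Fk_scale (by positivity) ?_ (by positivity), ← Real.rpow_natCast, ← Real.rpow_mul (by positivity)]
  · congr 2; push_cast; ring
  · have h1 : 0 ≤ r ^ 2 - ‖x‖ ^ 2 := by nlinarith [norm_nonneg x]
    have h2 : 0 ≤ r ^ 2 - ‖z‖ ^ 2 := by nlinarith [norm_nonneg z]
    positivity

lemma gk_comm (k : ℕ) (x y : Euc N) : gk k x y = gk k y x := by
  rw [gk_eq_Fk, gk_eq_Fk, norm_sub_rev]; congr 1; ring

lemma gk_sinv_left (k : ℕ) {r : ℝ} (hr : 0 < r) {x z : Euc N} (hx : 0 < x 0) (hz : 0 < z 0)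
    (hxr : ‖x‖ ≤ r) (hzr : ‖z‖ ≤ r) :
    gk k (sinv r x) z = (r / ‖x‖) ^ (2 * ((k : ℝ) + 1) - N) * Fk k ((N : ℝ) / 2)
      (‖x - z‖ ^ 2 + (r ^ 2 - ‖x‖ ^ 2) * (r ^ 2 - ‖z‖ ^ 2) / r ^ 2) (4 * x 0 * z 0) := by
  rw [gk_comm, gk_sinv_right k hr hz hx hzr hxr, norm_sub_rev]
  congr 2 <;> ring

lemma gk_sinv_sinv (k : ℕ) {r : ℝ} (hr : 0 < r) {x z : Euc N} (hx : 0 < x 0) (hz : 0 < z 0) :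
    gk k (sinv r x) (sinv r z) = (r / ‖x‖) ^ (2 * ((k : ℝ) + 1) - N) *
      (r / ‖z‖) ^ (2 * ((k : ℝ) + 1) - N) * gk k x z := by
  have hz0 := ne_zero_of_half hz
  have hzp := norm_pos_iff.2 hz0
  have hx0 := ne_zero_of_half hx
  have hxp := norm_pos_iff.2 hx0
  rw [gk_eq_Fk, gk_eq_Fk, normSq_sinv_sub_sinv hr hx0 hz0, sinv_apply_zero, sinv_apply_zero,
    show 4 * ((r / ‖x‖) ^ 2 * x 0) * ((r / ‖z‖) ^ 2 * z 0) =
      (r / ‖x‖) ^ 2 * (r / ‖z‖) ^ 2 * (4 * x 0 * z 0) by ring,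
    Fk_scale (by positivity) (by positivity) (by positivity), Real.mul_rpow (by positivity) (by positivity),
    ← Real.rpow_natCast, ← Real.rpow_mul (by positivity), ← Real.rpow_natCast, ← Real.rpow_mul (by positivity)]
  congr 3 <;> (push_cast; ring)

/-- The open half ball. -/
def hball (N : ℕ) [NeZero N] (r : ℝ) : Set (Euc N) := {z | 0 < z 0 ∧ ‖z‖ < r}

lemma isOpen_hball (r : ℝ) : IsOpen (hball N r) :=
  isOpen_half.inter (isOpen_lt continuous_norm continuous_const)

lemma hball_subset_half (r : ℝ) : hball N r ⊆ {z : Euc N | 0 < z 0} := fun _ hz => hz.1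

lemma sinv_image_hball {r : ℝ} (hr : 0 < r) :
    sinv r '' hball N r = {z : Euc N | 0 < z 0 ∧ r < ‖z‖} := by
  ext z
  constructor
  · rintro ⟨y, hy, rfl⟩
    refine ⟨sinv_half hr hy.1, ?_⟩
    have := norm_pos_iff.2 (ne_zero_of_half hy.1)
    rw [norm_sinv _ (ne_zero_of_half hy.1), lt_div_iff₀ this]
    nlinarith [hy.2]
  · rintro ⟨h0, h1⟩
    refine ⟨sinv r z, ⟨sinv_half hr h0, ?_⟩, sinv_sinv hr.ne' z⟩
    have := norm_pos_iff.2 (ne_zero_of_half h0)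
    rw [norm_sinv _ (ne_zero_of_half h0), div_lt_iff₀ this]
    nlinarith

lemma abs_det_reflection_smul (c : ℝ) (v : Euc N) :
    |(c • (((ℝ ∙ v)ᗮ.reflection : Euc N ≃ₗᵢ[ℝ] Euc N) : Euc N →L[ℝ] Euc N)).det| = |c| ^ N := by
  rw [ContinuousLinearMap.det]
  change |LinearMap.det (c • (ℝ ∙ v)ᗮ.reflection.toLinearMap)| = _
  rw [LinearMap.det_smul, Submodule.det_reflection]
  simp

lemma hasFDerivAt_sinv (r : ℝ) {x : Euc N} (hx : x ≠ 0) :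
    HasFDerivAt (sinv r) ((r / ‖x‖) ^ 2 • (((ℝ ∙ x)ᗮ.reflection : Euc N ≃ₗᵢ[ℝ] Euc N) : Euc N →L[ℝ] Euc N)) x := by
  have h := EuclideanGeometry.hasFDerivAt_inversion (c := (0 : Euc N)) (R := r) hx
  rw [dist_zero_right, sub_zero] at h
  have e : sinv r = EuclideanGeometry.inversion (0 : Euc N) r := funext (sinv_eq r)
  rw [e]; exact h

lemma integral_half_sinv {r : ℝ} (hr : 0 < r) {g : Euc N → ℝ} (hg : IntegrableOn g {z | 0 < z 0}) :
    IntegrableOn (fun z => (r / ‖z‖) ^ (2 * N) * g (sinv r z)) (hball N r) ∧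
    ∫ z in {z : Euc N | 0 < z 0}, g z = (∫ z in hball N r, g z) +
      ∫ z in hball N r, (r / ‖z‖) ^ (2 * N) * g (sinv r z) := by
  have hd : ∀ z ∈ hball N r, HasFDerivWithinAt (sinv r) ((r / ‖z‖) ^ 2 •
      (((ℝ ∙ z)ᗮ.reflection : Euc N ≃ₗᵢ[ℝ] Euc N) : Euc N →L[ℝ] Euc N)) (hball N r) z := fun z hz =>
    (hasFDerivAt_sinv r (ne_zero_of_half hz.1)).hasFDerivWithinAt
  have hinj : InjOn (sinv r) (hball N r) := fun a _ b _ h => by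
    rw [← sinv_sinv hr.ne' a, h, sinv_sinv hr.ne']
  have hm := (isOpen_hball (N := N) r).measurableSet
  have ej : ∀ z : Euc N, |((r / ‖z‖) ^ 2 • (((ℝ ∙ z)ᗮ.reflection : Euc N ≃ₗᵢ[ℝ] Euc N) : Euc N →L[ℝ] Euc N)).det|
      • g (sinv r z) = (r / ‖z‖) ^ (2 * N) * g (sinv r z) := fun z => by
    rw [abs_det_reflection_smul, abs_of_nonneg (by positivity), smul_eq_mul, pow_mul]
  have e1 := integral_image_eq_integral_abs_det_fderiv_smul volume hm hd hinj g
  have e2 := integrableOn_image_iff_integrableOn_abs_det_fderiv_smul volume hm hd hinj g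
  simp_rw [ej] at e1 e2
  rw [sinv_image_hball hr] at e1 e2
  have hsub : {z : Euc N | 0 < z 0 ∧ r < ‖z‖} ⊆ {z : Euc N | 0 < z 0} := fun _ hz => hz.1
  refine ⟨e2.1 (hg.mono_set hsub), ?_⟩
  rw [← e1, ← setIntegral_union ?_ ?_ (hg.mono_set (hball_subset_half r)) (hg.mono_set hsub)]
  · refine setIntegral_congr_set ?_
    have hs : ∀ᵐ z : Euc N ∂volume, z ∉ Metric.sphere (0 : Euc N) r :=
      measure_eq_zero_iff_ae_notMem.1 (Measure.addHaar_sphere_of_ne_zero _ _ hr.ne')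
    filter_upwards [hs] with z hz
    have hz' : ‖z‖ ≠ r := by simpa using hz
    refine propext ⟨fun h => ?_, ?_⟩
    · rcases lt_or_gt_of_ne hz' with h1 | h1
      · exact Or.inl ⟨h, h1⟩
      · exact Or.inr ⟨h, h1⟩
    · rintro (h | h) <;> exact h.1
  · rw [Set.disjoint_left]
    intro z h1 h2
    exact absurd h1.2 (not_lt.2 h2.2.le)
  · exact (isOpen_half.inter (isOpen_lt continuous_const continuous_norm)).measurableSet

end Inversion

section MovingSpheres
variable {N : ℕ} [NeZero N]

/-- Positive bounded solutions of the integral equation `κ u = G (u ^ q)` on the half-space. -/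
structure IntSol (k : ℕ) (q κ M : ℝ) (u : Euc N → ℝ) : Prop where
  kpos : 0 < κ
  cont : ContinuousOn u {x | 0 < x 0}
  pos : ∀ x : Euc N, 0 < x 0 → 0 < u x
  le : ∀ x : Euc N, 0 < x 0 → u x ≤ M
  integrable : ∀ x : Euc N, 0 < x 0 → IntegrableOn (fun y => gk k x y * u y ^ q) {y | 0 < y 0}
  eq : ∀ x : Euc N, 0 < x 0 → ∫ y in {y : Euc N | 0 < y 0}, gk k x y * u y ^ q = κ * u x

/-- The Kelvin transform with respect to the sphere of radius `r` centred at the origin. -/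
noncomputable def kelv (k : ℕ) (r : ℝ) (u : Euc N → ℝ) (x : Euc N) : ℝ :=
  (r / ‖x‖) ^ ((N : ℝ) - 2 * ((k : ℝ) + 1)) * u (sinv r x)

/-- The defect of conformal invariance of the nonlinearity. -/
noncomputable def tauExp (N k : ℕ) (q : ℝ) : ℝ :=
  (N : ℝ) + 2 * ((k : ℝ) + 1) - q * ((N : ℝ) - 2 * ((k : ℝ) + 1))

/-- The kernel of the integral equation for the difference of `u` and its Kelvin transform. -/
noncomputable def dk (k : ℕ) (r : ℝ) (x z : Euc N) : ℝ :=
  gk k x z - Fk k ((N : ℝ) / 2)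
    (‖x - z‖ ^ 2 + (r ^ 2 - ‖x‖ ^ 2) * (r ^ 2 - ‖z‖ ^ 2) / r ^ 2) (4 * x 0 * z 0)

variable {k : ℕ} {q κ M r : ℝ} {u : Euc N → ℝ}

lemma kelv_pos (h : IntSol k q κ M u) (hr : 0 < r) {x : Euc N} (hx : 0 < x 0) :
    0 < kelv k r u x := by
  have := norm_pos_iff.2 (ne_zero_of_half hx)
  exact mul_pos (by positivity) (h.pos _ (sinv_half hr hx))

lemma kelv_weight (h : IntSol k q κ M u) (hr : 0 < r) {z : Euc N} (hz : 0 < z 0) :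
    (r / ‖z‖) ^ (2 * N) * ((r / ‖z‖) ^ (2 * ((k : ℝ) + 1) - N) * u (sinv r z) ^ q) =
      (r / ‖z‖) ^ tauExp N k q * kelv k r u z ^ q := by
  have hzp := norm_pos_iff.2 (ne_zero_of_half hz)
  have hb : 0 < r / ‖z‖ := by positivity
  have hu := (h.pos _ (sinv_half hr hz)).le
  unfold kelv
  rw [Real.mul_rpow (by positivity) hu, ← Real.rpow_mul hb.le, ← mul_assoc, ← mul_assoc,
    ← Real.rpow_natCast, ← Real.rpow_add hb, ← Real.rpow_add hb]
  congr 2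
  unfold tauExp
  push_cast; ring

lemma moving_identity (h : IntSol k q κ M u) (hr : 0 < r) {x : Euc N} (hx : 0 < x 0) (hxr : ‖x‖ < r) :
    IntegrableOn (fun z => dk k r x z * (u z ^ q - (r / ‖z‖) ^ tauExp N k q * kelv k r u z ^ q)) (hball N r) ∧
    ∫ z in hball N r, dk k r x z * (u z ^ q - (r / ‖z‖) ^ tauExp N k q * kelv k r u z ^ q) =
      κ * (u x - kelv k r u x) := by
  have hxp := norm_pos_iff.2 (ne_zero_of_half hx)
  have ha : 0 < r / ‖x‖ := by positivity
  obtain ⟨i1, e1⟩ := integral_half_sinv hr (h.integrable x hx)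
  obtain ⟨i2, e2⟩ := integral_half_sinv hr (h.integrable _ (sinv_half hr hx))
  rw [h.eq x hx] at e1
  rw [h.eq _ (sinv_half hr hx)] at e2
  have j1 := (h.integrable x hx).mono_set (hball_subset_half r)
  have j2 := (h.integrable _ (sinv_half hr hx)).mono_set (hball_subset_half r)
  set a := (r / ‖x‖) ^ ((N : ℝ) - 2 * ((k : ℝ) + 1)) with hadef
  have hainv : a * (r / ‖x‖) ^ (2 * ((k : ℝ) + 1) - N) = 1 := by
    rw [hadef, ← Real.rpow_add ha]; simp
  have hE : EqOn (fun z => dk k r x z * (u z ^ q - (r / ‖z‖) ^ tauExp N k q * kelv k r u z ^ q))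
      (fun z => (gk k x z * u z ^ q + (r / ‖z‖) ^ (2 * N) * (gk k x (sinv r z) * u (sinv r z) ^ q)) -
        a * (gk k (sinv r x) z * u z ^ q +
          (r / ‖z‖) ^ (2 * N) * (gk k (sinv r x) (sinv r z) * u (sinv r z) ^ q))) (hball N r) := by
    intro z hz
    simp only
    rw [gk_sinv_left k hr hx hz.1 hxr.le hz.2.le, gk_sinv_right k hr hx hz.1 hxr.le hz.2.le,
      gk_sinv_sinv k hr hx hz.1, ← kelv_weight h hr hz.1]
    unfold dk
    set F' := Fk k ((N : ℝ) / 2)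
      (‖x - z‖ ^ 2 + (r ^ 2 - ‖x‖ ^ 2) * (r ^ 2 - ‖z‖ ^ 2) / r ^ 2) (4 * x 0 * z 0)
    set B := (r / ‖z‖) ^ (2 * ((k : ℝ) + 1) - N)
    set A := (r / ‖x‖) ^ (2 * ((k : ℝ) + 1) - N)
    linear_combination (F' * u z ^ q + (r / ‖z‖) ^ (2 * N) * B * gk k x z * u (sinv r z) ^ q) * hainv
  have hm := (isOpen_hball (N := N) r).measurableSet
  have iA := j1.add i1
  have iB := (j2.add i2).const_mul a
  refine ⟨(iA.sub iB).congr_fun hE.symm hm, ?_⟩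
  rw [setIntegral_congr_fun hm hE, integral_sub, integral_add j1 i1, integral_const_mul,
    integral_add j2 i2, ← e1, ← e2]
  · simp only [kelv]; rw [← hadef]; ring
  · exact iA
  · exact iB

lemma dk_pos (hr : 0 < r) {x z : Euc N} (hx : 0 < x 0) (hxr : ‖x‖ < r) (hz : z ∈ hball N r) (hxz : x ≠ z) :
    0 < dk k r x z := by
  have hN : (0 : ℝ) < N := by exact_mod_cast Nat.pos_of_ne_zero (NeZero.ne N)
  have h1 : 0 < r ^ 2 - ‖x‖ ^ 2 := by nlinarith [norm_nonneg x]
  have h2 : 0 < r ^ 2 - ‖z‖ ^ 2 := by nlinarith [norm_nonneg z, hz.2]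
  have h3 := norm_pos_iff.2 (sub_ne_zero.2 hxz)
  have h4 := hz.1
  unfold dk
  rw [gk_eq_Fk, sub_pos]
  refine Fk_strictAnti (by positivity) ?_ (by positivity) (by positivity)
  have : 0 < (r ^ 2 - ‖x‖ ^ 2) * (r ^ 2 - ‖z‖ ^ 2) / r ^ 2 := by positivity
  linarith

lemma dk_le_gk (hr : 0 < r) {x z : Euc N} (hx : 0 < x 0) (hxr : ‖x‖ < r) (hz : z ∈ hball N r) :
    dk k r x z ≤ gk k x z := by
  have h1 : 0 < r ^ 2 - ‖x‖ ^ 2 := by nlinarith [norm_nonneg x]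
  have h2 : 0 < r ^ 2 - ‖z‖ ^ 2 := by nlinarith [norm_nonneg z, hz.2]
  have h4 := hz.1
  unfold dk
  have := Fk_nonneg (k := k) (p := (N : ℝ) / 2)
    (show 0 ≤ ‖x - z‖ ^ 2 + (r ^ 2 - ‖x‖ ^ 2) * (r ^ 2 - ‖z‖ ^ 2) / r ^ 2 by positivity)
    (show 0 ≤ 4 * x 0 * z 0 by positivity)
  linarith

lemma small_sing (Λ : ℝ) {η : ℝ} (hη : 0 < η) : ∃ ε : ENNReal, 0 < ε ∧ ∀ D : Set (Euc N), MeasurableSet D →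
    D ⊆ Metric.ball 0 Λ → volume D < ε → ∀ x : Euc N, ‖x‖ < Λ →
      IntegrableOn (sing x) D ∧ ∫ z in D, sing x z ≤ η := by
  have hInt : Integrable ((Metric.ball (0 : Euc N) (2 * Λ)).indicator fun z => ‖z‖ ^ (-((N : ℝ) - 1 / 2))) :=
    (integrableOn_norm_rpow (2 * Λ) (by linarith)).integrable_indicator measurableSet_ball
  set f := (Metric.ball (0 : Euc N) (2 * Λ)).indicator fun z => ‖z‖ ^ (-((N : ℝ) - 1 / 2)) with hf
  have hf0 : ∀ z, 0 ≤ f z := fun z => indicator_nonneg (fun _ _ => by positivity) z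
  obtain ⟨ε, hε, H⟩ := exists_pos_setLIntegral_lt_of_measure_lt (μ := volume) (f := fun z => ENNReal.ofReal (f z))
    ((hasFiniteIntegral_iff_ofReal (Eventually.of_forall hf0)).1 hInt.2).ne
    (ε := ENNReal.ofReal η) (by simpa using hη)
  refine ⟨ε, hε, fun D hD hDs hv x hx => ?_⟩
  have e : EqOn (sing x) (fun z => f (x - z)) D := fun z hz => by
    have hz' : ‖z‖ < Λ := by simpa using hDs hz
    have : x - z ∈ Metric.ball (0 : Euc N) (2 * Λ) := by
      rw [mem_ball_zero_iff]; linarith [norm_sub_le x z]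
    simp only [hf, indicator_of_mem this, sing]
  have hi : Integrable (fun z => f (x - z)) := hInt.comp_sub_left x
  refine ⟨(hi.integrableOn).congr_fun e.symm hD, ?_⟩
  rw [setIntegral_congr_fun hD e, integral_eq_lintegral_of_nonneg_ae
    (Eventually.of_forall fun z => hf0 _) hi.integrableOn.aestronglyMeasurable]
  refine ENNReal.toReal_le_of_le_ofReal hη.le ?_
  set D' := (fun z => x - z) ⁻¹' D with hD'
  have mp : MeasurePreserving (fun z : Euc N => x - z) volume volume := Measure.measurePreserving_sub_left volume x
  have hv' : volume D' < ε := by rwa [hD', mp.measure_preimage hD.nullMeasurableSet]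
  have := H D' hv'
  refine le_trans (le_of_eq ?_) this.le
  have emb : MeasurableEmbedding (fun z : Euc N => x - z) := (Homeomorph.subLeft x).measurableEmbedding
  have h2 := mp.setLIntegral_comp_preimage_emb emb (fun z => ENNReal.ofReal (f (x - z))) D
  rw [← h2]
  simp only [sub_sub_cancel, hD']

end MovingSpheres

lemma rpow_sub_rpow_le {a b q : ℝ} (hb : 0 ≤ b) (hab : b ≤ a) (ha : 0 < a) (hq : 1 ≤ q) :
    a ^ q - b ^ q ≤ q * a ^ (q - 1) * (a - b) := by
  have h := one_add_mul_self_le_rpow_one_add (s := b / a - 1) (by have : 0 ≤ b / a := by positivity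
                                                                  linarith) hq
  have e : (1 + (b / a - 1)) ^ q = b ^ q / a ^ q := by
    rw [show 1 + (b / a - 1) = b / a by ring, Real.div_rpow hb ha.le]
  have e2 : a ^ q = a ^ (q - 1) * a := by
    rw [← Real.rpow_add_one ha.ne']; congr 1; ring
  have hp : 0 < a ^ q := by positivity
  rw [e, le_div_iff₀ hp] at h
  have : (1 + q * (b / a - 1)) * a ^ q = a ^ q - q * a ^ (q - 1) * (a - b) := by
    rw [e2]; field_simp; ring
  linarith

section MovingSpheres
variable {N : ℕ} [NeZero N] {k : ℕ} {q κ M r : ℝ} {u : Euc N → ℝ}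

/-- `u` lies below its Kelvin transform in the half ball of radius `r`. -/
def BelowKelv (k : ℕ) (u : Euc N → ℝ) (r : ℝ) : Prop :=
  ∀ x : Euc N, 0 < x 0 → ‖x‖ < r → u x ≤ kelv k r u x

/-- The part of the half ball of radius `r` where `u` exceeds its Kelvin transform. -/
def aboveKelv (k : ℕ) (u : Euc N → ℝ) (r : ℝ) : Set (Euc N) := {x | x ∈ hball N r ∧ kelv k r u x < u x}

lemma continuousOn_kelv (h : IntSol k q κ M u) :
    ContinuousOn (fun z : ℝ × Euc N => kelv k z.1 u z.2) {z | 0 < z.1 ∧ 0 < z.2 0} := by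
  have hn : ContinuousOn (fun z : ℝ × Euc N => z.1 / ‖z.2‖) {z | 0 < z.1 ∧ 0 < z.2 0} :=
    ContinuousOn.div (by fun_prop) (by fun_prop) fun z hz => (norm_pos_iff.2 (ne_zero_of_half hz.2)).ne'
  refine ContinuousOn.mul (hn.rpow_const fun z hz => Or.inl ?_) (h.cont.comp ?_ ?_)
  · have := norm_pos_iff.2 (ne_zero_of_half hz.2)
    have := hz.1
    positivity
  · exact (hn.pow 2).smul (by fun_prop)
  · exact fun z hz => sinv_half hz.1 hz.2

lemma continuousOn_kelv_right (h : IntSol k q κ M u) (hr : 0 < r) :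
    ContinuousOn (kelv k r u) {x | 0 < x 0} :=
  (continuousOn_kelv h).comp (f := fun x : Euc N => (r, x)) (by fun_prop) fun _ hx => ⟨hr, hx⟩

lemma isOpen_aboveKelv (h : IntSol k q κ M u) (hr : 0 < r) : IsOpen (aboveKelv k u r) := by
  have h1 := (continuousOn_kelv_right h hr).mono (hball_subset_half r)
  have h2 := h.cont.mono (hball_subset_half r)
  have := (h2.sub h1).isOpen_inter_preimage (isOpen_hball r) (isOpen_Ioi (a := (0 : ℝ)))
  convert this using 1
  ext x
  simp [aboveKelv]

lemma IntSol.M_pos (h : IntSol k q κ M u) : 0 < M := by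
  have : 0 < (bv (0 : Fin N)) 0 := by simp [bv]
  exact (h.pos _ this).trans_le (h.le _ this)

lemma coord_le_norm (x : Euc N) : x 0 ≤ ‖x‖ := (le_abs_self _).trans (PiLp.norm_apply_le x 0)

lemma belowKelv_of_small (h : IntSol k q κ M u) (hq : 1 < q) (hτ : 0 ≤ tauExp N k q) {Λ : ℝ} (hΛ : 0 < Λ) :
    ∃ ε : ENNReal, 0 < ε ∧ ∀ r : ℝ, 0 < r → r ≤ Λ → volume (aboveKelv k u r) < ε → BelowKelv k u r := by
  have hM := h.M_pos
  have hκ := h.kpos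
  have hq0 : 0 < q := by linarith
  set C := 4 / 3 * (4 * Λ * Λ) ^ ((k : ℝ) + 3 / 4) * (q * M ^ (q - 1)) with hC
  have hCp : 0 < C := by positivity
  obtain ⟨ε, hε, H⟩ := small_sing (N := N) Λ (η := κ / (2 * C)) (by positivity)
  refine ⟨ε, hε, fun r hr hrΛ hv => ?_⟩
  set D := aboveKelv k u r with hD
  have hDm : MeasurableSet D := (isOpen_aboveKelv h hr).measurableSet
  have hDs : D ⊆ Metric.ball 0 Λ := fun z hz => by
    rw [mem_ball_zero_iff]; exact hz.1.2.trans_le hrΛ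
  have hDb : D ⊆ hball N r := fun z hz => hz.1
  have step : ∀ S : ℝ, 0 ≤ S → (∀ z ∈ D, u z - kelv k r u z ≤ S) → ∀ x ∈ D, u x - kelv k r u x ≤ S / 2 := by
    intro S hS hSD x hx
    obtain ⟨iI, eI⟩ := moving_identity h hr hx.1.1 hx.1.2
    obtain ⟨jI, jle⟩ := H D hDm hDs hv x (hx.1.2.trans_le hrΛ)
    have hmb := (isOpen_hball (N := N) r).measurableSet
    have hle : κ * (u x - kelv k r u x) ≤ ∫ z in hball N r, D.indicator (fun z => C * S * sing x z) z := by
      rw [← eI]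
      refine integral_mono_ae iI ?_ ?_
      · have jJ : IntegrableOn (fun z => C * S * sing x z) D := jI.const_mul _
        exact (jJ.integrable_indicator hDm).integrableOn
      · have hne : ∀ᵐ z ∂(volume.restrict (hball N r)), z ≠ x := by
          have : Nontrivial (Euc N) := ⟨x, 0, ne_zero_of_half hx.1.1⟩
          exact ae_restrict_of_ae (measure_eq_zero_iff_ae_notMem.1 (measure_singleton x))
        filter_upwards [hne, ae_restrict_mem hmb] with z hzx hz
        have hdk := dk_pos (k := k) hr hx.1.1 hx.1.2 hz hzx.symm
        have hzn := norm_pos_iff.2 (ne_zero_of_half hz.1)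
        have hb : 1 ≤ (r / ‖z‖) ^ tauExp N k q :=
          Real.one_le_rpow (by rw [le_div_iff₀ hzn]; linarith [hz.2]) hτ
        have hkp := kelv_pos h hr hz.1
        have hkq : 0 ≤ kelv k r u z ^ q := by positivity
        by_cases hzD : z ∈ D
        · rw [indicator_of_mem hzD]
          have hlt := hzD.2
          have h1 : u z ^ q - (r / ‖z‖) ^ tauExp N k q * kelv k r u z ^ q ≤ q * M ^ (q - 1) * S := by
            have a1 := rpow_sub_rpow_le hkp.le hlt.le (h.pos z hz.1) hq.le
            have a2 : u z ^ (q - 1) ≤ M ^ (q - 1) :=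
              Real.rpow_le_rpow (h.pos z hz.1).le (h.le z hz.1) (by linarith)
            have a3 : q * u z ^ (q - 1) * (u z - kelv k r u z) ≤ q * M ^ (q - 1) * S := by
              have := hSD z hzD
              exact mul_le_mul (by gcongr) this (by linarith) (by positivity)
            nlinarith
          have h2 : dk k r x z ≤ 4 / 3 * (4 * Λ * Λ) ^ ((k : ℝ) + 3 / 4) * sing x z := by
            refine (dk_le_gk hr hx.1.1 hx.1.2 hz).trans ((gk_le k hx.1.1 hz.1 hzx.symm).trans ?_)
            have c1 := (coord_le_norm x).trans (hx.1.2.le.trans hrΛ)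
            have c2 := (coord_le_norm z).trans (hz.2.le.trans hrΛ)
            have : 4 * x 0 * z 0 ≤ 4 * Λ * Λ := by
              have := hx.1.1
              have := hz.1
              gcongr
            have c3 : 0 ≤ 4 * x 0 * z 0 := by have := hx.1.1; have := hz.1; positivity
            have c4 : 0 ≤ sing x z := by unfold sing; positivity
            rw [mul_assoc (4 / 3 : ℝ)]
            gcongr
          calc _ ≤ dk k r x z * (q * M ^ (q - 1) * S) := by gcongr
            _ ≤ (4 / 3 * (4 * Λ * Λ) ^ ((k : ℝ) + 3 / 4) * sing x z) * (q * M ^ (q - 1) * S) := by gcongr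
            _ = _ := by rw [hC]; ring
        · rw [indicator_of_notMem hzD]
          have : u z ≤ kelv k r u z := by
            by_contra hcon
            exact hzD ⟨hz, not_le.1 hcon⟩
          have a1 : u z ^ q ≤ kelv k r u z ^ q := Real.rpow_le_rpow (h.pos z hz.1).le this (by linarith)
          exact mul_nonpos_of_nonneg_of_nonpos hdk.le (by nlinarith)
    rw [setIntegral_indicator hDm, inter_eq_right.2 hDb, integral_const_mul] at hle
    have h3 : C * S * ∫ z in D, sing x z ≤ C * S * (κ / (2 * C)) := by gcongr
    have h4 : C * S * (κ / (2 * C)) = κ * (S / 2) := by field_simp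
    exact le_of_mul_le_mul_left (by linarith) hκ
  have iter : ∀ n : ℕ, ∀ x ∈ D, u x - kelv k r u x ≤ M * (1 / 2) ^ n := by
    intro n
    induction n with
    | zero =>
      intro x hx
      have := h.le x hx.1.1
      have := kelv_pos h hr hx.1.1
      simp; linarith
    | succ n ih =>
      intro x hx
      refine (step _ (by positivity) ih x hx).trans (le_of_eq ?_)
      rw [pow_succ]; ring
  intro x hx hxr
  by_contra hcon
  have hxD : x ∈ D := ⟨⟨hx, hxr⟩, not_le.1 hcon⟩
  have hlim : Tendsto (fun n : ℕ => M * (1 / 2 : ℝ) ^ n) atTop (𝓝 (M * 0)) :=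
    (tendsto_pow_atTop_nhds_zero_of_lt_one (by norm_num) (by norm_num)).const_mul M
  have := ge_of_tendsto' hlim fun n => iter n x hxD
  linarith [hxD.2]

end MovingSpheres

section MovingSpheres
variable {N : ℕ} [NeZero N] {k : ℕ} {q κ M r : ℝ} {u : Euc N → ℝ}

lemma bv_half : 0 < (bv (0 : Fin N)) 0 := by simp [bv]

lemma hball_nonempty (hr : 0 < r) : (hball N r).Nonempty := by
  refine ⟨(r / 2) • bv 0, ?_, ?_⟩
  · have := bv_half (N := N)
    simp only [PiLp.smul_apply, smul_eq_mul]; positivity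
  · rw [norm_smul, Real.norm_eq_abs, abs_of_pos (by positivity)]
    simp [bv]; linarith

lemma eq_kelv_of_touch (h : IntSol k q κ M u) (hq : 1 < q) (hτ : 0 ≤ tauExp N k q) (hr : 0 < r)
    (hb : BelowKelv k u r) {x₀ : Euc N} (hx₀ : x₀ ∈ hball N r) (he : kelv k r u x₀ ≤ u x₀) :
    tauExp N k q = 0 ∧ ∀ x ∈ hball N r, u x = kelv k r u x := by
  have hNt : Nontrivial (Euc N) := ⟨x₀, 0, ne_zero_of_half hx₀.1⟩
  have hm := (isOpen_hball (N := N) r).measurableSet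
  have hw : ∀ z ∈ hball N r, 1 < r / ‖z‖ := fun z hz => by
    rw [lt_div_iff₀ (norm_pos_iff.2 (ne_zero_of_half hz.1))]; linarith [hz.2]
  obtain ⟨i0, e0⟩ := moving_identity h hr hx₀.1 hx₀.2
  rw [le_antisymm (hb x₀ hx₀.1 hx₀.2) he, sub_self, mul_zero] at e0
  have hne : ∀ᵐ z ∂(volume.restrict (hball N r)), z ≠ x₀ :=
    ae_restrict_of_ae (measure_eq_zero_iff_ae_notMem.1 (measure_singleton x₀))
  have hnp : ∀ z ∈ hball N r, u z ^ q - (r / ‖z‖) ^ tauExp N k q * kelv k r u z ^ q ≤ 0 := fun z hz => by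
    have a1 : u z ^ q ≤ kelv k r u z ^ q :=
      Real.rpow_le_rpow (h.pos z hz.1).le (hb z hz.1 hz.2) (by linarith)
    have a2 : 1 ≤ (r / ‖z‖) ^ tauExp N k q := Real.one_le_rpow (hw z hz).le hτ
    have a3 : 0 ≤ kelv k r u z ^ q := Real.rpow_nonneg (kelv_pos h hr hz.1).le q
    nlinarith
  have hz0 : ∀ᵐ z ∂(volume.restrict (hball N r)),
      u z ^ q - (r / ‖z‖) ^ tauExp N k q * kelv k r u z ^ q = 0 := by
    have e1 : ∫ z in hball N r, -(dk k r x₀ z * (u z ^ q - (r / ‖z‖) ^ tauExp N k q * kelv k r u z ^ q)) = 0 := by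
      rw [integral_neg, e0, neg_zero]
    have := (setIntegral_eq_zero_iff_of_nonneg_ae ?_ i0.neg).1 e1
    · filter_upwards [this, hne, ae_restrict_mem hm] with z h1 h2 h3
      have := dk_pos (k := k) hr hx₀.1 hx₀.2 h3 h2.symm
      simp only [Pi.neg_apply, Pi.zero_apply, neg_eq_zero, mul_eq_zero] at h1
      exact h1.resolve_left this.ne'
    · filter_upwards [hne, ae_restrict_mem hm] with z h2 h3
      have := dk_pos (k := k) hr hx₀.1 hx₀.2 h3 h2.symm
      simp only [Pi.neg_apply, Pi.zero_apply, Left.nonneg_neg_iff]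
      exact mul_nonpos_of_nonneg_of_nonpos this.le (hnp z h3)
  have hall : ∀ x ∈ hball N r, u x = kelv k r u x := by
    intro x hx
    obtain ⟨-, e⟩ := moving_identity h hr hx.1 hx.2
    rw [integral_eq_zero_of_ae] at e
    · have := (mul_eq_zero.1 e.symm).resolve_left h.kpos.ne'
      linarith
    · filter_upwards [hz0] with z hz
      simp [hz]
  refine ⟨?_, hall⟩
  have hne' : (ae (volume.restrict (hball N r))).NeBot := by
    rw [ae_restrict_neBot]
    exact ((isOpen_hball r).measure_pos volume (hball_nonempty hr)).ne'
  obtain ⟨z, h1, h2⟩ := (hz0.and (ae_restrict_mem hm)).exists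
  rw [← hall z h2] at h1
  have hup : 0 < u z ^ q := Real.rpow_pos_of_pos (h.pos z h2.1) q
  have h3 : (r / ‖z‖) ^ tauExp N k q = 1 := by
    have : (1 - (r / ‖z‖) ^ tauExp N k q) * u z ^ q = 0 := by linarith
    have := (mul_eq_zero.1 this).resolve_right hup.ne'
    linarith
  by_contra hne0
  exact absurd h3 (Real.one_lt_rpow (hw z h2) (lt_of_le_of_ne hτ (Ne.symm hne0))).ne'

lemma isOpen_aboveKelv' (h : IntSol k q κ M u) (r : ℝ) : IsOpen (aboveKelv k u r) := by
  rcases le_or_gt r 0 with hr | hr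
  · have : aboveKelv k u r = ∅ := eq_empty_of_forall_notMem fun x hx => by
      have := hx.1.2; have := norm_nonneg x; linarith
    rw [this]; exact isOpen_empty
  · exact isOpen_aboveKelv h hr

lemma tendsto_volume_aboveKelv (h : IntSol k q κ M u) {r₀ : ℝ}
    (hs : ∀ x ∈ hball N r₀, u x < kelv k r₀ u x) :
    Tendsto (fun r => volume (aboveKelv k u r)) (𝓝[>] r₀) (𝓝 0) := by
  have hNt : Nontrivial (Euc N) := ⟨bv 0, 0, ne_zero_of_half bv_half⟩
  rw [← measure_empty (μ := (volume : Measure (Euc N)))]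
  refine tendsto_measure_of_ae_tendsto_indicator (𝓝[>] r₀) MeasurableSet.empty
    (fun r => (isOpen_aboveKelv' h r).measurableSet) (measurableSet_ball (x := (0 : Euc N)) (ε := r₀ + 1))
    measure_ball_lt_top.ne ?_ ?_
  · filter_upwards [mem_nhdsWithin_of_mem_nhds (Iio_mem_nhds (show r₀ < r₀ + 1 by linarith))] with r hr z hz
    rw [mem_ball_zero_iff]; exact hz.1.2.trans hr
  · have hsph : ∀ᵐ z : Euc N ∂volume, z ∉ Metric.sphere (0 : Euc N) r₀ :=
      measure_eq_zero_iff_ae_notMem.1 (Measure.addHaar_sphere _ _ _)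
    filter_upwards [hsph] with z hz
    have hz' : ‖z‖ ≠ r₀ := by simpa using hz
    simp only [mem_empty_iff_false, iff_false]
    rcases le_or_gt (z 0) 0 with h0 | h0
    · exact Eventually.of_forall fun r hr => absurd hr.1.1 (not_lt.2 h0)
    rcases lt_or_gt_of_ne hz' with h1 | h1
    · have hr0 : 0 < r₀ := (norm_nonneg z).trans_lt h1
      have hc : ContinuousAt (fun r => kelv k r u z) r₀ := by
        have := (continuousOn_kelv h).comp (f := fun s : ℝ => (s, z)) (s := Ioi 0) (by fun_prop)
          fun s hs => ⟨hs, h0⟩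
        exact this.continuousAt (Ioi_mem_nhds hr0)
      have := hc.eventually (Ioi_mem_nhds (hs z ⟨h0, h1⟩))
      filter_upwards [mem_nhdsWithin_of_mem_nhds this] with r hr hcon
      exact absurd hcon.2 (not_lt.2 (le_of_lt hr))
    · filter_upwards [mem_nhdsWithin_of_mem_nhds (Iio_mem_nhds h1)] with r hr hcon
      exact absurd hcon.1.2 (not_lt.2 (le_of_lt hr))

lemma belowKelv_extend (h : IntSol k q κ M u) (hq : 1 < q) (hτ : 0 ≤ tauExp N k q) {r₀ : ℝ} (h0 : 0 ≤ r₀)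
    (hs : ∀ x ∈ hball N r₀, u x < kelv k r₀ u x) : ∃ δ : ℝ, r₀ < δ ∧ ∀ r, r₀ < r → r ≤ δ → BelowKelv k u r := by
  obtain ⟨ε, hε, H⟩ := belowKelv_of_small h hq hτ (Λ := r₀ + 1) (by linarith)
  have h1 := (tendsto_volume_aboveKelv h hs).eventually (Iio_mem_nhds hε)
  have h2 : ∀ᶠ r in 𝓝[>] r₀, r < r₀ + 1 :=
    mem_nhdsWithin_of_mem_nhds (Iio_mem_nhds (show r₀ < r₀ + 1 by linarith))
  obtain ⟨δ, hδ, hsub⟩ := mem_nhdsGT_iff_exists_Ioc_subset.1 (h1.and h2)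
  refine ⟨δ, hδ, fun r hr hrδ => ?_⟩
  have := hsub ⟨hr, hrδ⟩
  exact H r (by linarith) this.2.le this.1

lemma moving_spheres (h : IntSol k q κ M u) (hq : 1 < q) (hτ : 0 ≤ tauExp N k q) :
    (∀ r : ℝ, 0 < r → BelowKelv k u r) ∨
      (tauExp N k q = 0 ∧ ∃ r : ℝ, 0 < r ∧ ∀ x ∈ hball N r, u x = kelv k r u x) := by
  by_contra! hcon
  obtain ⟨⟨R, hR, hnR⟩, hno⟩ := hcon
  set T : Set ℝ := {r | 0 < r ∧ ∀ s, 0 < s → s ≤ r → BelowKelv k u s} with hT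
  have hTbdd : BddAbove T := ⟨R, fun r hr => by
    by_contra hlt
    exact hnR (hr.2 R hR (not_le.1 hlt).le)⟩
  obtain ⟨δ, hδ, hδ2⟩ := belowKelv_extend h hq hτ (r₀ := 0) le_rfl
    fun x hx => absurd hx.2 (not_lt.2 (norm_nonneg x))
  have hδT : δ ∈ T := ⟨hδ, hδ2⟩
  set s := sSup T with hs
  have hs0 : 0 < s := hδ.trans_le (le_csSup hTbdd hδT)
  have hlt : ∀ r, 0 < r → r < s → BelowKelv k u r := fun r h0 hr => by
    obtain ⟨t, ht, hrt⟩ := exists_lt_of_lt_csSup ⟨δ, hδT⟩ hr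
    exact ht.2 r h0 hrt.le
  have hbs : BelowKelv k u s := by
    intro x hx hxs
    have hc : ContinuousAt (fun r => kelv k r u x) s := by
      have := (continuousOn_kelv h).comp (f := fun s : ℝ => (s, x)) (s := Ioi 0) (by fun_prop)
        fun s hs => ⟨hs, hx⟩
      exact this.continuousAt (Ioi_mem_nhds hs0)
    refine ge_of_tendsto (b := u x) (hc.tendsto.mono_left (nhdsWithin_le_nhds (s := Iio s))) ?_
    filter_upwards [self_mem_nhdsWithin, mem_nhdsWithin_of_mem_nhds (Ioi_mem_nhds hxs)] with r h1 h2
    exact hlt r ((norm_nonneg x).trans_lt h2) h1 x hx h2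
  have hstrict : ∀ x ∈ hball N s, u x < kelv k s u x := by
    intro x hx
    by_contra hge
    obtain ⟨t0, hall⟩ := eq_kelv_of_touch h hq hτ hs0 hbs hx (not_lt.1 hge)
    obtain ⟨y, hy, hne⟩ := hno t0 s hs0
    exact hne (hall y hy)
  obtain ⟨δ', hδ', hδ2'⟩ := belowKelv_extend h hq hτ hs0.le hstrict
  have : δ' ∈ T := ⟨hs0.trans hδ', fun r h0 hr => by
    rcases lt_trichotomy r s with h1 | h1 | h1
    · exact hlt r h0 h1
    · rw [h1]; exact hbs
    · exact hδ2' r h1 hr⟩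
  exact absurd (le_csSup hTbdd this) (not_le.2 hδ')

end MovingSpheres

section Translate
variable {N : ℕ} [NeZero N] {k : ℕ} {q κ M : ℝ} {u : Euc N → ℝ}

lemma gk_add_right (k : ℕ) {b : Euc N} (hb : b 0 = 0) (x y : Euc N) : gk k (x + b) (y + b) = gk k x y := by
  rw [gk_eq_Fk, gk_eq_Fk]
  simp [hb]

lemma integral_half_translate {b : Euc N} (hb : b 0 = 0) (g : Euc N → ℝ) :
    (IntegrableOn g {y | 0 < y 0} → IntegrableOn (fun y => g (y + b)) {y | 0 < y 0}) ∧
    ∫ y in {y : Euc N | 0 < y 0}, g (y + b) = ∫ y in {y : Euc N | 0 < y 0}, g y := by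
  have e : ∀ y, ({y : Euc N | 0 < y 0}.indicator fun y => g (y + b)) y = ({y : Euc N | 0 < y 0}.indicator g) (y + b) := by
    intro y
    simp [indicator, hb]
  constructor
  · intro h
    rw [← integrable_indicator_iff measurableSet_half] at h ⊢
    exact (h.comp_add_right b).congr (Eventually.of_forall fun y => (e y).symm)
  · rw [← integral_indicator measurableSet_half, ← integral_indicator measurableSet_half, funext e,
      integral_add_right_eq_self]

lemma IntSol.translate (h : IntSol k q κ M u) {b : Euc N} (hb : b 0 = 0) :
    IntSol k q κ M (fun x => u (x + b)) := by
  have hh : ∀ x : Euc N, 0 < x 0 → 0 < (x + b) 0 := fun x hx => by simpa [hb] using hx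
  refine ⟨h.kpos, h.cont.comp (by fun_prop) hh, fun x hx => h.pos _ (hh x hx), fun x hx => h.le _ (hh x hx),
    fun x hx => ?_, fun x hx => ?_⟩
  · have := (integral_half_translate hb _).1 (h.integrable _ (hh x hx))
    simpa only [gk_add_right k hb] using this
  · rw [← h.eq _ (hh x hx), ← (integral_half_translate hb (fun y => gk k (x + b) y * u y ^ q)).2]
    simp only [gk_add_right k hb]

end Translate

section Monotone
variable {N : ℕ} [NeZero N] {k : ℕ} {q κ M : ℝ} {u : Euc N → ℝ}

lemma le_of_belowKelv (hB : ∀ b : Euc N, b 0 = 0 → ∀ r : ℝ, 0 < r → BelowKelv k (fun x => u (x + b)) r)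
    {b v : Euc N} (hb : b 0 = 0) (hv : 0 < v 0) {s : ℝ} (hs : 1 < s) :
    u (v + b) ≤ s ^ ((N : ℝ) - 2 * ((k : ℝ) + 1)) * u (s ^ 2 • v + b) := by
  have hvn := norm_pos_iff.2 (ne_zero_of_half hv)
  have := hB b hb (s * ‖v‖) (by positivity) v hv (by nlinarith)
  simp only [kelv, sinv] at this
  rwa [mul_div_cancel_right₀ _ hvn.ne'] at this

lemma eq_of_height_eq (h : IntSol k q κ M u)
    (hB : ∀ b : Euc N, b 0 = 0 → ∀ r : ℝ, 0 < r → BelowKelv k (fun x => u (x + b)) r)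
    {x y : Euc N} (hx : 0 < x 0) (hxy : x 0 = y 0) : u x ≤ u y := by
  have key : ∀ s : ℝ, 1 < s → u x ≤ s ^ ((N : ℝ) - 2 * ((k : ℝ) + 1)) * u (y + ((s ^ 2 - 1) * x 0) • bv 0) := by
    intro s hs
    have hs2 : 0 < s ^ 2 - 1 := by nlinarith
    set v : Euc N := (s ^ 2 - 1)⁻¹ • (y - x) + x 0 • bv 0 with hv
    have hv0 : v 0 = x 0 := by simp [hv, hxy, bv]
    have := le_of_belowKelv hB (b := x - v) (v := v) (by simp [hv0]) (by rw [hv0]; exact hx) hs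
    have e1 : v + (x - v) = x := by abel
    have e2 : s ^ 2 • v + (x - v) = y + ((s ^ 2 - 1) * x 0) • bv 0 := by
      have : s ^ 2 • v + (x - v) = (s ^ 2 - 1) • v + x := by rw [sub_smul, one_smul]; abel
      rw [this, hv, smul_add, smul_smul, smul_smul, mul_inv_cancel₀ hs2.ne', one_smul]
      abel
    rwa [e1, e2] at this
  have hy : 0 < y 0 := hxy ▸ hx
  have hc : ContinuousAt (fun s : ℝ => s ^ ((N : ℝ) - 2 * ((k : ℝ) + 1)) * u (y + ((s ^ 2 - 1) * x 0) • bv 0)) 1 := by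
    refine ContinuousAt.mul (Real.continuousAt_rpow_const _ _ (Or.inl one_ne_zero)) ?_
    refine ContinuousAt.comp (f := fun s : ℝ => y + ((s ^ 2 - 1) * x 0) • bv 0) ?_ (by fun_prop)
    simp only [one_pow, sub_self, zero_mul, zero_smul, add_zero]
    exact h.cont.continuousAt (isOpen_half.mem_nhds hy)
  have hl := hc.tendsto.mono_left (nhdsWithin_le_nhds (s := Ioi 1))
  simp only [one_pow, sub_self, zero_mul, zero_smul, add_zero, Real.one_rpow, one_mul] at hl
  exact ge_of_tendsto hl (by filter_upwards [self_mem_nhdsWithin] with s hs using key s hs)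

/-- The box of heights between `A` and `2 * A` and of width `R`. -/
def hbox (N : ℕ) [NeZero N] (A R : ℝ) : Set (Euc N) :=
  {y | ∀ i, y i ∈ Ioo (if i = 0 then A else 0) (if i = 0 then 2 * A else R)}

lemma hbox_eq (A R : ℝ) : hbox N A R = (WithLp.ofLp : Euc N → Fin N → ℝ) ⁻¹'
    (univ.pi fun i => Ioo (if i = 0 then A else 0) (if i = 0 then 2 * A else R)) := by
  ext y
  simp only [hbox, mem_preimage, mem_univ_pi]
  exact Iff.rfl

lemma measurableSet_hbox (A R : ℝ) : MeasurableSet (hbox N A R) := by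
  rw [hbox_eq]
  exact (PiLp.volume_preserving_ofLp (Fin N)).measurable (MeasurableSet.univ_pi fun i => measurableSet_Ioo)

lemma volume_hbox {A R : ℝ} (hA : 0 ≤ A) (hR : 0 ≤ R) :
    volume (hbox N A R) = ENNReal.ofReal (A * R ^ (N - 1)) := by
  rw [hbox_eq, (PiLp.volume_preserving_ofLp (Fin N)).measure_preimage
    (MeasurableSet.univ_pi fun i => measurableSet_Ioo).nullMeasurableSet, Real.volume_pi_Ioo,
    ← ENNReal.ofReal_prod_of_nonneg]
  · congr 1
    rw [← Finset.mul_prod_erase _ _ (Finset.mem_univ (0 : Fin N))]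
    have : ∀ i ∈ Finset.univ.erase (0 : Fin N), ((if i = 0 then 2 * A else R) - if i = 0 then A else 0) = R := by
      intro i hi
      rw [if_neg (Finset.ne_of_mem_erase hi), if_neg (Finset.ne_of_mem_erase hi), sub_zero]
    rw [Finset.prod_congr rfl this, Finset.prod_const, Finset.card_erase_of_mem (Finset.mem_univ _)]
    simp
    left; ring
  · intro i _
    split_ifs <;> linarith

lemma box_lower_bound (h : IntSol k q κ M u) (hq : 0 < q) {A B R c : ℝ} (hA : 1 ≤ A) (hB : 1 ≤ B) (hAB : A * B = R)
    (hc : 0 < c) (hu : ∀ y ∈ hbox N A R, c ≤ u y) :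
    (4 : ℝ) ^ (k + 1) * (4 * N + 8) ^ (-((N : ℝ) / 2)) / (k + 1) * c ^ q * R ^ k * A ≤ κ * u (B • bv 0) := by
  have hR : 1 ≤ R := by nlinarith
  have hAR : A ≤ R := by nlinarith
  have hBR : B ≤ R := by nlinarith
  have hN : 0 < N := Nat.pos_of_ne_zero (NeZero.ne N)
  have hN' : (0 : ℝ) < N := by exact_mod_cast hN
  have hx0 : (B • bv (0 : Fin N)) 0 = B := by simp [bv]
  have hxp : 0 < (B • bv (0 : Fin N)) 0 := by rw [hx0]; linarith
  have hb0 : ∀ y ∈ hbox N A R, A < y 0 ∧ y 0 < 2 * A := fun y hy => by simpa using hy 0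
  have hsub : hbox N A R ⊆ {y : Euc N | 0 < y 0} := fun y hy => by
    have := (hb0 y hy).1
    exact lt_trans (by linarith) this
  have hgk : ∀ y ∈ hbox N A R, y ≠ B • bv 0 →
      (4 * R) ^ (k + 1) * ((4 * N + 8) * R ^ 2) ^ (-((N : ℝ) / 2)) / (k + 1) ≤ gk k (B • bv 0) y := by
    intro y hy hne
    obtain ⟨y1, y2⟩ := hb0 y hy
    have ht1 : 4 * R ≤ 4 * B * y 0 := by nlinarith
    have ht2 : 4 * B * y 0 ≤ 8 * R := by nlinarith
    have hρ : ‖B • bv 0 - y‖ ^ 2 ≤ 4 * N * R ^ 2 := by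
      rw [EuclideanSpace.real_norm_sq_eq]
      have : ∀ i ∈ (Finset.univ : Finset (Fin N)), ((B • bv 0 - y : Euc N) i) ^ 2 ≤ 4 * R ^ 2 := by
        intro i _
        have hi := hy i
        by_cases h0 : i = 0
        · subst h0
          simp only [PiLp.sub_apply, hx0]
          nlinarith
        · rw [if_neg h0, if_neg h0] at hi
          have : (B • bv (0 : Fin N)) i = 0 := by simp [bv, h0]
          simp only [PiLp.sub_apply, this]
          nlinarith [hi.1, hi.2]
      refine (Finset.sum_le_sum this).trans (le_of_eq ?_)
      simp; ring
    have hρ0 : 0 < ‖B • bv 0 - y‖ := norm_pos_iff.2 (sub_ne_zero.2 hne.symm)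
    have h1 := Fk_lower (k := k) (p := (N : ℝ) / 2) (ρ := ‖B • bv 0 - y‖ ^ 2) (t := 4 * B * y 0)
      (by positivity) (by linarith) (by positivity)
    rw [gk_eq_Fk, hx0]
    refine le_trans ?_ h1
    have h2 : ((4 * (N : ℝ) + 8) * R ^ 2) ^ (-((N : ℝ) / 2)) ≤ (‖B • bv 0 - y‖ ^ 2 + 4 * B * y 0) ^ (-((N : ℝ) / 2)) := by
      refine Real.rpow_le_rpow_of_nonpos ?_ ?_ (by linarith)
      · have : 0 < ‖B • bv 0 - y‖ ^ 2 := by positivity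
        linarith
      · nlinarith
    have h3 : 0 ≤ 4 * B * y 0 := by linarith
    gcongr
  have hNt : Nontrivial (Euc N) := ⟨bv 0, 0, ne_zero_of_half bv_half⟩
  have hm := measurableSet_hbox (N := N) A R
  have hfin : volume (hbox N A R) ≠ ⊤ := by rw [volume_hbox (by linarith) (by linarith)]; exact ENNReal.ofReal_ne_top
  have hne : ∀ᵐ z ∂(volume.restrict (hbox N A R)), z ≠ B • bv 0 :=
    ae_restrict_of_ae (measure_eq_zero_iff_ae_notMem.1 (measure_singleton _))
  rw [← h.eq _ hxp]
  have s1 : ∫ y in hbox N A R, gk k (B • bv 0) y * u y ^ q ≤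
      ∫ y in {y : Euc N | 0 < y 0}, gk k (B • bv 0) y * u y ^ q := by
    refine setIntegral_mono_set (h.integrable _ hxp) ?_ (Eventually.of_forall hsub)
    filter_upwards [ae_restrict_mem measurableSet_half] with y hy
    exact mul_nonneg (gk_nonneg hxp.le (le_of_lt hy)) (Real.rpow_nonneg (h.pos y hy).le q)
  refine le_trans ?_ s1
  set G := (4 * R) ^ (k + 1) * ((4 * (N : ℝ) + 8) * R ^ 2) ^ (-((N : ℝ) / 2)) / (k + 1) with hG
  have hG0 : 0 ≤ G := by positivity
  have s2 : ∫ y in hbox N A R, G * c ^ q ≤ ∫ y in hbox N A R, gk k (B • bv 0) y * u y ^ q := by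
    refine integral_mono_ae (integrableOn_const hfin) ((h.integrable _ hxp).mono_set hsub) ?_
    filter_upwards [hne, ae_restrict_mem hm] with y h1 h2
    have := hu y h2
    exact mul_le_mul (hgk y h2 h1) (by gcongr) (by positivity) (gk_nonneg hxp.le (hsub h2).le)
  refine le_trans (le_of_eq ?_) s2
  rw [setIntegral_const, Measure.real, volume_hbox (by linarith) (by linarith),
    ENNReal.toReal_ofReal (by positivity), hG, Real.mul_rpow (by positivity) (by positivity)]
  have e1 : (R ^ 2) ^ (-((N : ℝ) / 2)) = (R ^ N)⁻¹ := by
    rw [← Real.rpow_natCast R 2, ← Real.rpow_mul (by linarith), ← Real.rpow_natCast, ← Real.rpow_neg (by linarith)]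
    congr 1; push_cast; ring
  have e2 : R ^ N = R * R ^ (N - 1) := by rw [← pow_succ']; congr 1; omega
  rw [e1, e2, smul_eq_mul, mul_pow, pow_succ R k]
  have : R ^ (N - 1) ≠ 0 := by positivity
  field_simp

lemma not_forall_belowKelv (h : IntSol k q κ M u) (hq : 0 < q) :
    ¬ ∀ b : Euc N, b 0 = 0 → ∀ r : ℝ, 0 < r → BelowKelv k (fun x => u (x + b)) r := by
  intro hB
  have hN' : (0 : ℝ) < N := by exact_mod_cast Nat.pos_of_ne_zero (NeZero.ne N)
  have hκ := h.kpos
  have hU : ∀ y : Euc N, 0 < y 0 → u (y 0 • bv 0) ≤ u y := fun y hy => by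
    have e : (y 0 • bv (0 : Fin N)) 0 = y 0 := by simp [bv]
    exact eq_of_height_eq h hB (by rw [e]; exact hy) e
  obtain ⟨t₀, ht₀, hmin⟩ := (isCompact_Icc (a := (1 : ℝ)) (b := 2)).exists_isMinOn ⟨1, by simp⟩
    (f := fun t : ℝ => u (t • bv (0 : Fin N))) (h.cont.comp (by fun_prop) fun t ht => by
      have : 0 < t := by linarith [ht.1]
      simpa [bv] using this)
  set c₀ := u (t₀ • bv (0 : Fin N)) with hc₀
  have hc₀p : 0 < c₀ := h.pos _ (by
    have : 0 < t₀ := by linarith [ht₀.1]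
    simpa [bv] using this)
  set K := (4 : ℝ) ^ (k + 1) * (4 * N + 8) ^ (-((N : ℝ) / 2)) / (k + 1) with hK
  have hKp : 0 < K := by positivity
  have hb0 : ∀ {A R : ℝ}, ∀ y ∈ hbox N A R, A < y 0 ∧ y 0 < 2 * A := fun y hy => by simpa using hy 0
  set c₁ := K * c₀ ^ q / κ with hc₁
  have hc₁p : 0 < c₁ := by positivity
  have h1 : ∀ B : ℝ, 1 ≤ B → c₁ ≤ u (B • bv 0) := by
    intro B hB1
    have := box_lower_bound h hq (A := 1) (B := B) (R := B) (c := c₀) le_rfl hB1 (one_mul B) hc₀p fun y hy => by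
      obtain ⟨y1, y2⟩ := hb0 y hy
      exact (hmin (show y 0 ∈ Icc (1 : ℝ) 2 from ⟨y1.le, by linarith⟩)).trans (hU y (by linarith))
    rw [← hK] at this
    have hBk : 1 ≤ B ^ k := one_le_pow₀ hB1
    rw [hc₁, div_le_iff₀ hκ]
    have : K * c₀ ^ q * 1 ≤ K * c₀ ^ q * B ^ k := by gcongr
    linarith
  have h2 : ∀ R : ℝ, 1 ≤ R → K * c₁ ^ q * R ≤ κ * M := by
    intro R hR
    have := box_lower_bound h hq (A := R) (B := 1) (R := R) (c := c₁) hR le_rfl (mul_one R) hc₁p fun y hy => by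
      obtain ⟨y1, y2⟩ := hb0 y hy
      exact (h1 (y 0) (by linarith)).trans (hU y (by linarith))
    rw [← hK] at this
    have hRk : 1 ≤ R ^ k := one_le_pow₀ hR
    have hM : κ * u ((1 : ℝ) • bv 0) ≤ κ * M := by
      gcongr
      exact h.le _ (by simp [bv])
    have : K * c₁ ^ q * 1 * R ≤ K * c₁ ^ q * R ^ k * R := by gcongr
    linarith
  have hP : 0 < K * c₁ ^ q := by positivity
  have h3 := h2 (κ * M / (K * c₁ ^ q) + 1) (by
    have := h.M_pos
    have : 0 ≤ κ * M / (K * c₁ ^ q) := by positivity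
    linarith)
  rw [mul_add, mul_div_cancel₀ _ hP.ne'] at h3
  linarith

end Monotone

section KernelProfile
variable {k : ℕ} {p ρ t : ℝ}

lemma Fk_eq_integral (ht : 0 < t) :
    Fk k p ρ t = ∫ r in (0 : ℝ)..t, r ^ k * (ρ + r) ^ (-p) := by
  unfold Fk
  rw [← intervalIntegral.integral_of_le zero_le_one]
  have h := intervalIntegral.integral_comp_mul_left (a := 0) (b := 1) (fun r => r ^ k * (ρ + r) ^ (-p)) ht.ne'
  rw [mul_zero, mul_one, smul_eq_mul, eq_inv_mul_iff_mul_eq₀ ht.ne'] at h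
  rw [← h, ← intervalIntegral.integral_const_mul]
  congr 1
  funext σ
  ring

lemma Fk_sub_lower {t' : ℝ} (hρ : 0 < ρ) (ht : 0 < t) (htt : t ≤ t') (hp : 0 ≤ p) :
    (t' - t) * (t ^ k * (ρ + t') ^ (-p)) ≤ Fk k p ρ t' - Fk k p ρ t := by
  have hc : ∀ a : ℝ, 0 ≤ a → a ≤ t' → ContinuousOn (fun r : ℝ => r ^ k * (ρ + r) ^ (-p)) (Icc a t') := fun a ha _ =>
    ContinuousOn.mul (by fun_prop) (ContinuousOn.rpow_const (by fun_prop) fun r hr =>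
      Or.inl (by have := ha.trans hr.1; positivity))
  have i1 := (hc 0 le_rfl (ht.le.trans htt)).intervalIntegrable_of_Icc (μ := volume) (ht.le.trans htt)
  have i2 := (hc t ht.le htt).intervalIntegrable_of_Icc (μ := volume) htt
  have i3 : IntervalIntegrable (fun r : ℝ => r ^ k * (ρ + r) ^ (-p)) volume 0 t :=
    ((hc 0 le_rfl (ht.le.trans htt)).mono (Icc_subset_Icc_right htt)).intervalIntegrable_of_Icc ht.le
  rw [Fk_eq_integral ht, Fk_eq_integral (ht.trans_le htt), intervalIntegral.integral_interval_sub_left i1 i3]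
  have : (t' - t) * (t ^ k * (ρ + t') ^ (-p)) = ∫ _ in t..t', t ^ k * (ρ + t') ^ (-p) := by
    rw [intervalIntegral.integral_const, smul_eq_mul]
  rw [this]
  refine intervalIntegral.integral_mono_on htt (by simp) i2 fun r hr => ?_
  have h1 : (ρ + t') ^ (-p) ≤ (ρ + r) ^ (-p) :=
    Real.rpow_le_rpow_of_nonpos (by linarith [hr.1]) (by linarith [hr.2]) (by linarith)
  have h2 : t ^ k ≤ r ^ k := pow_le_pow_left₀ ht.le hr.1 k
  have h3 : 0 ≤ r ^ k := pow_nonneg (ht.le.trans hr.1) k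
  have h4 : 0 ≤ (ρ + t') ^ (-p) := Real.rpow_nonneg (by linarith) _
  exact mul_le_mul h2 h1 h4 h3

lemma Fk_mono_right {t' : ℝ} (hρ : 0 < ρ) (ht : 0 < t) (htt : t ≤ t') (hp : 0 ≤ p) :
    Fk k p ρ t ≤ Fk k p ρ t' := by
  have h := Fk_sub_lower (k := k) hρ ht htt hp
  have : 0 ≤ (t' - t) * (t ^ k * (ρ + t') ^ (-p)) := by
    have : 0 ≤ t' - t := by linarith
    have := ht.trans_le htt
    positivity
  linarith

end KernelProfile

lemma rpow_mul_sub_le {a b q : ℝ} (ha : 0 < a) (hb : 0 < b) (hq : 1 < q) :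
    a ^ q * b - a * b ^ q ≤ (q - 1) / (q + 1) * (a ^ q * a - b ^ q * b) + (a ^ q - b ^ q) * (a - b) := by
  have hq1 : 0 < q + 1 := by linarith
  have h := Real.geom_mean_le_arith_mean2_weighted (w₁ := q / (q + 1)) (w₂ := 1 / (q + 1))
    (p₁ := a ^ (q + 1)) (p₂ := b ^ (q + 1)) (by positivity) (by positivity) (by positivity) (by positivity)
    (by field_simp)
  rw [← Real.rpow_mul ha.le, ← Real.rpow_mul hb.le, mul_div_cancel₀ _ hq1.ne', mul_one_div_cancel hq1.ne',
    Real.rpow_one, Real.rpow_add_one ha.ne', Real.rpow_add_one hb.ne'] at h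
  have e : (q - 1) / (q + 1) * (a ^ q * a - b ^ q * b) + (a ^ q - b ^ q) * (a - b) - (a ^ q * b - a * b ^ q) =
      2 * (q / (q + 1) * (a ^ q * a) + 1 / (q + 1) * (b ^ q * b) - a ^ q * b) := by
    field_simp; ring
  linarith

section Shift
variable {N : ℕ} [NeZero N] {k : ℕ} {q κ M : ℝ} {u : Euc N → ℝ}

lemma measurable_gk (k : ℕ) : Measurable (fun z : Euc N × Euc N => gk k z.1 z.2) := by
  have h : StronglyMeasurable (fun w : (Euc N × Euc N) × ℝ => kh k w.1.1 w.2 w.1.2) :=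
    ((measurable_kh k).comp (by fun_prop : Measurable fun w : (Euc N × Euc N) × ℝ => (w.1.1, w.2, w.1.2))).stronglyMeasurable
  exact (h.integral_prod_right (ν := volume.restrict (Ioc 0 1))).measurable

lemma measurable_gk_right (k : ℕ) (x : Euc N) : Measurable (gk k x) :=
  (measurable_gk k).comp (measurable_const.prodMk measurable_id)

lemma add_smul_bv_zero (x : Euc N) (s : ℝ) : (x + s • bv 0 : Euc N) 0 = x 0 + s := by simp [bv]

lemma shift_half {x : Euc N} (hx : 0 < x 0) {s : ℝ} (hs : 0 ≤ s) : 0 < (x + s • bv 0 : Euc N) 0 := by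
  rw [add_smul_bv_zero]; linarith

lemma norm_le_norm_shift {x : Euc N} (hx : 0 < x 0) {s : ℝ} (hs : 0 ≤ s) : ‖x‖ ≤ ‖x + s • bv 0‖ := by
  have h : ‖x‖ ^ 2 ≤ ‖x + s • bv 0‖ ^ 2 := by
    have h0 : 0 ≤ s * x 0 := by positivity
    have h1 : inner ℝ x (bv 0) = x 0 := by simp [bv, EuclideanSpace.inner_single_right]
    rw [norm_add_sq_real, inner_smul_right, h1]
    nlinarith [sq_nonneg ‖s • (bv 0 : Euc N)‖]
  exact le_of_sq_le_sq h (norm_nonneg _)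

lemma integral_half_shift (g : Euc N → ℝ) (s : ℝ) :
    ∫ x in {x : Euc N | 0 < x 0}, g (x + s • bv 0) = ∫ x in {x : Euc N | s < x 0}, g x := by
  have hm : MeasurableSet {x : Euc N | s < x 0} := (isOpen_lt continuous_const (by fun_prop)).measurableSet
  rw [← integral_indicator measurableSet_half, ← integral_indicator hm,
    ← integral_add_right_eq_self ({x : Euc N | s < x 0}.indicator g) (s • bv 0)]
  congr 1
  funext x
  simp [indicator, bv]

lemma integrableOn_half_shift {g : Euc N → ℝ} {s : ℝ} (hg : IntegrableOn g {x | 0 < x 0}) (hs : 0 ≤ s) :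
    IntegrableOn (fun x => g (x + s • bv 0)) {x | 0 < x 0} := by
  have hm : MeasurableSet {x : Euc N | s < x 0} := (isOpen_lt continuous_const (by fun_prop)).measurableSet
  have h1 : IntegrableOn g {x : Euc N | s < x 0} := hg.mono_set fun x hx => hs.trans_lt hx
  rw [← integrable_indicator_iff measurableSet_half]
  rw [← integrable_indicator_iff hm] at h1
  refine (h1.comp_add_right (s • bv 0)).congr (Eventually.of_forall fun x => ?_)
  simp [indicator, bv]

lemma gk_le_shift (k : ℕ) {x y : Euc N} (hx : 0 < x 0) (hy : 0 < y 0) (hxy : x ≠ y) {s : ℝ} (hs : 0 ≤ s) :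
    gk k x y ≤ gk k (x + s • bv 0) (y + s • bv 0) := by
  have := norm_pos_iff.2 (sub_ne_zero.2 hxy)
  rw [gk_eq_Fk, gk_eq_Fk, add_sub_add_right_eq_sub, add_smul_bv_zero, add_smul_bv_zero]
  refine Fk_mono_right (by positivity) (by positivity) ?_ (by positivity)
  have : 0 ≤ s * x 0 := by positivity
  have : 0 ≤ s * y 0 := by positivity
  nlinarith

/-- The kernel gains at least linearly when both points are shifted upwards. -/
lemma gk_shift_gain (k : ℕ) {x y : Euc N} (hx : x ∈ Metric.ball (bv 0) (1 / 2)) (hy : y ∈ Metric.ball (bv 0) (1 / 2))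
    (hxy : x ≠ y) {s : ℝ} (hs : 0 < s) (hs1 : s ≤ 1) :
    4 * s * (26 : ℝ) ^ (-((N : ℝ) / 2)) ≤ gk k (x + s • bv 0) (y + s • bv 0) - gk k x y := by
  have hb : ∀ z ∈ Metric.ball (bv (0 : Fin N)) (1 / 2), 1 / 2 < z 0 ∧ z 0 < 3 / 2 := fun z hz => by
    rw [mem_ball_iff_norm] at hz
    have := (PiLp.norm_apply_le (z - bv 0) 0).trans_lt hz
    simp only [PiLp.sub_apply, Real.norm_eq_abs, abs_lt] at this
    have e : (bv (0 : Fin N)) 0 = 1 := by simp [bv]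
    rw [e] at this
    constructor <;> linarith
  obtain ⟨x1, x2⟩ := hb x hx
  obtain ⟨y1, y2⟩ := hb y hy
  have hρ := norm_pos_iff.2 (sub_ne_zero.2 hxy)
  have hρ1 : ‖x - y‖ ≤ 1 := by
    have := dist_triangle_right x y (bv 0)
    rw [← dist_eq_norm]
    rw [Metric.mem_ball] at hx hy
    linarith
  have hN0 : (0 : ℝ) ≤ (N : ℝ) / 2 := by positivity
  rw [gk_eq_Fk, gk_eq_Fk, add_sub_add_right_eq_sub, add_smul_bv_zero, add_smul_bv_zero]
  have ht1 : 1 ≤ 4 * x 0 * y 0 := by nlinarith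
  have hst : 4 * x 0 * y 0 + 4 * s ≤ 4 * (x 0 + s) * (y 0 + s) := by nlinarith
  have ht2 : 4 * (x 0 + s) * (y 0 + s) ≤ 25 := by nlinarith
  refine le_trans ?_ (Fk_sub_lower (by positivity) (by linarith) (by linarith) hN0)
  have h1 : (26 : ℝ) ^ (-((N : ℝ) / 2)) ≤ (‖x - y‖ ^ 2 + 4 * (x 0 + s) * (y 0 + s)) ^ (-((N : ℝ) / 2)) := by
    refine Real.rpow_le_rpow_of_nonpos ?_ ?_ (by linarith)
    · have : 0 < ‖x - y‖ ^ 2 := by positivity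
      linarith
    · nlinarith
  have h2 : 1 ≤ (4 * x 0 * y 0) ^ k := one_le_pow₀ ht1
  have h3 : 0 < (26 : ℝ) ^ (-((N : ℝ) / 2)) := by positivity
  calc 4 * s * (26 : ℝ) ^ (-((N : ℝ) / 2)) = 4 * s * (1 * (26 : ℝ) ^ (-((N : ℝ) / 2))) := by ring
    _ ≤ _ := mul_le_mul (by linarith) (mul_le_mul h2 h1 h3.le (by linarith)) (by positivity) (by linarith)

end Shift

section Decay
variable {N : ℕ} [NeZero N] {k : ℕ} {q κ M C β L : ℝ} {u : Euc N → ℝ}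

lemma gk_pos (k : ℕ) {x y : Euc N} (hx : 0 < x 0) (hy : 0 < y 0) (hxy : x ≠ y) : 0 < gk k x y := by
  have hρ : 0 < ‖x - y‖ := norm_pos_iff.2 (sub_ne_zero.2 hxy)
  have hN : (0 : ℝ) ≤ (N : ℝ) / 2 := by positivity
  have ht : 0 < 4 * x 0 * y 0 := by positivity
  rw [gk_eq_Fk]
  have hρ2 : 0 < ‖x - y‖ ^ 2 := by positivity
  have h := Fk_sub_lower (k := k) hρ2 (half_pos ht) (by linarith : 4 * x 0 * y 0 / 2 ≤ 4 * x 0 * y 0) hN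
  have h2 : 0 ≤ Fk k ((N : ℝ) / 2) (‖x - y‖ ^ 2) (4 * x 0 * y 0 / 2) := by
    rw [Fk_eq_integral (half_pos ht)]
    exact intervalIntegral.integral_nonneg (half_pos ht).le fun r hr =>
      mul_nonneg (pow_nonneg hr.1 k) (Real.rpow_nonneg (by linarith [hr.1]) _)
  have h3 : 0 < (4 * x 0 * y 0 - 4 * x 0 * y 0 / 2) *
      ((4 * x 0 * y 0 / 2) ^ k * (‖x - y‖ ^ 2 + 4 * x 0 * y 0) ^ (-((N : ℝ) / 2))) :=
    mul_pos (by linarith) (by positivity)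
  linarith

lemma IntSol.rpow_continuousOn (h : IntSol k q κ M u) : ContinuousOn (fun x => u x ^ q) {x | 0 < x 0} :=
  h.cont.rpow_const fun x hx => Or.inl (h.pos x hx).ne'

lemma IntSol.shift_continuousOn (h : IntSol k q κ M u) {s : ℝ} (hs : 0 ≤ s) :
    ContinuousOn (fun x => u (x + s • bv 0)) {x | 0 < x 0} :=
  h.cont.comp (by fun_prop) fun _ hx => shift_half hx hs

lemma integrable_decay (hβ : (N : ℝ) < β) (C : ℝ) : Integrable (fun x : Euc N => C * (1 + ‖x‖) ^ (-β)) :=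
  (integrable_one_add_norm (by simpa using hβ)).const_mul C

lemma IntSol.rpow_integrable (h : IntSol k q κ M u) (hβ : (N : ℝ) < β)
    (hdec : ∀ x : Euc N, 0 < x 0 → u x ^ q ≤ C * (1 + ‖x‖) ^ (-β)) :
    IntegrableOn (fun x => u x ^ q) {x | 0 < x 0} := by
  refine Integrable.mono' (integrable_decay hβ C).integrableOn
    (h.rpow_continuousOn.aestronglyMeasurable measurableSet_half) ?_
  filter_upwards [ae_restrict_mem measurableSet_half] with x hx
  rw [Real.norm_of_nonneg (Real.rpow_nonneg (h.pos x hx).le _)]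
  exact hdec x hx

lemma integrableOn_half_mul_bounded {g v : Euc N → ℝ} (hg : IntegrableOn g {x | 0 < x 0})
    (hv : ContinuousOn v {x | 0 < x 0}) (hv0 : ∀ x : Euc N, 0 < x 0 → 0 ≤ v x) (hvM : ∀ x : Euc N, 0 < x 0 → v x ≤ M) :
    IntegrableOn (fun x => g x * v x) {x | 0 < x 0} := by
  refine Integrable.mul_bdd (c := M) hg (hv.aestronglyMeasurable measurableSet_half) ?_
  filter_upwards [ae_restrict_mem measurableSet_half] with x hx
  rw [Real.norm_of_nonneg (hv0 x hx)]
  exact hvM x hx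

lemma IntSol.shift_gk_integrable (h : IntSol k q κ M u) {x : Euc N} (hx : 0 < x 0) {s : ℝ} (hs : 0 ≤ s) :
    IntegrableOn (fun y => gk k (x + s • bv 0) (y + s • bv 0) * u (y + s • bv 0) ^ q) {y | 0 < y 0} :=
  integrableOn_half_shift (g := fun y => gk k (x + s • bv 0) y * u y ^ q) (h.integrable _ (shift_half hx hs)) hs

lemma ae_half_ne (x : Euc N) : ∀ᵐ y ∂(volume.restrict {y : Euc N | 0 < y 0}), 0 < y 0 ∧ x ≠ y := by
  have : Nontrivial (Euc N) := ⟨bv 0, 0, ne_zero_of_half bv_half⟩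
  filter_upwards [ae_restrict_mem measurableSet_half,
    ae_restrict_of_ae (measure_eq_zero_iff_ae_notMem.1 (measure_singleton x))] with y h1 h2
  exact ⟨h1, fun h => h2 h.symm⟩

lemma IntSol.gk_shift_integrable (h : IntSol k q κ M u) {x : Euc N} (hx : 0 < x 0) {s : ℝ} (hs : 0 ≤ s) :
    IntegrableOn (fun y => gk k x y * u (y + s • bv 0) ^ q) {y | 0 < y 0} := by
  refine Integrable.mono' (h.shift_gk_integrable hx hs) ?_ ?_
  · exact (measurable_gk_right k x).aestronglyMeasurable.mul
      (((h.shift_continuousOn hs).rpow_const fun y hy => Or.inl (h.pos _ (shift_half hy hs)).ne').aestronglyMeasurable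
        measurableSet_half)
  · filter_upwards [ae_half_ne x] with y hy
    have h1 := Real.rpow_nonneg (h.pos _ (shift_half hy.1 hs)).le q
    rw [Real.norm_of_nonneg (mul_nonneg (gk_nonneg hx.le hy.1.le) h1)]
    exact mul_le_mul_of_nonneg_right (gk_le_shift k hx hy.1 hy.2 hs) h1

lemma IntSol.deficit (h : IntSol k q κ M u) {x : Euc N} (hx : 0 < x 0) {s : ℝ} (hs : 0 ≤ s) :
    ∫ y in {y : Euc N | 0 < y 0}, (gk k (x + s • bv 0) (y + s • bv 0) - gk k x y) * u (y + s • bv 0) ^ q ≤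
      κ * u (x + s • bv 0) - ∫ y in {y : Euc N | 0 < y 0}, gk k x y * u (y + s • bv 0) ^ q := by
  have hx' := shift_half hx hs
  rw [← h.eq _ hx']
  have h1 := integral_half_shift (fun y => gk k (x + s • bv 0) y * u y ^ q) s
  have h2 : ∫ y in {y : Euc N | s < y 0}, gk k (x + s • bv 0) y * u y ^ q ≤
      ∫ y in {y : Euc N | 0 < y 0}, gk k (x + s • bv 0) y * u y ^ q := by
    refine setIntegral_mono_set (h.integrable _ hx') ?_ (Eventually.of_forall fun y hy => ?_)
    · filter_upwards [ae_restrict_mem measurableSet_half] with y hy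
      exact mul_nonneg (gk_nonneg hx'.le (le_of_lt hy)) (Real.rpow_nonneg (h.pos y hy).le _)
    · exact hs.trans_lt hy
  simp only [sub_mul]
  rw [integral_sub (h.shift_gk_integrable hx hs) (h.gk_shift_integrable hx hs), h1]
  linarith

lemma IntSol.deficit_nonneg (h : IntSol k q κ M u) {x : Euc N} (hx : 0 < x 0) {s : ℝ} (hs : 0 ≤ s) :
    0 ≤ κ * u (x + s • bv 0) - ∫ y in {y : Euc N | 0 < y 0}, gk k x y * u (y + s • bv 0) ^ q := by
  refine le_trans (integral_nonneg_of_ae ?_) (h.deficit hx hs)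
  filter_upwards [ae_half_ne x] with y hy
  exact mul_nonneg (sub_nonneg.2 (gk_le_shift k hx hy.1 hy.2 hs))
    (Real.rpow_nonneg (h.pos _ (shift_half hy.1 hs)).le q)

lemma coord_of_mem_ball {ρ : ℝ} {z : Euc N} (hz : z ∈ Metric.closedBall (bv 0) ρ) : 1 - ρ ≤ z 0 := by
  rw [mem_closedBall_iff_norm] at hz
  have := (PiLp.norm_apply_le (z - bv 0) 0).trans hz
  simp only [PiLp.sub_apply, Real.norm_eq_abs, abs_le] at this
  have e : (bv (0 : Fin N)) 0 = 1 := by simp [bv]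
  rw [e] at this
  linarith

lemma ball_subset_half : Metric.ball (bv (0 : Fin N)) (1 / 2) ⊆ {x | 0 < x 0} := fun z hz => by
  have := coord_of_mem_ball (Metric.ball_subset_closedBall hz)
  change 0 < z 0
  linarith

lemma IntSol.exists_deficit (h : IntSol k q κ M u) :
    ∃ c : ℝ, 0 < c ∧ ∀ s : ℝ, 0 < s → s ≤ 1 → ∀ x ∈ Metric.ball (bv (0 : Fin N)) (1 / 2),
      c * s ≤ κ * u (x + s • bv 0) - ∫ y in {y : Euc N | 0 < y 0}, gk k x y * u (y + s • bv 0) ^ q := by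
  have hK : IsCompact (Metric.closedBall (bv (0 : Fin N)) (3 / 2) ∩ {z : Euc N | 1 / 2 ≤ z 0}) :=
    (isCompact_closedBall _ _).inter_right (isClosed_le continuous_const (by fun_prop))
  have hKH : Metric.closedBall (bv (0 : Fin N)) (3 / 2) ∩ {z : Euc N | 1 / 2 ≤ z 0} ⊆ {z | 0 < z 0} := fun z hz =>
    lt_of_lt_of_le (by norm_num : (0 : ℝ) < 1 / 2) hz.2
  have e : (bv (0 : Fin N)) 0 = 1 := by simp [bv]
  obtain ⟨z₀, hz₀, hmin⟩ := hK.exists_isMinOn ⟨bv 0, Metric.mem_closedBall_self (by norm_num), by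
    change 1 / 2 ≤ (bv (0 : Fin N)) 0; rw [e]; norm_num⟩ (h.rpow_continuousOn.mono hKH)
  have hc0 : 0 < u z₀ ^ q := Real.rpow_pos_of_pos (h.pos _ (hKH hz₀)) q
  have hv : 0 < volume.real (Metric.ball (bv (0 : Fin N)) (1 / 2)) :=
    ENNReal.toReal_pos (Metric.measure_ball_pos _ _ (by norm_num)).ne' measure_ball_lt_top.ne
  refine ⟨4 * (26 : ℝ) ^ (-((N : ℝ) / 2)) * u z₀ ^ q * volume.real (Metric.ball (bv (0 : Fin N)) (1 / 2)),
    by positivity, fun s hs hs1 x hx => ?_⟩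
  have hxH := ball_subset_half hx
  refine le_trans ?_ (h.deficit hxH hs.le)
  have hInt : IntegrableOn (fun y => (gk k (x + s • bv 0) (y + s • bv 0) - gk k x y) * u (y + s • bv 0) ^ q)
      {y | 0 < y 0} := by
    simp only [sub_mul]
    exact (h.shift_gk_integrable hxH hs.le).sub (h.gk_shift_integrable hxH hs.le)
  refine le_trans ?_ (setIntegral_mono_set hInt ?_ (Eventually.of_forall ball_subset_half))
  · have h1 : 4 * (26 : ℝ) ^ (-((N : ℝ) / 2)) * u z₀ ^ q * volume.real (Metric.ball (bv (0 : Fin N)) (1 / 2)) * s =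
        ∫ _ in Metric.ball (bv (0 : Fin N)) (1 / 2), 4 * s * (26 : ℝ) ^ (-((N : ℝ) / 2)) * u z₀ ^ q := by
      rw [setIntegral_const, smul_eq_mul]; ring
    rw [h1]
    refine integral_mono_ae (integrableOn_const measure_ball_lt_top.ne) (hInt.mono_set ball_subset_half) ?_
    have hae := ae_restrict_of_ae_restrict_of_subset ball_subset_half (ae_half_ne x)
    filter_upwards [hae, ae_restrict_mem measurableSet_ball] with y hy hyb
    have h2 : u z₀ ^ q ≤ u (y + s • bv 0) ^ q := by
      refine hmin ⟨?_, ?_⟩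
      · rw [mem_closedBall_iff_norm]
        have hb : ‖(bv 0 : Euc N)‖ = 1 := by simp [bv]
        have h3 : ‖y + s • bv 0 - bv 0‖ ≤ ‖y - bv 0‖ + ‖s • (bv 0 : Euc N)‖ := by
          rw [add_sub_right_comm]; exact norm_add_le _ _
        rw [norm_smul, hb, Real.norm_of_nonneg hs.le] at h3
        rw [mem_ball_iff_norm] at hyb
        linarith
      · have := coord_of_mem_ball (Metric.ball_subset_closedBall hyb)
        change 1 / 2 ≤ (y + s • bv 0 : Euc N) 0
        rw [add_smul_bv_zero]; linarith
    exact mul_le_mul (gk_shift_gain k hx hyb hy.2 hs hs1) h2 hc0.le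
      (sub_nonneg.2 (gk_le_shift k hxH hy.1 hy.2 hs.le))
  · filter_upwards [ae_half_ne x] with y hy
    exact mul_nonneg (sub_nonneg.2 (gk_le_shift k hxH hy.1 hy.2 hs.le))
      (Real.rpow_nonneg (h.pos _ (shift_half hy.1 hs.le)).le q)

end Decay

section Contra
variable {N : ℕ} [NeZero N] {k : ℕ} {q κ M C β L : ℝ} {u : Euc N → ℝ}

lemma IntSol.rpow_shift_aesm (h : IntSol k q κ M u) {s : ℝ} (hs : 0 ≤ s) :
    AEStronglyMeasurable (fun y => u (y + s • bv 0) ^ q) (volume.restrict {y : Euc N | 0 < y 0}) :=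
  ((h.shift_continuousOn hs).rpow_const fun _ hy => Or.inl (h.pos _ (shift_half hy hs)).ne').aestronglyMeasurable
    measurableSet_half

lemma IntSol.prod_integrable (h : IntSol k q κ M u) (hf : IntegrableOn (fun x => u x ^ q) {x | 0 < x 0})
    {s : ℝ} (hs : 0 ≤ s) :
    Integrable (fun z : Euc N × Euc N => u z.1 ^ q * (gk k z.1 z.2 * u (z.2 + s • bv 0) ^ q))
      ((volume.restrict {y : Euc N | 0 < y 0}).prod (volume.restrict {y : Euc N | 0 < y 0})) := by
  have hm : AEStronglyMeasurable (fun z : Euc N × Euc N => u z.1 ^ q * (gk k z.1 z.2 * u (z.2 + s • bv 0) ^ q))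
      ((volume.restrict {y : Euc N | 0 < y 0}).prod (volume.restrict {y : Euc N | 0 < y 0})) :=
    (h.rpow_continuousOn.aestronglyMeasurable measurableSet_half).comp_fst.mul
      ((measurable_gk k).aestronglyMeasurable.mul (h.rpow_shift_aesm hs).comp_snd)
  have hcm : ∀ x y : Euc N, u x ^ q * (gk k x y * u (y + s • bv 0) ^ q) =
      u (y + s • bv 0) ^ q * (gk k y x * u x ^ q) := fun x y => by rw [gk_comm]; ring
  refine (integrable_prod_iff' hm).2 ⟨?_, ?_⟩
  · filter_upwards [ae_restrict_mem measurableSet_half] with y hy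
    simp only [hcm]
    exact (h.integrable y hy).const_mul _
  · have h1 := integrableOn_half_mul_bounded (integrableOn_half_shift hf hs) h.cont (fun x hx => (h.pos x hx).le) h.le
    refine (h1.const_mul κ).congr ?_
    filter_upwards [ae_restrict_mem measurableSet_half] with y hy
    have h2 : ∫ x in {x : Euc N | 0 < x 0}, ‖u x ^ q * (gk k x y * u (y + s • bv 0) ^ q)‖ =
        ∫ x in {x : Euc N | 0 < x 0}, u (y + s • bv 0) ^ q * (gk k y x * u x ^ q) := by
      refine setIntegral_congr_fun measurableSet_half fun x hx => ?_
      simp only [hcm]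
      exact Real.norm_of_nonneg (mul_nonneg (Real.rpow_nonneg (h.pos _ (shift_half hy hs)).le _)
        (mul_nonneg (gk_nonneg (le_of_lt hy) (le_of_lt hx)) (Real.rpow_nonneg (h.pos x hx).le _)))
    simp only [h2, integral_const_mul, h.eq y hy]
    ring

lemma IntSol.swap (h : IntSol k q κ M u) (hf : IntegrableOn (fun x => u x ^ q) {x | 0 < x 0})
    {s : ℝ} (hs : 0 ≤ s) :
    IntegrableOn (fun x => u x ^ q * ∫ y in {y : Euc N | 0 < y 0}, gk k x y * u (y + s • bv 0) ^ q) {x | 0 < x 0} ∧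
    ∫ x in {x : Euc N | 0 < x 0}, u x ^ q * ∫ y in {y : Euc N | 0 < y 0}, gk k x y * u (y + s • bv 0) ^ q =
      κ * ∫ y in {y : Euc N | 0 < y 0}, u (y + s • bv 0) ^ q * u y := by
  have hp := h.prod_integrable hf hs
  have hcm : ∀ x y : Euc N, u x ^ q * (gk k x y * u (y + s • bv 0) ^ q) =
      u (y + s • bv 0) ^ q * (gk k y x * u x ^ q) := fun x y => by rw [gk_comm]; ring
  have hl := hp.integral_prod_left
  simp only [integral_const_mul] at hl
  refine ⟨hl, ?_⟩
  have h1 := integral_integral_swap (f := fun x y => u x ^ q * (gk k x y * u (y + s • bv 0) ^ q)) hp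
  simp only [integral_const_mul] at h1
  rw [h1, ← integral_const_mul]
  refine setIntegral_congr_fun measurableSet_half fun y hy => ?_
  simp only [hcm, integral_const_mul, h.eq y hy]
  ring

lemma IntSol.exists_lower (h : IntSol k q κ M u) (hf : IntegrableOn (fun x => u x ^ q) {x | 0 < x 0}) :
    ∃ c : ℝ, 0 < c ∧ ∀ s : ℝ, 0 < s → s ≤ 1 →
      c * s ≤ ∫ x in {x : Euc N | 0 < x 0}, (u x ^ q * u (x + s • bv 0) - u x * u (x + s • bv 0) ^ q) := by
  obtain ⟨c, hc, hdef⟩ := h.exists_deficit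
  have hκ := h.kpos
  have hI : 0 < ∫ x in Metric.ball (bv (0 : Fin N)) (1 / 2), u x ^ q := by
    refine (setIntegral_pos_iff_support_of_nonneg_ae ?_ (hf.mono_set ball_subset_half)).2 ?_
    · filter_upwards [ae_restrict_mem measurableSet_ball] with x hx
      exact Real.rpow_nonneg (h.pos x (ball_subset_half hx)).le _
    · refine lt_of_lt_of_le (Metric.measure_ball_pos volume (bv (0 : Fin N)) (by norm_num : (0 : ℝ) < 1 / 2))
        (measure_mono fun x hx => ⟨(Real.rpow_pos_of_pos (h.pos x (ball_subset_half hx)) q).ne', hx⟩)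
  refine ⟨c * (∫ x in Metric.ball (bv (0 : Fin N)) (1 / 2), u x ^ q) / κ, by positivity, fun s hs hs1 => ?_⟩
  obtain ⟨i1, e1⟩ := h.swap hf hs.le
  have i2 : IntegrableOn (fun x => u x ^ q * u (x + s • bv 0)) {x | 0 < x 0} :=
    integrableOn_half_mul_bounded hf (h.shift_continuousOn hs.le) (fun x hx => (h.pos _ (shift_half hx hs.le)).le)
      (fun x hx => h.le _ (shift_half hx hs.le))
  have i3 : IntegrableOn (fun x => u (x + s • bv 0) ^ q * u x) {x | 0 < x 0} :=
    integrableOn_half_mul_bounded (integrableOn_half_shift hf hs.le) h.cont (fun x hx => (h.pos x hx).le) h.le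
  have i3' : IntegrableOn (fun x => u x * u (x + s • bv 0) ^ q) {x | 0 < x 0} := by simpa only [mul_comm] using i3
  have i4 : IntegrableOn (fun x => u x ^ q * (κ * u (x + s • bv 0) -
      ∫ y in {y : Euc N | 0 < y 0}, gk k x y * u (y + s • bv 0) ^ q)) {x | 0 < x 0} := by
    refine ((i2.const_mul κ).sub i1).congr (Eventually.of_forall fun x => ?_)
    simp only [Pi.sub_apply]
    ring
  have e2 : κ * ∫ x in {x : Euc N | 0 < x 0}, (u x ^ q * u (x + s • bv 0) - u x * u (x + s • bv 0) ^ q) =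
      ∫ x in {x : Euc N | 0 < x 0}, u x ^ q * (κ * u (x + s • bv 0) -
        ∫ y in {y : Euc N | 0 < y 0}, gk k x y * u (y + s • bv 0) ^ q) := by
    rw [integral_sub i2 i3', mul_sub]
    simp only [mul_sub]
    have i2' : IntegrableOn (fun x => u x ^ q * (κ * u (x + s • bv 0))) {x | 0 < x 0} :=
      (i2.const_mul κ).congr (Eventually.of_forall fun x => by simp only; ring)
    rw [integral_sub i2' i1, e1, ← integral_const_mul]
    simp only [mul_comm, mul_left_comm]
  have e3 : c * (∫ x in Metric.ball (bv (0 : Fin N)) (1 / 2), u x ^ q) * s ≤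
      ∫ x in {x : Euc N | 0 < x 0}, u x ^ q * (κ * u (x + s • bv 0) -
        ∫ y in {y : Euc N | 0 < y 0}, gk k x y * u (y + s • bv 0) ^ q) := by
    refine le_trans ?_ (setIntegral_mono_set i4 ?_ (Eventually.of_forall ball_subset_half))
    · have : c * (∫ x in Metric.ball (bv (0 : Fin N)) (1 / 2), u x ^ q) * s =
          ∫ x in Metric.ball (bv (0 : Fin N)) (1 / 2), u x ^ q * (c * s) := by
        rw [integral_mul_const]; ring
      rw [this]
      refine setIntegral_mono_on ((hf.mono_set ball_subset_half).mul_const _) (i4.mono_set ball_subset_half)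
        measurableSet_ball fun x hx => ?_
      exact mul_le_mul_of_nonneg_left (hdef s hs hs1 x hx) (Real.rpow_nonneg (h.pos x (ball_subset_half hx)).le _)
    · filter_upwards [ae_restrict_mem measurableSet_half] with x hx
      exact mul_nonneg (Real.rpow_nonneg (h.pos x hx).le _) (h.deficit_nonneg hx hs.le)
  rw [← e2] at e3
  rw [div_mul_eq_mul_div, div_le_iff₀ hκ]
  linarith

lemma IntSol.upper (h : IntSol k q κ M u) (hq : 1 < q) (hL : 0 ≤ L)
    (hf : IntegrableOn (fun x => u x ^ q) {x | 0 < x 0})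
    (hLip : ∀ x : Euc N, 0 < x 0 → ∀ s : ℝ, 0 < s → |u (x + s • bv 0) - u x| ≤ L * s)
    (hbd : ∀ x : Euc N, 0 < x 0 → u x ≤ L * x 0) {s : ℝ} (hs : 0 < s) :
    ∫ x in {x : Euc N | 0 < x 0}, (u x ^ q * u (x + s • bv 0) - u x * u (x + s • bv 0) ^ q) ≤
      L * s * ∫ x in {x : Euc N | 0 < x 0},
        ({x : Euc N | x 0 ≤ s}.indicator (fun x => u x ^ q) x + |u x ^ q - u (x + s • bv 0) ^ q|) := by
  have hfs := integrableOn_half_shift hf hs.le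
  have hm : MeasurableSet {x : Euc N | x 0 ≤ s} := (isClosed_le (by fun_prop) continuous_const).measurableSet
  have hm' : MeasurableSet {x : Euc N | s < x 0} := (isOpen_lt continuous_const (by fun_prop)).measurableSet
  have hpos' : ∀ x : Euc N, 0 < x 0 → 0 < u (x + s • bv 0) := fun x hx => h.pos _ (shift_half hx hs.le)
  have i2 : IntegrableOn (fun x => u x ^ q * u (x + s • bv 0)) {x | 0 < x 0} :=
    integrableOn_half_mul_bounded hf (h.shift_continuousOn hs.le) (fun x hx => (hpos' x hx).le)
      (fun x hx => h.le _ (shift_half hx hs.le))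
  have i3 : IntegrableOn (fun x => u (x + s • bv 0) ^ q * u x) {x | 0 < x 0} :=
    integrableOn_half_mul_bounded hfs h.cont (fun x hx => (h.pos x hx).le) h.le
  have i1 : IntegrableOn (fun x => u x ^ q * u x) {x | 0 < x 0} :=
    integrableOn_half_mul_bounded hf h.cont (fun x hx => (h.pos x hx).le) h.le
  have i4 : IntegrableOn (fun x => u (x + s • bv 0) ^ q * u (x + s • bv 0)) {x | 0 < x 0} :=
    integrableOn_half_mul_bounded hfs (h.shift_continuousOn hs.le) (fun x hx => (hpos' x hx).le)
      (fun x hx => h.le _ (shift_half hx hs.le))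
  have i5 : IntegrableOn (fun x => u x ^ q * u (x + s • bv 0) - u x * u (x + s • bv 0) ^ q) {x | 0 < x 0} :=
    i2.sub (by simpa only [mul_comm] using i3)
  have i6 : IntegrableOn (fun x => u x ^ q * u x - u (x + s • bv 0) ^ q * u (x + s • bv 0)) {x | 0 < x 0} := i1.sub i4
  have i7 : IntegrableOn (fun x => |u x ^ q - u (x + s • bv 0) ^ q|) {x | 0 < x 0} := (hf.sub hfs).abs
  have i8 : IntegrableOn ({x : Euc N | x 0 ≤ s}.indicator (fun x => u x ^ q)) {x | 0 < x 0} := hf.indicator hm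
  have hθ : 0 ≤ (q - 1) / (q + 1) := div_nonneg (by linarith) (by linarith)
  have hθ1 : (q - 1) / (q + 1) ≤ 1 := (div_le_one (by linarith)).2 (by linarith)
  have s1 : ∫ x in {x : Euc N | 0 < x 0}, (u x ^ q * u x - u (x + s • bv 0) ^ q * u (x + s • bv 0)) ≤
      L * s * ∫ x in {x : Euc N | 0 < x 0}, {x : Euc N | x 0 ≤ s}.indicator (fun x => u x ^ q) x := by
    rw [integral_sub i1 i4, integral_half_shift (fun x => u x ^ q * u x) s]
    have e : ∫ x in {x : Euc N | s < x 0}, u x ^ q * u x =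
        ∫ x in {x : Euc N | 0 < x 0}, {x : Euc N | s < x 0}.indicator (fun x => u x ^ q * u x) x := by
      rw [setIntegral_indicator hm']
      congr 2
      ext x
      exact ⟨fun hx => ⟨hs.trans hx, hx⟩, fun hx => hx.2⟩
    rw [e, ← integral_sub i1 (i1.indicator hm'), ← integral_const_mul]
    refine setIntegral_mono_on (i1.sub (i1.indicator hm')) (i8.const_mul _) measurableSet_half fun x hx => ?_
    by_cases hxs : x 0 ≤ s
    · rw [indicator_of_notMem (show x ∉ {x : Euc N | s < x 0} from not_lt.2 hxs),
        indicator_of_mem (show x ∈ {x : Euc N | x 0 ≤ s} from hxs), sub_zero, mul_comm]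
      exact mul_le_mul_of_nonneg_right ((hbd x hx).trans (mul_le_mul_of_nonneg_left hxs hL))
        (Real.rpow_nonneg (h.pos x hx).le _)
    · rw [indicator_of_mem (show x ∈ {x : Euc N | s < x 0} from not_le.1 hxs),
        indicator_of_notMem (show x ∉ {x : Euc N | x 0 ≤ s} from hxs), sub_self, mul_zero]
  have s2 : 0 ≤ L * s * ∫ x in {x : Euc N | 0 < x 0}, {x : Euc N | x 0 ≤ s}.indicator (fun x => u x ^ q) x := by
    refine mul_nonneg (by positivity) (setIntegral_nonneg measurableSet_half fun x hx => ?_)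
    exact indicator_apply_nonneg fun _ => Real.rpow_nonneg (h.pos x hx).le _
  rw [integral_add i8 i7, mul_add]
  refine le_trans (setIntegral_mono_on i5 ((i6.const_mul ((q - 1) / (q + 1))).add (i7.const_mul (L * s)))
    measurableSet_half fun x hx => ?_) ?_
  · refine (rpow_mul_sub_le (h.pos x hx) (hpos' x hx) hq).trans ?_
    refine add_le_add le_rfl ?_
    have h1 := hLip x hx s hs
    rw [abs_sub_comm] at h1
    calc _ ≤ |(u x ^ q - u (x + s • bv 0) ^ q) * (u x - u (x + s • bv 0))| := le_abs_self _
      _ = |u x - u (x + s • bv 0)| * |u x ^ q - u (x + s • bv 0) ^ q| := by rw [abs_mul, mul_comm]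
      _ ≤ _ := mul_le_mul_of_nonneg_right h1 (abs_nonneg _)
  · rw [integral_add' (i6.const_mul _) (i7.const_mul _), integral_const_mul, integral_const_mul]
    refine add_le_add ?_ le_rfl
    exact (mul_le_mul_of_nonneg_left s1 hθ).trans (mul_le_of_le_one_left s2 hθ1)

lemma IntSol.tendsto_shift (h : IntSol k q κ M u) (hβ : (N : ℝ) < β)
    (hdec : ∀ x : Euc N, 0 < x 0 → u x ^ q ≤ C * (1 + ‖x‖) ^ (-β)) :
    Tendsto (fun s : ℝ => ∫ x in {x : Euc N | 0 < x 0},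
      ({x : Euc N | x 0 ≤ s}.indicator (fun x => u x ^ q) x + |u x ^ q - u (x + s • bv 0) ^ q|)) (𝓝[>] 0) (𝓝 0) := by
  have hfc := h.rpow_continuousOn
  have key := tendsto_integral_filter_of_dominated_convergence (l := 𝓝[>] (0 : ℝ))
    (μ := volume.restrict {x : Euc N | 0 < x 0}) (f := fun _ => (0 : ℝ))
    (F := fun (s : ℝ) (x : Euc N) =>
      {x : Euc N | x 0 ≤ s}.indicator (fun x => u x ^ q) x + |u x ^ q - u (x + s • bv 0) ^ q|)
    (fun x => 3 * (C * (1 + ‖x‖) ^ (-β))) ?_ ?_ ((integrable_decay hβ C).const_mul 3).integrableOn ?_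
  · simpa using key
  · filter_upwards [self_mem_nhdsWithin] with s hs
    have hs : 0 < s := hs
    have hm : MeasurableSet {x : Euc N | x 0 ≤ s} := (isClosed_le (by fun_prop) continuous_const).measurableSet
    have m1 := hfc.aestronglyMeasurable (μ := volume) measurableSet_half
    exact (m1.indicator hm).add (m1.sub (h.rpow_shift_aesm hs.le)).norm
  · filter_upwards [self_mem_nhdsWithin] with s hs
    have hs : 0 < s := hs
    filter_upwards [ae_restrict_mem measurableSet_half] with x hx
    have hx : 0 < x 0 := hx
    have a1 := Real.rpow_nonneg (h.pos x hx).le q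
    have a2 := Real.rpow_nonneg (h.pos _ (shift_half hx hs.le)).le q
    have a3 := hdec x hx
    have hβ0 : 0 < β := lt_of_le_of_lt (Nat.cast_nonneg N) hβ
    have hC : 0 ≤ C := by
      have : 0 < (1 + ‖x‖) ^ (-β) := by positivity
      by_contra hC
      have := mul_neg_of_neg_of_pos (not_le.1 hC) this
      linarith
    have a4 : u (x + s • bv 0) ^ q ≤ C * (1 + ‖x‖) ^ (-β) := by
      refine (hdec _ (shift_half hx hs.le)).trans (mul_le_mul_of_nonneg_left ?_ hC)
      exact Real.rpow_le_rpow_of_nonpos (by positivity) (by linarith [norm_le_norm_shift hx hs.le]) (by linarith)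
    have a5 : {x : Euc N | x 0 ≤ s}.indicator (fun x => u x ^ q) x ≤ u x ^ q := indicator_le_self' (fun _ _ => a1) x
    have a6 : 0 ≤ {x : Euc N | x 0 ≤ s}.indicator (fun x => u x ^ q) x := indicator_apply_nonneg fun _ => a1
    have a7 : |u x ^ q - u (x + s • bv 0) ^ q| ≤ u x ^ q + u (x + s • bv 0) ^ q := by
      rw [abs_le]; constructor <;> linarith
    rw [Real.norm_of_nonneg (add_nonneg a6 (abs_nonneg _))]
    linarith
  · filter_upwards [ae_restrict_mem measurableSet_half] with x hx
    have hx : 0 < x 0 := hx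
    have e : (0 : ℝ) + |u x ^ q - u x ^ q| = 0 := by simp
    suffices h0 : Tendsto (fun s : ℝ => {x : Euc N | x 0 ≤ s}.indicator (fun x => u x ^ q) x +
        |u x ^ q - u (x + s • bv 0) ^ q|) (𝓝[>] 0) (𝓝 (0 + |u x ^ q - u x ^ q|)) by rwa [e] at h0
    refine Tendsto.add ?_ ?_
    · refine tendsto_const_nhds.congr' ?_
      filter_upwards [nhdsWithin_le_nhds (Iio_mem_nhds hx)] with s hs
      rw [indicator_of_notMem (show x ∉ {x : Euc N | x 0 ≤ s} from not_le.2 (mem_Iio.1 hs))]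
    · refine (tendsto_const_nhds.sub ?_).abs
      have hca : ContinuousAt (fun x => u x ^ q) x := hfc.continuousAt (isOpen_half.mem_nhds hx)
      have ht : Tendsto (fun s : ℝ => x + s • (bv 0 : Euc N)) (𝓝[>] 0) (𝓝 x) := by
        have : Continuous fun s : ℝ => x + s • (bv 0 : Euc N) := by fun_prop
        simpa using (this.tendsto 0).mono_left nhdsWithin_le_nhds
      exact hca.tendsto.comp ht

theorem decay_contra (h : IntSol k q κ M u) (hq : 1 < q) (hL : 0 ≤ L)
    (hLip : ∀ x : Euc N, 0 < x 0 → ∀ s : ℝ, 0 < s → |u (x + s • bv 0) - u x| ≤ L * s)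
    (hbd : ∀ x : Euc N, 0 < x 0 → u x ≤ L * x 0) (hβ : (N : ℝ) < β)
    (hdec : ∀ x : Euc N, 0 < x 0 → u x ^ q ≤ C * (1 + ‖x‖) ^ (-β)) : False := by
  have hf := h.rpow_integrable hβ hdec
  obtain ⟨c, hc, hlow⟩ := h.exists_lower hf
  have ht := (h.tendsto_shift hβ hdec).const_mul L
  rw [mul_zero] at ht
  have hev := (ht.eventually_lt_const hc).and (Ioo_mem_nhdsGT (zero_lt_one (α := ℝ)))
  obtain ⟨s, hs, hs0, hs1⟩ := hev.exists
  have h1 := (hlow s hs0 hs1.le).trans (h.upper hq hL hf hLip hbd hs0)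
  rw [mul_right_comm] at h1
  exact absurd (le_of_mul_le_mul_right h1 hs0) (not_le.2 hs)

end Contra

section Final
variable {N : ℕ} [NeZero N] {k : ℕ} {q κ M r : ℝ} {u : Euc N → ℝ}

lemma IsBCSol.eq_zero_of_boundary (hsol : IsBCSol N (k + 1) q u) {x : Euc N} (hx : x 0 = 0) : u x = 0 := by
  have := hsol.2.2.2.2 0 (by omega) x hx
  simpa using this

lemma convex_closed_half : Convex ℝ {x : Euc N | 0 ≤ x 0} := fun x hx y hy a b ha hb _ => by
  have hx : 0 ≤ x 0 := hx
  have hy : 0 ≤ y 0 := hy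
  change 0 ≤ (a • x + b • y : Euc N) 0
  simp only [PiLp.add_apply, PiLp.smul_apply, smul_eq_mul]
  positivity

lemma IsBCSol.exists_lipschitz (hsol : IsBCSol N (k + 1) q u) :
    ∃ L : ℝ, 0 ≤ L ∧ ∀ x : Euc N, 0 ≤ x 0 → ∀ y : Euc N, 0 ≤ y 0 → |u y - u x| ≤ L * ‖y - x‖ := by
  obtain ⟨L, hL⟩ := hsol.2.2.1 1 (by omega)
  refine ⟨L, (norm_nonneg _).trans (hL 0 (by simp)), fun x hx y hy => ?_⟩
  have hd : DifferentiableOn ℝ u {x : Euc N | 0 ≤ x 0} :=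
    hsol.2.1.differentiableOn (by
      have : 2 * (k + 1) - 1 ≠ 0 := by omega
      exact_mod_cast this)
  refine convex_closed_half.norm_image_sub_le_of_norm_fderivWithin_le hd (fun z hz => ?_) hx hy
  have hz' := hL z hz
  have hU : UniqueDiffOn ℝ {y : Euc N | 0 ≤ y 0} := by
    refine uniqueDiffOn_convex convex_closed_half ⟨bv 0, ?_⟩
    exact mem_interior.2 ⟨{x | 0 < x 0}, fun x (hx : 0 < x 0) => hx.le, isOpen_half, bv_half⟩
  rwa [norm_iteratedFDerivWithin_one _ (hU z hz)] at hz'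

lemma IntSol.le_of_eq_kelv (h : IntSol k q κ M u) (hr : 0 < r) (hα : 0 < (N : ℝ) - 2 * ((k : ℝ) + 1))
    (hk : ∀ x ∈ hball N r, u x = kelv k r u x) {x : Euc N} (hx : 0 < x 0) :
    u x ≤ M * ((1 + r) / (1 + ‖x‖)) ^ ((N : ℝ) - 2 * ((k : ℝ) + 1)) := by
  have hxp := norm_pos_iff.2 (ne_zero_of_half hx)
  have hM : 0 < M := (h.pos x hx).trans_le (h.le x hx)
  rcases le_or_gt ‖x‖ r with hxr | hxr
  · have h1 : 1 ≤ (1 + r) / (1 + ‖x‖) := (one_le_div (by positivity)).2 (by linarith)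
    have h2 := Real.one_le_rpow h1 hα.le
    exact (h.le x hx).trans (le_mul_of_one_le_right hM.le h2)
  · have hz := sinv_half hr hx
    have hzn : ‖sinv r x‖ = r ^ 2 / ‖x‖ := norm_sinv x (ne_zero_of_half hx)
    have hzr : sinv r x ∈ hball N r := ⟨hz, by rw [hzn, div_lt_iff₀ hxp]; nlinarith⟩
    have h1 := hk _ hzr
    have h2 : r / ‖sinv r x‖ = (r / ‖x‖)⁻¹ := by rw [hzn]; field_simp
    rw [kelv, sinv_sinv hr.ne', h2, Real.inv_rpow (by positivity)] at h1
    have hp : 0 < (r / ‖x‖) ^ ((N : ℝ) - 2 * ((k : ℝ) + 1)) := by positivity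
    have h3 : u x = (r / ‖x‖) ^ ((N : ℝ) - 2 * ((k : ℝ) + 1)) * u (sinv r x) := by
      rw [h1, mul_inv_cancel_left₀ hp.ne']
    rw [h3, mul_comm]
    refine mul_le_mul (h.le _ hz) (Real.rpow_le_rpow (by positivity) ?_ hα.le) hp.le hM.le
    rw [div_le_div_iff₀ hxp (by positivity)]
    linarith

lemma IntSol.not_kelv_invariant (h : IntSol k q κ M u) (hq : 1 < q) {L : ℝ} (hL : 0 ≤ L)
    (hLip : ∀ x : Euc N, 0 < x 0 → ∀ s : ℝ, 0 < s → |u (x + s • bv 0) - u x| ≤ L * s)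
    (hbd : ∀ x : Euc N, 0 < x 0 → u x ≤ L * x 0) (hτ : tauExp N k q = 0) (hr : 0 < r)
    (hk : ∀ x ∈ hball N r, u x = kelv k r u x) : False := by
  have e : q * ((N : ℝ) - 2 * ((k : ℝ) + 1)) = (N : ℝ) + 2 * ((k : ℝ) + 1) := by
    unfold tauExp at hτ; linarith
  have hα : 0 < (N : ℝ) - 2 * ((k : ℝ) + 1) := by
    refine pos_of_mul_pos_right (a := q) ?_ (by linarith)
    rw [e]; positivity
  have hM : 0 < M := h.M_pos
  refine decay_contra (β := q * ((N : ℝ) - 2 * ((k : ℝ) + 1)))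
    (C := M ^ q * (1 + r) ^ (q * ((N : ℝ) - 2 * ((k : ℝ) + 1)))) h hq hL hLip hbd ?_ fun x hx => ?_
  · rw [e]
    have : (0 : ℝ) < 2 * ((k : ℝ) + 1) := by positivity
    linarith
  · have h1 := Real.rpow_le_rpow (h.pos x hx).le (h.le_of_eq_kelv hr hα hk hx) (by linarith : 0 ≤ q)
    refine h1.trans_eq ?_
    rw [Real.mul_rpow hM.le (by positivity), ← Real.rpow_mul (by positivity), mul_comm _ q,
      Real.div_rpow (by positivity) (by positivity), Real.rpow_neg (by positivity)]
    ring

lemma IsBCSol.eq_zero_of_exists_zero (hsol : IsBCSol N (k + 1) q u) (hq : 0 < q)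
    (hpos : ∀ x : Euc N, 0 ≤ x 0 → 0 ≤ u x) {x₀ : Euc N} (hx₀ : 0 < x₀ 0) (h0 : u x₀ = 0)
    {x : Euc N} (hx : 0 < x 0) : u x = 0 := by
  obtain ⟨i0, e0⟩ := integral_rep hsol hq.le hpos hx₀
  obtain ⟨-, e1⟩ := integral_rep hsol hq.le hpos hx
  rw [h0, mul_zero, setIntegral_eq_zero_iff_of_nonneg_ae ?_ i0] at e0
  · have : ∫ y in {y : Euc N | 0 < y 0}, gk k x y * u y ^ q = 0 := by
      refine integral_eq_zero_of_ae ?_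
      filter_upwards [e0, ae_half_ne x₀] with y hy hy'
      have := (gk_pos k hx₀ hy'.1 hy'.2).ne'
      have hz : u y ^ q = 0 := (mul_eq_zero.1 hy).resolve_left this
      simp [hz]
    rw [this] at e1
    exact (mul_eq_zero.1 e1.symm).resolve_left (kap_pos k).ne'
  · filter_upwards [ae_restrict_mem measurableSet_half] with y hy
    exact mul_nonneg (gk_nonneg hx₀.le (le_of_lt hy)) (Real.rpow_nonneg (hpos y (le_of_lt hy)) _)

lemma IsBCSol.not_pos (hsol : IsBCSol N (k + 1) q u) (hq : 1 < q) (hτ : 0 ≤ tauExp N k q)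
    (hnn : ∀ x : Euc N, 0 ≤ x 0 → 0 ≤ u x) : ¬ ∀ x : Euc N, 0 < x 0 → 0 < u x := fun hpos => by
  obtain ⟨M, -, hM⟩ := hsol.exists_bound
  obtain ⟨L, hL, hLip⟩ := hsol.exists_lipschitz
  have h : IntSol k q (kap N k) M u :=
    { kpos := kap_pos k
      cont := hsol.1.continuousOn
      pos := hpos
      le := fun x hx => (le_abs_self _).trans (hM x (le_of_lt hx))
      integrable := fun x hx => (integral_rep hsol (by linarith) hnn hx).1
      eq := fun x hx => (integral_rep hsol (by linarith) hnn hx).2 }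
  have hb1 : ‖(bv 0 : Euc N)‖ = 1 := by simp [bv]
  refine not_forall_belowKelv h (by linarith) fun b hb => ?_
  rcases moving_spheres (h.translate hb) hq hτ with h1 | ⟨hτ0, r, hr, hk⟩
  · exact h1
  · refine ((h.translate hb).not_kelv_invariant hq hL (fun x hx s hs => ?_) (fun x hx => ?_) hτ0 hr hk).elim
    · have hx1 : 0 ≤ (x + b : Euc N) 0 := by simp only [PiLp.add_apply, hb]; linarith
      have hx2 : 0 ≤ (x + s • bv 0 + b : Euc N) 0 := by
        have := shift_half hx hs.le
        simp only [PiLp.add_apply, hb] at this ⊢; linarith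
      have := hLip _ hx1 _ hx2
      rwa [show x + s • bv 0 + b - (x + b) = s • (bv 0 : Euc N) by abel, norm_smul, hb1, mul_one,
        Real.norm_of_nonneg hs.le] at this
    · have hx1 : 0 ≤ (x + b : Euc N) 0 := by simp only [PiLp.add_apply, hb]; linarith
      have e : (x + b - x 0 • bv 0 : Euc N) 0 = 0 := by simp [bv, hb]
      have := hLip _ e.ge _ hx1
      rw [hsol.eq_zero_of_boundary e, sub_zero, sub_sub_cancel, norm_smul, hb1, mul_one,
        Real.norm_of_nonneg hx.le] at this
      exact (le_abs_self _).trans this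

end Final

/-- Liouville theorem on the half-space: a nonnegative bounded classical solution of the
Dirichlet problem `(-Δ)^m u = u^q` on `ℝ^N_+`, with `q > 1` (and `q ≤ (N+2m)/(N-2m)` if
`N > 2m`), vanishes identically. -/
theorem stmt_1 {N m : ℕ} [NeZero N] (hm : 0 < m) (q : ℝ)
    (hq1 : 1 < q) (hq2 : 2 * m < N → q ≤ ((N : ℝ) + 2 * m) / ((N : ℝ) - 2 * m))
    (u : EuclideanSpace ℝ (Fin N) → ℝ)
    (hsol : IsBCSol N m q u)
    (hpos : ∀ x : EuclideanSpace ℝ (Fin N), 0 ≤ x 0 → 0 ≤ u x) :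
    ∀ x : EuclideanSpace ℝ (Fin N), 0 ≤ x 0 → u x = 0 := by
  obtain ⟨k, rfl⟩ := Nat.exists_eq_succ_of_ne_zero hm.ne'
  intro x hx
  have hτ : 0 ≤ tauExp N k q := by
    unfold tauExp
    rcases lt_or_ge (2 * (k + 1)) N with hN | hN
    · have h1 := hq2 hN
      have hN' : 2 * ((k : ℝ) + 1) < N := by exact_mod_cast hN
      push_cast at h1
      rw [le_div_iff₀ (by linarith)] at h1
      linarith
    · have hN' : (N : ℝ) ≤ 2 * ((k : ℝ) + 1) := by exact_mod_cast hN
      have : q * ((N : ℝ) - 2 * ((k : ℝ) + 1)) ≤ 0 :=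
        mul_nonpos_of_nonneg_of_nonpos (by linarith) (by linarith)
      have : 0 ≤ (N : ℝ) + 2 * ((k : ℝ) + 1) := by positivity
      linarith
  have hnot := hsol.not_pos hq1 hτ hpos
  push Not at hnot
  obtain ⟨x₀, hx₀, h0⟩ := hnot
  rcases hx.eq_or_lt with hx0 | hx0
  · exact hsol.eq_zero_of_boundary hx0.symm
  · exact hsol.eq_zero_of_exists_zero (by linarith) hpos hx₀ (le_antisymm h0 (hpos x₀ hx₀.le)) hx0
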